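/- arXiv:2404.10672 — 2 statements merged into one kernel-verified Lean document; each statement's English description precedes it below -/
import Mathlib

section
/- Let K be a field and let H be a compact graph. Then the projective dimension of the edge ring K[H] as a module over the polynomial ring K[E(H)] equals t(H) − 1, where t(H) is the number of minimal cycles of H. -/
open CategoryTheory MvPolynomial Finset
open scoped Classical

noncomputable section

namespace Paper

/-- The monomial `x_u * x_v` associated to an unordered pair `{u, v}` of vertices. -/
def edgeMon (K : Type*) [CommRing K] {V : Type*} (e : Sym2 V) : MvPolynomial V K :=
  Sym2.lift ⟨fun u v => X u * X v, fun u v => mul_comm _ _⟩ e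

/-- The `K`-algebra map `K[E(G)] → K[V(G)]` sending the variable of an edge `{u,v}` to
`x_u * x_v`. -/
def edgeHom (K : Type*) [CommRing K] {V : Type*} (G : SimpleGraph V) :
    MvPolynomial G.edgeSet K →ₐ[K] MvPolynomial V K :=
  aeval (fun e => edgeMon K (e : Sym2 V))

/-- The toric ideal of a simple graph. -/
def toricIdeal (K : Type*) [CommRing K] {V : Type*} (G : SimpleGraph V) :
    Ideal (MvPolynomial G.edgeSet K) :=
  RingHom.ker (edgeHom K G).toRingHom

/-- The edge ring `K[G] = K[E(G)]/I_G`. -/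
abbrev edgeRing (K : Type*) [CommRing K] {V : Type*} (G : SimpleGraph V) :=
  MvPolynomial G.edgeSet K ⧸ toricIdeal K G

open CategoryTheory.Limits in
/-- The projective dimension of a module, as an element of `ℕ∞`:  the least `n` such that `M`
admits a projective resolution vanishing in homological degrees `> n` (or `⊤` if there is
no such finite resolution). -/
def projDim (R : Type*) [CommRing R] (M : ModuleCat R) : ℕ∞ :=
  sInf {n : ℕ∞ | ∃ m : ℕ, (m : ℕ∞) = n ∧
    ∃ P : ProjectiveResolution M, ∀ i : ℕ, m < i → IsZero (P.complex.X i)}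

/-- The 0-1 vector `ε_u + ε_v` attached to an unordered pair `{u,v}` with `u ≠ v`. -/
def edgeVec {V : Type*} (e : Sym2 V) : V → ℝ :=
  fun v => if v ∈ e then 1 else 0

/-- The edge cone of a finite simple graph: all nonnegative real combinations of the vectors
`v_e = ε_u + ε_v`, for `e = {u,v}` an edge of `G`. -/
def edgeCone {V : Type*} [Fintype V] (G : SimpleGraph V) : Set (V → ℝ) :=
  {x | ∃ a : Sym2 V → ℝ, (∀ e, 0 ≤ a e) ∧ (∀ e, e ∉ G.edgeSet → a e = 0) ∧
    x = ∑ e : Sym2 V, a e • edgeVec e}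

/-- A vector has integer coordinates. -/
def IsIntegralVec {V : Type*} (x : V → ℝ) : Prop := ∀ v, ∃ n : ℤ, x v = n

/-- A minimal vector of `relint(ℝ₊(G)) ∩ ℤ^{V(G)}`. -/
def IsMinimalVec {V : Type*} [Fintype V] (G : SimpleGraph V) (x : V → ℝ) : Prop :=
  x ∈ intrinsicInterior ℝ (edgeCone G) ∧ IsIntegralVec x ∧
    ¬ ∃ y z : V → ℝ, (y ∈ intrinsicInterior ℝ (edgeCone G) ∧ IsIntegralVec y) ∧
      (z ∈ edgeCone G ∧ IsIntegralVec z ∧ z ≠ 0) ∧ x = y + z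

/-! ### Multi-path graphs.  `c i` is the number of interior vertices of the `i`-th path,
so the `i`-th path has length `c i + 1`. -/

/-- Vertices of the multi-path graph: `Sum.inl 0 = v1`, `Sum.inl 1 = v2`, and
`Sum.inr ⟨i, j⟩ = u_{i,j+1}`, the `(j+1)`-st interior vertex of the `i`-th path. -/
abbrev MPV {m : ℕ} (c : Fin m → ℕ) : Type := Fin 2 ⊕ (Σ i : Fin m, Fin (c i))

def mpRel {m : ℕ} (c : Fin m → ℕ) : MPV c → MPV c → Prop
  | Sum.inl a, Sum.inr ⟨i, j⟩ => (a = 0 ∧ (j : ℕ) = 0) ∨ (a = 1 ∧ (j : ℕ) + 1 = c i)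
  | Sum.inr ⟨i, j⟩, Sum.inr ⟨i', j'⟩ => (i : ℕ) = i' ∧ (j' : ℕ) = (j : ℕ) + 1
  | _, _ => False

/-- The multi-path graph with `m` paths, the `i`-th of which has `c i` interior vertices
(hence length `c i + 1`), all starting at `v1 = Sum.inl 0` and ending at `v2 = Sum.inl 1`. -/
def multiPath {m : ℕ} (c : Fin m → ℕ) : SimpleGraph (MPV c) :=
  SimpleGraph.fromRel (mpRel c)

/-! ### The two-ear graph `G_m` and the one-ear graph `P_m`. -/

/-- Vertices of the two-ear graph:  `Sum.inl 0 = v1`, `Sum.inl 1 = v2`, `Sum.inl 2 = x1`,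
`Sum.inl 3 = x2`, `Sum.inl 4 = y1`, `Sum.inl 5 = y2`, and `Sum.inr i = u_{i+1}`. -/
abbrev TEV (m : ℕ) : Type := Fin 6 ⊕ Fin (m - 1)

def teRel (m : ℕ) : TEV m → TEV m → Prop
  | Sum.inl a, Sum.inl b =>
      (a = 0 ∧ b = 2) ∨ (a = 0 ∧ b = 3) ∨ (a = 2 ∧ b = 3) ∨ (a = 1 ∧ b = 4) ∨
      (a = 1 ∧ b = 5) ∨ (a = 4 ∧ b = 5) ∨ (a = 2 ∧ b = 4)
  | Sum.inl a, Sum.inr _ => a = 0 ∨ a = 1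
  | _, _ => False

/-- The two-ear graph `𝐆_m`. -/
def twoEar (m : ℕ) : SimpleGraph (TEV m) := SimpleGraph.fromRel (teRel m)

/-- The one-ear graph `𝐏_m`, the induced subgraph of `𝐆_m` on the complement of `x2`. -/
def oneEar (m : ℕ) : SimpleGraph ({v : TEV m | v ≠ Sum.inl 3} : Set (TEV m)) :=
  (twoEar m).induce {v : TEV m | v ≠ Sum.inl 3}

/-! ### Cycles, the odd-cycle condition, and compact graphs. -/

/-- The odd-cycle condition: any two vertex-disjoint odd cycles are joined by an edge. -/
def OddCycleCondition {V : Type*} (G : SimpleGraph V) : Prop :=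
  ∀ (a b : V) (c₁ : G.Walk a a) (c₂ : G.Walk b b), c₁.IsCycle → c₂.IsCycle →
    Odd c₁.length → Odd c₂.length →
    (∀ x, x ∈ c₁.support → x ∉ c₂.support) →
    ∃ x ∈ c₁.support, ∃ y ∈ c₂.support, G.Adj x y

/-- `G` has no even cycle. -/
def HasNoEvenCycle {V : Type*} (G : SimpleGraph V) : Prop :=
  ∀ (a : V) (c : G.Walk a a), c.IsCycle → ¬ Even c.length

/-- A compact graph: connected, all degrees at least `2`, no even cycle, and the
odd-cycle condition holds. -/
def IsCompactGraph {V : Type*} (G : SimpleGraph V) : Prop :=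
  G.Connected ∧ (∀ v : V, 2 ≤ (G.neighborSet v).ncard) ∧ HasNoEvenCycle G ∧ OddCycleCondition G

/-- The number `t(G)` of minimal (= induced) cycles of `G`, counted via their vertex sets. -/
def cycleCount {V : Type*} (G : SimpleGraph V) : ℕ :=
  Set.ncard {S : Set V | ∃ (a : V) (c : G.Walk a a), c.IsCycle ∧
    (∀ x y, x ∈ c.support → y ∈ c.support → G.Adj x y → s(x, y) ∈ c.edges) ∧
    S = {x | x ∈ c.support}}


universe u v w
set_option linter.unusedSectionVars false

section PartH1

open CategoryTheory.Limits in
theorem hasPD_of_resolution {C : Type*} [Category C] [Abelian C] [EnoughProjectives C] {M : C}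
    (P : ProjectiveResolution M) (m : ℕ) (h : ∀ i, m < i → IsZero (P.complex.X i)) :
    HasProjectiveDimensionLT M (m + 1) := by
  have := HasExt.standard C
  rw [hasProjectiveDimensionLT_iff]
  intro i hi Y e
  obtain ⟨f, hf, rfl⟩ := P.extMk_surjective e (i+1) rfl
  have : f = 0 := (h i (by omega)).eq_of_src _ _
  subst this
  simp

open CategoryTheory.Limits in
theorem exists_resolution_of_hasPD {C : Type*} [Category C] [Abelian C] [EnoughProjectives C] (m : ℕ) :
    ∀ (M : C), HasProjectiveDimensionLT M (m + 1) → 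
    ∃ P : ProjectiveResolution M, ∀ i, m < i → IsZero (P.complex.X i) := by
  induction m with
  | zero =>
    intro M hM
    have : Projective M := projective_iff_hasProjectiveDimensionLT_one.2 hM
    refine ⟨ProjectiveResolution.self M, fun i hi => ?_⟩
    apply HomologicalComplex.isZero_single_obj_X
    omega
  | succ m ih =>
    intro M hM
    let S : ShortComplex C := ShortComplex.mk (kernel.ι (Projective.π M)) (Projective.π M) (by simp)
    have hS : S.ShortExact :=
      { exact := ShortComplex.exact_of_f_is_kernel _ (kernelIsKernel _)
        mono_f := by dsimp [S]; infer_instance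
        epi_g := by dsimp [S]; infer_instance }
    have hP : Projective S.X₂ := Projective.projective_over M
    have h1 : HasProjectiveDimensionLT S.X₁ (m+1) := 
      (hS.hasProjectiveDimensionLT_X₃_iff m hP).1 hM
    obtain ⟨Q, hQ⟩ := ih _ h1
    let q : Q.complex.X 0 ⟶ S.X₁ := Q.π.f 0
    have hq : Epi q := inferInstanceAs (Epi (Q.π.f 0))
    have hdq : Q.complex.d 1 0 ≫ q = 0 := Q.complex_d_comp_π_f_zero
    have hex : (ShortComplex.mk _ _ hdq).Exact := Q.exact₀
    have w : Q.complex.d 1 0 ≫ (q ≫ S.f) = 0 := by rw [← Category.assoc, hdq, zero_comp]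
    let D := ChainComplex.augment Q.complex (q ≫ S.f) w
    have w' : D.d 1 0 ≫ S.g = 0 := by
      change (q ≫ S.f) ≫ S.g = 0
      rw [Category.assoc, S.zero, comp_zero]
    have e0 : (ShortComplex.mk _ _ w').Exact := by
      let φ : ShortComplex.mk _ _ w' ⟶ S :=
        { τ₁ := q, τ₂ := 𝟙 _, τ₃ := 𝟙 _
          comm₁₂ := (Category.comp_id _).symm
          comm₂₃ := (Category.id_comp _).trans (Category.comp_id _).symm }
      have i1 : Epi φ.τ₁ := hq
      have i2 : IsIso φ.τ₂ := inferInstanceAs (IsIso (𝟙 S.X₂))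
      have i3 : Mono φ.τ₃ := inferInstanceAs (Mono (𝟙 S.X₃))
      exact (ShortComplex.exact_iff_of_epi_of_isIso_of_mono φ).2 hS.exact
    have e1 : (ShortComplex.mk _ _ w).Exact := by
      let φ : ShortComplex.mk _ _ hdq ⟶ ShortComplex.mk _ _ w :=
        { τ₁ := 𝟙 _, τ₂ := 𝟙 _, τ₃ := S.f
          comm₁₂ := (Category.id_comp _).trans (Category.comp_id _).symm
          comm₂₃ := (Category.id_comp _) }
      have i1 : Epi φ.τ₁ := inferInstanceAs (Epi (𝟙 (Q.complex.X 1)))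
      have i2 : IsIso φ.τ₂ := inferInstanceAs (IsIso (𝟙 (Q.complex.X 0)))
      have i3 : Mono φ.τ₃ := hS.mono_f
      exact (ShortComplex.exact_iff_of_epi_of_isIso_of_mono φ).1 hex
    refine ⟨{ complex := D
              projective := fun n => by
                cases n
                · exact hP
                · exact Q.projective _
              π := (ChainComplex.toSingle₀Equiv _ _).symm ⟨S.g, w'⟩
              quasiIso := ⟨fun n => ?_⟩ }, ?_⟩
    · cases n with
      | zero =>
        rw [ChainComplex.quasiIsoAt₀_iff, ShortComplex.quasiIso_iff_of_zeros']
        · refine (ShortComplex.exact_and_epi_g_iff_of_iso ?_).2 ⟨e0, hS.epi_g⟩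
          exact ShortComplex.isoMk (Iso.refl _) (Iso.refl _) (Iso.refl _)
            ((Category.id_comp _).trans (Category.comp_id _).symm)
            ((Category.id_comp _).trans (Eq.trans
              (by
                have := ChainComplex.toSingle₀Equiv_symm_apply_f_zero (C := D) (X := M) S.g w'
                exact this.symm) (Category.comp_id _).symm))
        all_goals rfl
      | succ n =>
        rw [quasiIsoAt_iff_exactAt']
        · rw [HomologicalComplex.exactAt_iff' _ (n + 1 + 1) (n + 1) n (by simp) (by simp)]
          cases n with
          | zero => exact e1
          | succ n => exact Q.exact_succ n
        · apply ChainComplex.exactAt_succ_single_obj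
    · intro i hi
      cases i with
      | zero => omega
      | succ i => exact hQ i (by omega)
end PartH1

section PartH2

/-- short exact sequence from linear maps -/
theorem shortExact_of_linear {S : Type u} [CommRing S] {A B D : Type u} [AddCommGroup A] [Module S A]
    [AddCommGroup B] [Module S B] [AddCommGroup D] [Module S D] (f : A →ₗ[S] B) (g : B →ₗ[S] D)
    (hf : Function.Injective f) (hg : Function.Surjective g) (h : LinearMap.range f = LinearMap.ker g) :
    ∃ w : ModuleCat.ofHom f ≫ ModuleCat.ofHom g = 0, 
      (ShortComplex.mk (ModuleCat.ofHom f) (ModuleCat.ofHom g) w).ShortExact := by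
  have hex : Function.Exact f g := LinearMap.exact_iff.2 h.symm
  have w : ModuleCat.ofHom f ≫ ModuleCat.ofHom g = 0 := by
    ext x
    exact hex.apply_apply_eq_zero x
  refine ⟨w, ?_⟩
  exact { exact := (ShortComplex.ShortExact.moduleCat_exact_iff_function_exact _).2 hex
          mono_f := (ModuleCat.mono_iff_injective _).2 hf
          epi_g := (ModuleCat.epi_iff_surjective _).2 hg }

/-- `M` has projective dimension `< n`. -/
def PdLT {S : Type u} [CommRing S] (M : Type u) [AddCommGroup M] [Module S M] (n : ℕ) : Prop :=
  HasProjectiveDimensionLT (ModuleCat.of S M) n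

theorem pd_step_upper {S : Type u} [CommRing S] {P R R' Q : Type u} [AddCommGroup P] [Module S P]
    [AddCommGroup R] [Module S R] [AddCommGroup R'] [Module S R'] [AddCommGroup Q] [Module S Q]
    (f : P →ₗ[S] R) (g : R →ₗ[S] R') (i : P →ₗ[S] R) (q : R →ₗ[S] Q)
    (hf : Function.Injective f) (hg : Function.Surjective g) (h : LinearMap.range f = LinearMap.ker g)
    (hi : Function.Injective i) (hq : Function.Surjective q)
    (h' : LinearMap.range i = LinearMap.ker q) (n : ℕ)
    (hR : HasProjectiveDimensionLT (ModuleCat.of S R) (n + 1))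
    (hQ : HasProjectiveDimensionLT (ModuleCat.of S Q) (n + 2)) :
    HasProjectiveDimensionLT (ModuleCat.of S R') (n + 2) := by
  obtain ⟨w, hw⟩ := shortExact_of_linear f g hf hg h
  obtain ⟨w', hw'⟩ := shortExact_of_linear i q hi hq h'
  have hP : HasProjectiveDimensionLT (ModuleCat.of S P) (n + 1) :=
    hw'.hasProjectiveDimensionLT_X₁ (n + 1) hR hQ
  exact hw.hasProjectiveDimensionLT_X₃ (n+1) hP (hasProjectiveDimensionLT_of_ge _ (n+1) (n+2) (by omega))

open CategoryTheory.Abelian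

theorem ext_abstract {R : Type*} [CommRing R] {C : Type*} [Category C] [Abelian C] [Linear R C]
    [HasExt C]
    {T : ShortComplex C} (hT : T.ShortExact) (Y : C) (i : T.X₁ ⟶ T.X₂) (j : T.X₂ ⟶ T.X₁)
    (s s' : R) (hs : s • 𝟙 Y = 𝟙 Y) (hs' : s' • 𝟙 Y = 0)
    (hij : j ≫ i = s • 𝟙 _) (hfj : j ≫ T.f = s' • 𝟙 _) (n : ℕ)
    (hsub : Subsingleton (Ext T.X₃ Y (n + 1))) :
    Subsingleton (Ext T.X₂ Y n) := by
  refine subsingleton_of_forall_eq 0 fun x => ?_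
  obtain ⟨y, hy⟩ := Ext.contravariant_sequence_exact₁ hT Y 
    ((Ext.mk₀ i).comp x (zero_add n)) (add_comm 1 n) (Subsingleton.elim _ _)
  have h1 : (Ext.mk₀ j).comp ((Ext.mk₀ i).comp x (zero_add n)) (zero_add n) = x := by
    rw [Ext.mk₀_comp_mk₀_assoc, hij, Ext.mk₀_smul, Ext.smul_comp, Ext.mk₀_id_comp,
      Ext.smul_eq_comp_mk₀, hs, Ext.comp_mk₀_id]
  have h2 : (Ext.mk₀ j).comp ((Ext.mk₀ T.f).comp y (zero_add n)) (zero_add n) = 0 := by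
    rw [Ext.mk₀_comp_mk₀_assoc, hfj, Ext.mk₀_smul, Ext.smul_comp, Ext.mk₀_id_comp,
      Ext.smul_eq_comp_mk₀, hs', Ext.mk₀_zero, Ext.comp_zero]
  rw [← h1, ← h2, hy]

theorem pd_step_lower {S : Type u} [CommRing S] {P R R' Y : Type u} [AddCommGroup P] [Module S P]
    [AddCommGroup R] [Module S R] [AddCommGroup R'] [Module S R'] [AddCommGroup Y] [Module S Y]
    (f : P →ₗ[S] R) (g : R →ₗ[S] R') (i : P →ₗ[S] R) (j : R →ₗ[S] P)
    (hf : Function.Injective f) (hg : Function.Surjective g) (h : LinearMap.range f = LinearMap.ker g)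
    (s s' : S) (hs : ∀ y : Y, s • y = y) (hs' : ∀ y : Y, s' • y = 0)
    (hij : i ∘ₗ j = s • LinearMap.id) (hfj : f ∘ₗ j = s' • LinearMap.id) (n : ℕ)
    (hsub : Subsingleton (Ext (ModuleCat.of S R') (ModuleCat.of S Y) (n + 1))) :
    Subsingleton (Ext (ModuleCat.of S R) (ModuleCat.of S Y) n) := by
  obtain ⟨w, hw⟩ := shortExact_of_linear f g hf hg h
  have e1 : (ModuleCat.ofHom j) ≫ (ModuleCat.ofHom i) = s • 𝟙 (ModuleCat.of S R) := by
    ext y; exact LinearMap.congr_fun hij y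
  have e2 : (ModuleCat.ofHom j) ≫ (ModuleCat.ofHom f) = s' • 𝟙 (ModuleCat.of S R) := by
    ext y; exact LinearMap.congr_fun hfj y
  exact ext_abstract hw (ModuleCat.of S Y) (ModuleCat.ofHom i) (ModuleCat.ofHom j) s s' 
    (by ext y; exact hs y) (by ext y; exact hs' y) e1 e2 n hsub

end PartH2

section PartA1

section Amb
variable {K : Type u} [Field K] {σ : Type v} {G : Type v} [AddCommGroup G]

/-- group algebra viewed as an algebra over the polynomial ring via `κ` -/
def Amb (K : Type u) [Field K] {σ : Type v} {G : Type v} [AddCommGroup G]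
    (_κ : (σ →₀ ℕ) →+ G) : Type (max u v) := AddMonoidAlgebra K G

instance (κ : (σ →₀ ℕ) →+ G) : CommRing (Amb K κ) :=
  inferInstanceAs (CommRing (AddMonoidAlgebra K G))

/-- the structure map -/
def ambMap (K : Type u) [Field K] (κ : (σ →₀ ℕ) →+ G) : MvPolynomial σ K →+* Amb K κ :=
  AddMonoidAlgebra.mapDomainRingHom K κ

instance (κ : (σ →₀ ℕ) →+ G) : Algebra (MvPolynomial σ K) (Amb K κ) := (ambMap K κ).toAlgebra

/-- basis elements -/
def sg (κ : (σ →₀ ℕ) →+ G) (g : G) (a : K) : Amb K κ := AddMonoidAlgebra.single g a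

/-- coefficients -/
def cf {κ : (σ →₀ ℕ) →+ G} (x : Amb K κ) : G →₀ K := AddMonoidAlgebra.coeff x

variable {κ : (σ →₀ ℕ) →+ G}

theorem sg_mul (g h : G) (a b : K) : sg κ g a * sg κ h b = sg κ (g + h) (a * b) :=
  AddMonoidAlgebra.single_mul_single ..

theorem sg_zero (g : G) : sg κ g (0 : K) = 0 := AddMonoidAlgebra.single_zero _

theorem sg_one : sg κ (0 : G) (1 : K) = 1 := rfl

theorem cf_add (x y : Amb K κ) : cf (x + y) = cf x + cf y := rfl
theorem cf_sub (x y : Amb K κ) : cf (x - y) = cf x - cf y := rfl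
theorem cf_neg (x : Amb K κ) : cf (-x) = - cf x := rfl
theorem cf_zero : cf (0 : Amb K κ) = 0 := rfl
theorem cf_sg (g : G) (a : K) : cf (sg κ g a) = Finsupp.single g a := rfl
theorem cf_inj {x y : Amb K κ} (h : cf x = cf y) : x = y := AddMonoidAlgebra.coeff_injective h

theorem cf_sg_mul (g h : G) (a : K) (x : Amb K κ) : cf (sg κ g a * x) h = a * cf x (h - g) := by
  have := AddMonoidAlgebra.coeff_single_mul_apply (R := K) x a g h
  rw [neg_add_eq_sub] at this
  exact this

theorem amb_sum (x : Amb K κ) : x = ∑ g ∈ (cf x).support, sg κ g (cf x g) :=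
  (AddMonoidAlgebra.sum_coeff_single (R := K) x).symm

theorem ambMap_monomial (m : σ →₀ ℕ) (a : K) : ambMap K κ (monomial m a) = sg κ (κ m) a :=
  AddMonoidAlgebra.mapDomain_single

theorem smul_amb (p : MvPolynomial σ K) (x : Amb K κ) : p • x = ambMap K κ p * x := rfl

/-- submodule of elements supported in `T` -/
def supp (κ : (σ →₀ ℕ) →+ G) (T : Set G) (hT : ∀ g ∈ T, ∀ m, κ m + g ∈ T) :
    Submodule (MvPolynomial σ K) (Amb K κ) where
  carrier := {x | ∀ g, cf x g ≠ 0 → g ∈ T}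
  add_mem' := by
    intro a b ha hb g hg
    by_cases h : cf a g = 0
    · exact hb g (by intro h'; apply hg; rw [cf_add]; simp [h, h'])
    · exact ha g h
  zero_mem' := by intro g hg; exact absurd rfl hg
  smul_mem' := by
    intro p x hx
    induction p using MvPolynomial.induction_on' with
    | monomial m a =>
      intro g hg
      rw [smul_amb, ambMap_monomial, cf_sg_mul] at hg
      have := hT _ (hx (g - κ m) (right_ne_zero_of_mul hg)) m
      simpa using this
    | add p q hp hq =>
      intro g hg
      rw [add_smul, cf_add] at hg
      by_cases h : cf (p • x) g = 0
      · exact hq g (by intro h'; apply hg; simp [h, h'])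
      · exact hp g h

theorem mem_supp {T : Set G} {hT : ∀ g ∈ T, ∀ m, κ m + g ∈ T} {x : Amb K κ} :
    x ∈ supp κ T hT ↔ ∀ g, cf x g ≠ 0 → g ∈ T := Iff.rfl

theorem sg_mem_supp {T : Set G} {hT : ∀ g ∈ T, ∀ m, κ m + g ∈ T} {g : G} (a : K) (h : g ∈ T) :
    sg κ g a ∈ supp κ T hT := by
  intro g' hg'
  rw [cf_sg, Finsupp.single_apply] at hg'
  by_cases e : g = g'
  · exact e ▸ h
  · simp [e] at hg'

/-- the monomial subring -/
def Rm (K : Type u) [Field K] (κ : (σ →₀ ℕ) →+ G) : Submodule (MvPolynomial σ K) (Amb K κ) :=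
  supp κ (Set.range κ) (by rintro _ ⟨a, rfl⟩ m; exact ⟨m + a, by simp⟩)

/-- the submodule of elements that stay in `Rm` after multiplication by `X^δ` -/
def Pm (K : Type u) [Field K] (κ : (σ →₀ ℕ) →+ G) (δ : G) :
    Submodule (MvPolynomial σ K) (Amb K κ) :=
  supp κ {g | g ∈ Set.range κ ∧ g + δ ∈ Set.range κ} (by
    rintro g ⟨⟨a, rfl⟩, b, hb⟩ m
    exact ⟨⟨m + a, by simp⟩, m + b, by simp [hb, add_assoc]⟩)

theorem Pm_le (δ : G) : Pm K κ δ ≤ Rm K κ := fun _ hx g hg => (hx g hg).1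

theorem cf_ambMap (p : MvPolynomial σ K) :
    cf (ambMap K κ p) = Finsupp.mapDomain κ (AddMonoidAlgebra.coeff p) := rfl

theorem mem_Rm_iff {x : Amb K κ} : x ∈ Rm K κ ↔ ∃ p, ambMap K κ p = x := by
  constructor
  · intro hx
    rw [amb_sum x]
    have : ∀ g ∈ (cf x).support, ∃ m, κ m = g := fun g hg => hx g (by simpa using hg)
    choose! r hr using this
    refine ⟨∑ g ∈ (cf x).support, monomial (r g) (cf x g), ?_⟩
    rw [map_sum]
    refine Finset.sum_congr rfl fun g hg => ?_
    rw [ambMap_monomial, hr g hg]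
  · rintro ⟨p, rfl⟩
    have h1 : (1 : Amb K κ) ∈ Rm K κ := sg_mem_supp (1 : K) ⟨0, map_zero κ⟩
    have := (Rm K κ).smul_mem p h1
    rwa [smul_amb, mul_one] at this

variable {G' : Type v} [AddCommGroup G']

/-- pushing forward along a group homomorphism, as a ring homomorphism -/
def pushR (K : Type u) [Field K] (κ : (σ →₀ ℕ) →+ G) (π : G →+ G') :
    Amb K κ →+* Amb K (π.comp κ) := AddMonoidAlgebra.mapDomainRingHom K π

theorem pushR_ambMap (π : G →+ G') (p : MvPolynomial σ K) :
    pushR K κ π (ambMap K κ p) = ambMap K (π.comp κ) p := by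
  apply cf_inj
  rw [cf_ambMap, AddMonoidHom.coe_comp, Finsupp.mapDomain_comp]
  rfl

/-- pushing forward along a group homomorphism -/
def push (K : Type u) [Field K] (κ : (σ →₀ ℕ) →+ G) (π : G →+ G') :
    Amb K κ →ₗ[MvPolynomial σ K] Amb K (π.comp κ) where
  toFun := pushR K κ π
  map_add' x y := map_add (pushR K κ π) x y
  map_smul' p x := by
    rw [RingHom.id_apply, smul_amb, smul_amb, map_mul, pushR_ambMap]

theorem cf_push (π : G →+ G') (x : Amb K κ) :
    cf (push K κ π x) = Finsupp.mapDomain π (cf x) := rfl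

theorem push_ambMap (π : G →+ G') (p : MvPolynomial σ K) :
    push K κ π (ambMap K κ p) = ambMap K (π.comp κ) p := by
  apply cf_inj
  rw [cf_push, cf_ambMap, cf_ambMap, AddMonoidHom.coe_comp, Finsupp.mapDomain_comp]

/-- multiplication by an element as a linear map -/
def mulL (θ : Amb K κ) : Amb K κ →ₗ[MvPolynomial σ K] Amb K κ :=
  LinearMap.mulLeft (MvPolynomial σ K) θ

theorem mulL_apply (θ x : Amb K κ) : mulL θ x = θ * x := rfl

theorem push_sg (π : G →+ G') (g : G) (a : K) : push K κ π (sg κ g a) = sg (π.comp κ) (π g) a :=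
  AddMonoidAlgebra.mapDomain_single

/-- The kernel of the push-forward on `Rm`. -/
theorem push_ker (π : G →+ G') (δ : G) (α β : σ →₀ ℕ)
    (hπ : ∀ g, π g = 0 → ∃ d : ℤ, g = d • (κ β + δ - κ α))
    (HC : ∀ g ∈ Set.range κ, ∀ d : ℕ, 1 ≤ d → g + d • (κ β + δ - κ α) ∈ Set.range κ →
      ∃ p ∈ Set.range κ, p + δ ∈ Set.range κ ∧ g = κ α + p)
    (x : Amb K κ) (hx : x ∈ Rm K κ) (h0 : push K κ π x = 0) :
    x ∈ (Pm K κ δ).map (mulL (sg κ (κ α) (1 : K) - sg κ (κ β + δ) 1)) := by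
  set N := (Pm K κ δ).map (mulL (sg κ (κ α) (1 : K) - sg κ (κ β + δ) 1)) with hN
  set γ := κ β + δ - κ α with hγ
  -- step 1
  have key : ∀ d : ℕ, ∀ g ∈ Set.range κ, g + d • γ ∈ Set.range κ → ∀ a : K,
      sg κ g a - sg κ (g + d • γ) a ∈ N := by
    intro d
    induction d with
    | zero => intro g _ _ a; simp
    | succ d ih =>
      intro g hg hg' a
      obtain ⟨p, hp, hpδ, hgp⟩ := HC g hg (d + 1) (by omega) hg'
      have e1 : g + γ = κ β + (p + δ) := by rw [hgp, hγ]; abel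
      have h1 : g + γ ∈ Set.range κ := by
        rw [e1]
        obtain ⟨q, hq⟩ := hpδ
        exact ⟨β + q, by simp [hq]⟩
      have e2 : g + (d + 1) • γ = (g + γ) + d • γ := by rw [succ_nsmul]; abel
      have h2 := ih (g + γ) h1 (by rwa [← e2]) a
      have h3 : sg κ g a - sg κ (g + γ) a ∈ N := by
        refine ⟨sg κ p a, sg_mem_supp a ⟨hp, hpδ⟩, ?_⟩
        rw [mulL_apply, sub_mul, sg_mul, sg_mul, one_mul, ← hgp, e1]
        congr 2
        abel
      have := N.add_mem h3 h2
      rw [e2]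
      simpa using this
  have key2 : ∀ g ∈ Set.range κ, ∀ g' ∈ Set.range κ, π g = π g' → ∀ a : K,
      sg κ g a - sg κ g' a ∈ N := by
    intro g hg g' hg' hgg a
    obtain ⟨d, hd⟩ := hπ (g' - g) (by rw [map_sub, hgg, sub_self])
    obtain ⟨n, rfl | rfl⟩ := d.eq_nat_or_neg
    · have e : g' = g + n • γ := by rw [← natCast_zsmul, ← hd]; abel
      rw [e]; rw [e] at hg'
      exact key n g hg hg' a
    · have e : g = g' + n • γ := by 
        rw [neg_zsmul, natCast_zsmul] at hd
        have e3 : n • γ = g - g' := by rw [← neg_sub, hd, neg_neg]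
        rw [e3]; abel
      rw [e]; rw [e] at hg
      have := N.neg_mem (key n g' hg' hg a)
      simpa using this
  have hr : ∀ h : G', ∃ r : G, ∀ g ∈ Set.range κ, π g = h → r ∈ Set.range κ ∧ π r = h := by
    intro h
    by_cases hh : ∃ g ∈ Set.range κ, π g = h
    · obtain ⟨g, hg, rfl⟩ := hh; exact ⟨g, fun _ _ _ => ⟨hg, rfl⟩⟩
    · exact ⟨0, fun g hg he => absurd ⟨g, hg, he⟩ hh⟩
  choose r hr using hr
  have hz : ∑ g ∈ (cf x).support, sg κ (r (π g)) (cf x g) = 0 := by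
    apply cf_inj
    have h1 : cf (∑ g ∈ (cf x).support, sg κ (r (π g)) (cf x g)) =
        Finsupp.mapDomain (r ∘ π) (cf x) := by
      rw [Finsupp.mapDomain, Finsupp.sum]
      exact AddMonoidAlgebra.coeff_sum (R := K) _ _
    rw [h1, Finsupp.mapDomain_comp, ← cf_push, h0, cf_zero, cf_zero, Finsupp.mapDomain_zero]
  have : x = ∑ g ∈ (cf x).support, (sg κ g (cf x g) - sg κ (r (π g)) (cf x g)) := by
    rw [Finset.sum_sub_distrib, hz, sub_zero]; exact amb_sum x
  rw [this]
  refine N.sum_mem fun g hg => ?_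
  have hg' := hx g (by simpa using hg)
  obtain ⟨h1, h2⟩ := hr (π g) g hg' rfl
  exact key2 g hg' _ h1 h2.symm _

/-- injectivity of multiplication by `θ` -/
theorem theta_inj (g h : G) (hinf : ∀ n : ℕ, n ≠ 0 → n • (h - g) ≠ 0) :
    Function.Injective (mulL (κ := κ) (sg κ g (1 : K) - sg κ h 1)) := by
  rw [injective_iff_map_eq_zero]
  intro x hx
  rw [mulL_apply, sub_mul, sub_eq_zero] at hx
  have hc : ∀ t, cf x t = cf x (t + (h - g)) := by
    intro t
    have := congrArg (fun y => cf y (t + h)) hx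
    simp only [cf_sg_mul, one_mul] at this
    rw [add_sub_cancel_right] at this
    rw [← this]
    congr 1; abel
  have hc2 : ∀ n : ℕ, ∀ t, cf x t = cf x (t + n • (h - g)) := by
    intro n
    induction n with
    | zero => intro t; simp
    | succ n ih => intro t; rw [ih, hc, succ_nsmul, add_assoc]
  by_contra hne
  have : ∃ t, cf x t ≠ 0 := by
    by_contra hh
    push Not at hh
    exact hne (cf_inj (Finsupp.ext hh))
  obtain ⟨t, ht⟩ := this
  have hinj : Function.Injective (fun n : ℕ => t + n • (h - g)) := by
    intro a b hab
    simp only [add_right_inj] at hab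
    by_contra hne
    wlog hlt : a < b generalizing a b
    · exact this hab.symm (Ne.symm hne) (by omega)
    apply hinf (b - a) (by omega)
    rw [sub_nsmul _ hlt.le, hab, add_neg_cancel]
  have hfin : (Set.range (fun n : ℕ => t + n • (h - g))).Finite := by
    refine (cf x).support.finite_toSet.subset ?_
    rintro _ ⟨n, rfl⟩
    simp only [Finset.mem_coe, Finsupp.mem_support_iff]
    rw [← hc2]; exact ht
  exact (Set.infinite_range_of_injective hinj) hfin

end Amb
end PartA1

section PartA2

theorem pd_one_of_free {S : Type u} [CommRing S] (M : Type u) [AddCommGroup M] [Module S M]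
    [Module.Projective S M] : HasProjectiveDimensionLT (ModuleCat.of S M) 1 := by
  have : Projective (ModuleCat.of S M) := (IsProjective.iff_projective M).1 inferInstance
  infer_instance

theorem pd_of_equiv {S : Type u} [CommRing S] {M N : Type u} [AddCommGroup M] [Module S M]
    [AddCommGroup N] [Module S N] (e : M ≃ₗ[S] N) (n : ℕ)
    (h : HasProjectiveDimensionLT (ModuleCat.of S M) n) : 
    HasProjectiveDimensionLT (ModuleCat.of S N) n := by
  exact hasProjectiveDimensionLT_of_iso e.toModuleIso n

/-- monomial ideal -/
def monIdeal (K : Type u) [Field K] {σ : Type v} {ι : Type w} (β : ι → σ →₀ ℕ) (s : Finset ι) :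
    Ideal (MvPolynomial σ K) := Ideal.span ((fun m => monomial m (1:K)) '' (β '' s))

theorem mem_monIdeal {K : Type u} [Field K] {σ : Type v} {ι : Type w} {β : ι → σ →₀ ℕ}
    {s : Finset ι} {p : MvPolynomial σ K} :
    p ∈ monIdeal K β s ↔ ∀ m ∈ p.support, ∃ i ∈ s, β i ≤ m := by
  rw [monIdeal, mem_ideal_span_monomial_image]
  simp

theorem pd_mon (K : Type u) [Field K] {σ : Type v} {ι : Type w} (β : ι → σ →₀ ℕ) (s : Finset ι) 
    (hd : ∀ i ∈ s, ∀ j ∈ s, i ≠ j → ∀ e, β i e = 0 ∨ β j e = 0) :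
    HasProjectiveDimensionLT (ModuleCat.of (MvPolynomial σ K) (MvPolynomial σ K ⧸ monIdeal K β s))
      (s.card + 1) := by
  induction s using Finset.induction_on with
  | empty =>
    have h : monIdeal K β ∅ = ⊥ := by simp [monIdeal]
    have e : MvPolynomial σ K ≃ₗ[MvPolynomial σ K] (MvPolynomial σ K ⧸ monIdeal K β ∅) :=
      (Submodule.quotEquivOfEqBot _ h).symm
    exact pd_of_equiv e _ (pd_one_of_free _)
  | insert j s hj ih =>
    have ih := ih (fun i hi k hk => hd i (mem_insert_of_mem hi) k (mem_insert_of_mem hk))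
    set J := monIdeal K β s with hJ
    set J' := monIdeal K β (insert j s) with hJ'
    set S := MvPolynomial σ K
    have hle : J ≤ J' := by
      intro p hp
      rw [hJ', mem_monIdeal]; rw [hJ, mem_monIdeal] at hp
      intro m hm; obtain ⟨i, hi, h⟩ := hp m hm; exact ⟨i, mem_insert_of_mem hi, h⟩
    let x : S := monomial (β j) 1
    let f : (S ⧸ J) →ₗ[S] (S ⧸ J) := LinearMap.lsmul S (S ⧸ J) x
    let g : (S ⧸ J) →ₗ[S] (S ⧸ J') := Submodule.factor hle
    have hcj : ∀ p : S, ∀ m, coeff (β j + m) (x * p) = coeff m p := by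
      intro p m; rw [coeff_monomial_mul, one_mul]
    have hf : Function.Injective f := by
      rw [injective_iff_map_eq_zero]
      intro a
      obtain ⟨p, rfl⟩ := Submodule.Quotient.mk_surjective _ a
      intro hp
      have hp' : x * p ∈ J := by
        rw [← Submodule.Quotient.mk_eq_zero J]; exact hp
      rw [Submodule.Quotient.mk_eq_zero, hJ, mem_monIdeal]
      rw [hJ, mem_monIdeal] at hp'
      intro m hm
      obtain ⟨i, hi, h⟩ := hp' (β j + m) (by rw [mem_support_iff, hcj]; exact mem_support_iff.1 hm)
      refine ⟨i, hi, fun e => ?_⟩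
      have := h e
      rcases hd i (mem_insert_of_mem hi) j (mem_insert_self _ _) (by rintro rfl; exact hj hi) e with h | h
      · omega
      · simpa [h] using this
    have hg : Function.Surjective g := Submodule.factor_surjective hle
    have hx : x ∈ J' := by
      rw [hJ', mem_monIdeal]
      intro m hm
      have := support_monomial_subset hm
      simp at this
      exact ⟨j, mem_insert_self _ _, this.ge⟩
    have hr : LinearMap.range f = LinearMap.ker g := by
      apply le_antisymm
      · rintro _ ⟨a, rfl⟩
        obtain ⟨p, rfl⟩ := Submodule.Quotient.mk_surjective _ a
        change Submodule.Quotient.mk (x * p) = (0 : S ⧸ J')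
        rw [Submodule.Quotient.mk_eq_zero]
        exact Ideal.mul_mem_right _ _ hx
      · intro a ha
        obtain ⟨p, rfl⟩ := Submodule.Quotient.mk_surjective _ a
        have hp : p ∈ J' := by rw [← Submodule.Quotient.mk_eq_zero J']; exact ha
        have hJJ : J' = Ideal.span {x} ⊔ J := by
          rw [hJ', hJ, monIdeal, monIdeal, Finset.coe_insert, Set.image_insert_eq, 
            Set.image_insert_eq, Ideal.span_insert]
        rw [hJJ, Submodule.mem_sup] at hp
        obtain ⟨y, hy, z, hz, rfl⟩ := hp
        rw [Ideal.mem_span_singleton] at hy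
        obtain ⟨q, rfl⟩ := hy
        refine ⟨Submodule.Quotient.mk q, ?_⟩
        change Submodule.Quotient.mk (x * q) = _
        rw [Submodule.Quotient.eq]
        rw [sub_add_cancel_left]; exact J.neg_mem hz
    obtain ⟨w, hw⟩ := shortExact_of_linear f g hf hg hr
    rw [card_insert_of_notMem hj]
    exact hw.hasProjectiveDimensionLT_X₃ _ ih (hasProjectiveDimensionLT_of_ge _ (s.card+1) _ (by omega))

section
variable {K : Type u} [Field K] {σ : Type v} {G : Type v} [AddCommGroup G]
  {κ : (σ →₀ ℕ) →+ G}

/-- the quotient `Rm / Pm` has small projective dimension -/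
theorem pd_quot {ι : Type w} (δ : G) (β : ι → σ →₀ ℕ) (s : Finset ι)
    (hd : ∀ i ∈ s, ∀ j ∈ s, i ≠ j → ∀ e, β i e = 0 ∨ β j e = 0)
    (hβ : ∀ i ∈ s, κ (β i) + δ ∈ Set.range κ)
    (h1 : ∀ m m', (∀ i ∈ s, ¬ β i ≤ m) → κ m = κ m' → (∀ i ∈ s, ¬ β i ≤ m') → m = m')
    (h2 : ∀ m, (∀ i ∈ s, ¬ β i ≤ m) → κ m + δ ∉ Set.range κ) :
    HasProjectiveDimensionLT (ModuleCat.of (MvPolynomial σ K)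
      (Rm K κ ⧸ (Pm K κ δ).submoduleOf (Rm K κ))) (s.card + 1) := by
  set S := MvPolynomial σ K
  let r : S →ₗ[S] Rm K κ := LinearMap.codRestrict _ (Algebra.linearMap S (Amb K κ)) 
    (fun p => mem_Rm_iff.2 ⟨p, rfl⟩)
  let q : S →ₗ[S] (Rm K κ ⧸ (Pm K κ δ).submoduleOf (Rm K κ)) := (Submodule.mkQ _).comp r
  have hq : Function.Surjective q := by
    apply (Submodule.mkQ_surjective _).comp
    rintro ⟨x, hx⟩
    obtain ⟨p, rfl⟩ := mem_Rm_iff.1 hx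
    exact ⟨p, rfl⟩
  have hmem : ∀ p : S, p ∈ LinearMap.ker q ↔ ambMap K κ p ∈ Pm K κ δ := by
    intro p
    change Submodule.Quotient.mk (r p) = _ ↔ _
    rw [Submodule.Quotient.mk_eq_zero]; rfl
  have hmon : monIdeal K β s ≤ LinearMap.ker q := by
    rw [monIdeal, Ideal.span_le]
    rintro _ ⟨_, ⟨i, hi, rfl⟩, rfl⟩
    rw [SetLike.mem_coe, hmem, ambMap_monomial]
    exact sg_mem_supp _ ⟨⟨_, rfl⟩, hβ i hi⟩
  have hker : LinearMap.ker q = monIdeal K β s := by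
    refine le_antisymm ?_ hmon
    intro p hp
    -- split p
    set p1 : S := ∑ m ∈ p.support.filter (fun m => ∃ i ∈ s, β i ≤ m), monomial m (coeff m p)
    set p2 : S := ∑ m ∈ p.support.filter (fun m => ¬ ∃ i ∈ s, β i ≤ m), monomial m (coeff m p)
    have hp12 : p = p1 + p2 := by
      rw [Finset.sum_filter_add_sum_filter_not]; exact p.as_sum
    have hp1 : p1 ∈ monIdeal K β s := by
      refine Ideal.sum_mem _ fun m hm => ?_
      rw [mem_monIdeal]
      intro m' hm'
      have := support_monomial_subset hm'
      simp only [mem_singleton] at this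
      rw [this]
      exact (mem_filter.1 hm).2
    have hp2 : ambMap K κ p2 ∈ Pm K κ δ := by
      rw [← hmem]
      have : p2 = p - p1 := by rw [hp12]; abel
      rw [this]
      exact sub_mem hp (hmon hp1)
    have hsupp : ∀ m ∈ p2.support, ∀ i ∈ s, ¬ β i ≤ m := by
      intro m hm
      have := support_sum hm
      simp only [mem_biUnion] at this
      obtain ⟨m', hm', h⟩ := this
      have h := support_monomial_subset h
      simp only [mem_singleton] at h
      subst h
      have := (mem_filter.1 hm').2
      push Not at this
      exact this
    have hz : p2 = 0 := by
      by_contra hne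
      obtain ⟨m, hm⟩ := support_nonempty.2 hne
      have hc : cf (ambMap K κ p2) (κ m) = coeff m p2 := by
        rw [cf_ambMap, Finsupp.mapDomain, Finsupp.sum, Finsupp.finsetSum_apply]
        rw [Finset.sum_eq_single m]
        · simp; rfl
        · intro m' hm' hne
          rw [Finsupp.single_apply, if_neg]
          intro he
          exact hne (h1 m' m (hsupp m' hm') he (hsupp m hm))
        · intro h; exact absurd hm h
      refine h2 m (hsupp m hm) (hp2 (κ m) ?_).2
      rw [hc]; exact mem_support_iff.1 hm
    rw [hp12, hz, add_zero]; exact hp1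
  have e := (LinearMap.quotKerEquivOfSurjective q hq)
  rw [hker] at e
  exact pd_of_equiv e _ (pd_mon K β s hd)
end
end PartA2

section PartA3
open CategoryTheory.Abelian

/-- the residue field at the all-ones point -/
abbrev Yone (K : Type u) [Field K] (σ : Type v) : Type (max u v) :=
  MvPolynomial σ K ⧸ (RingHom.ker (MvPolynomial.eval (fun _ : σ => (1 : K))))

section
variable {K : Type u} [Field K] {σ : Type v} {G : Type v} [AddCommGroup G]
  {κ : (σ →₀ ℕ) →+ G}

theorem smul_Yone (p : MvPolynomial σ K) (c : K) (h : eval (fun _ => (1:K)) p = c) (y : Yone K σ) :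
    p • y = (C c : MvPolynomial σ K) • y := by
  rw [← sub_eq_zero, ← sub_smul]
  obtain ⟨q, rfl⟩ := Submodule.Quotient.mk_surjective _ y
  rw [← Submodule.Quotient.mk_smul, Submodule.Quotient.mk_eq_zero, smul_eq_mul]
  apply Ideal.mul_mem_right
  rw [RingHom.mem_ker]; simp [h]

theorem eval_mon_one (m : σ →₀ ℕ) : eval (fun _ => (1:K)) (monomial m (1:K)) = 1 := by
  simp [eval_monomial]

/-- induction invariant -/
def Inv (K : Type u) [Field K] (κ : (σ →₀ ℕ) →+ G) (n : ℕ) : Prop :=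
  HasProjectiveDimensionLT (ModuleCat.of (MvPolynomial σ K) (Rm K κ)) (n + 1) ∧
  ¬ Subsingleton (Ext (ModuleCat.of (MvPolynomial σ K) (Rm K κ))
      (ModuleCat.of (MvPolynomial σ K) (Yone K σ)) n)

variable {G' : Type v} [AddCommGroup G']

theorem inv_step {ι : Type w} (π : G →+ G') (δ : G) (α β : σ →₀ ℕ) (b : ι → σ →₀ ℕ) (s : Finset ι)
    (n : ℕ) (hs : s.card = n + 1)
    (hπ : ∀ g, π g = 0 ↔ ∃ d : ℤ, g = d • (κ β + δ - κ α))
    (hinf : ∀ n : ℕ, n ≠ 0 → n • (κ β + δ - κ α) ≠ 0)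
    (HC : ∀ g ∈ Set.range κ, ∀ d : ℕ, 1 ≤ d → g + d • (κ β + δ - κ α) ∈ Set.range κ →
      ∃ p ∈ Set.range κ, p + δ ∈ Set.range κ ∧ g = κ α + p)
    (hd : ∀ i ∈ s, ∀ j ∈ s, i ≠ j → ∀ e, b i e = 0 ∨ b j e = 0)
    (hb : ∀ i ∈ s, κ (b i) + δ ∈ Set.range κ)
    (h1 : ∀ m m', (∀ i ∈ s, ¬ b i ≤ m) → κ m = κ m' → (∀ i ∈ s, ¬ b i ≤ m') → m = m')
    (h2 : ∀ m, (∀ i ∈ s, ¬ b i ≤ m) → κ m + δ ∉ Set.range κ)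
    (hI : Inv K κ n) : Inv K (π.comp κ) (n + 1) := by
  set S := MvPolynomial σ K
  set θ : Amb K κ := sg κ (κ α) (1 : K) - sg κ (κ β + δ) 1 with hθ
  have hθP : ∀ x ∈ Pm K κ δ, θ * x ∈ Rm K κ := by
    intro x hx g hg
    rw [hθ, sub_mul, cf_sub, Finsupp.sub_apply, cf_sg_mul, cf_sg_mul, one_mul, one_mul] at hg
    by_cases h : cf x (g - κ α) = 0
    · rw [h, zero_sub, neg_ne_zero] at hg
      obtain ⟨_, q, hq⟩ := hx _ hg
      refine ⟨β + q, ?_⟩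
      rw [map_add, hq]; abel
    · obtain ⟨⟨q, hq⟩, _⟩ := hx _ h
      refine ⟨α + q, ?_⟩
      rw [map_add, hq]; abel
  let f : Pm K κ δ →ₗ[S] Rm K κ := ((mulL θ).comp (Pm K κ δ).subtype).codRestrict _ 
    (fun x => hθP x.1 x.2)
  have hpush : ∀ x ∈ Rm K κ, push K κ π x ∈ Rm K (π.comp κ) := by
    intro x hx
    obtain ⟨p, rfl⟩ := mem_Rm_iff.1 hx
    exact mem_Rm_iff.2 ⟨p, (push_ambMap π p).symm⟩
  let g : Rm K κ →ₗ[S] Rm K (π.comp κ) := ((push K κ π).comp (Rm K κ).subtype).codRestrict _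
    (fun x => hpush x.1 x.2)
  let i : Pm K κ δ →ₗ[S] Rm K κ := Submodule.inclusion (Pm_le δ)
  let q : Rm K κ →ₗ[S] (Rm K κ ⧸ (Pm K κ δ).submoduleOf (Rm K κ)) := Submodule.mkQ _
  have hf : Function.Injective f := by
    intro x y hxy
    apply Subtype.ext
    apply theta_inj (κ := κ) (K := K) (κ α) (κ β + δ) hinf
    exact congrArg Subtype.val hxy
  have hg : Function.Surjective g := by
    rintro ⟨x, hx⟩
    obtain ⟨p, rfl⟩ := mem_Rm_iff.1 hx
    refine ⟨⟨ambMap K κ p, mem_Rm_iff.2 ⟨p, rfl⟩⟩, Subtype.ext (push_ambMap π p)⟩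
  have hpθ : push K κ π θ = 0 := by
    have : π (κ β + δ - κ α) = 0 := (hπ _).2 ⟨1, by simp⟩
    rw [map_sub, sub_eq_zero] at this
    rw [hθ, map_sub, push_sg, push_sg, this, sub_self]
  have hfg : LinearMap.range f = LinearMap.ker g := by
    apply le_antisymm
    · rintro _ ⟨x, rfl⟩
      apply Subtype.ext
      change pushR K κ π (θ * x.1) = 0
      rw [map_mul]
      have : pushR K κ π θ = 0 := hpθ
      rw [this, zero_mul]
    · rintro ⟨x, hx⟩ h0
      obtain ⟨y, hy, hyx⟩ := push_ker π δ α β (fun g => (hπ g).1) HC x hx (congrArg Subtype.val h0)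
      exact ⟨⟨y, hy⟩, Subtype.ext hyx⟩
  have hi : Function.Injective i := Submodule.inclusion_injective _
  have hq : Function.Surjective q := Submodule.mkQ_surjective _
  have hiq : LinearMap.range i = LinearMap.ker q := by
    rw [Submodule.ker_mkQ]; exact Submodule.range_inclusion _ _ _
  constructor
  · refine pd_step_upper f g i q hf hg hfg hi hq hiq n hI.1 ?_
    have := pd_quot (K := K) δ b s hd hb h1 h2
    rwa [hs] at this
  · intro hsub
    apply hI.2
    obtain ⟨i0, hi0⟩ : s.Nonempty := by rw [← Finset.card_pos]; omega
    obtain ⟨a, ha⟩ := hb i0 hi0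
    have hj : ∀ x ∈ Rm K κ, ambMap K κ (monomial (b i0) 1) * x ∈ Pm K κ δ := by
      intro x hx g hg
      rw [ambMap_monomial, cf_sg_mul, one_mul] at hg
      obtain ⟨m, hm⟩ := hx _ hg
      refine ⟨⟨b i0 + m, by rw [map_add, hm]; abel⟩, a + m, ?_⟩
      rw [map_add, hm, ha]; abel
    let j : Rm K κ →ₗ[S] Pm K κ δ := 
      ((mulL (ambMap K κ (monomial (b i0) 1))).comp (Rm K κ).subtype).codRestrict _ 
        (fun x => hj x.1 x.2)
    refine pd_step_lower f g i j hf hg hfg (monomial (b i0) 1) 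
      (monomial (α + b i0) 1 - monomial (β + a) 1) ?_ ?_ ?_ ?_ n hsub
    · intro y
      rw [smul_Yone _ 1 (eval_mon_one _)]
      simp
    · intro y
      rw [smul_Yone _ 0 (by rw [map_sub, eval_mon_one, eval_mon_one, sub_self])]
      simp
    · ext x
      rfl
    · ext x
      change θ * (ambMap K κ (monomial (b i0) 1) * x.1) = ambMap K κ _ * x.1
      rw [map_sub, ambMap_monomial, ambMap_monomial, ambMap_monomial, ← mul_assoc, hθ, sub_mul, 
        sg_mul, sg_mul, map_add, map_add, ha, one_mul]
      congr 3
      abel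

theorem inv_base (hinj : Function.Injective κ) : Inv K κ 0 := by
  set S := MvPolynomial σ K
  let r : S →ₗ[S] Rm K κ := LinearMap.codRestrict _ (Algebra.linearMap S (Amb K κ)) 
    (fun p => mem_Rm_iff.2 ⟨p, rfl⟩)
  have hr : Function.Bijective r := by
    constructor
    · intro x y hxy
      have h := congrArg (fun z => cf z.1) hxy
      have h' : Finsupp.mapDomain κ (AddMonoidAlgebra.coeff x) = 
        Finsupp.mapDomain κ (AddMonoidAlgebra.coeff y) := h
      exact AddMonoidAlgebra.coeff_injective (Finsupp.mapDomain_injective hinj h')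
    · rintro ⟨x, hx⟩
      obtain ⟨p, rfl⟩ := mem_Rm_iff.1 hx
      exact ⟨p, rfl⟩
  let e : S ≃ₗ[S] Rm K κ := LinearEquiv.ofBijective r hr
  refine ⟨pd_of_equiv e _ (pd_one_of_free _), fun hsub => ?_⟩
  let h : Rm K κ →ₗ[S] Yone K σ := (Submodule.mkQ _).comp e.symm.toLinearMap
  have h0 : Ext.mk₀ (ModuleCat.ofHom h) = 0 := Subsingleton.elim _ _
  rw [Ext.mk₀_eq_zero_iff] at h0
  have h1 : h (e 1) = 0 := by
    have := congrArg (fun φ => φ.hom (e 1)) h0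
    exact this
  have h2 : (Submodule.Quotient.mk (e.symm (e 1)) : Yone K σ) = 0 := h1
  rw [e.symm_apply_apply, Submodule.Quotient.mk_eq_zero, RingHom.mem_ker, map_one] at h2
  exact one_ne_zero h2

end
end PartA3

section PartA4

section
variable {σ : Type v} [Finite σ] {ι : Type w}

/-- the map from monomials to the quotient of the lattice -/
def κL (L : AddSubgroup (σ → ℤ)) : (σ →₀ ℕ) →+ ((σ → ℤ) ⧸ L) :=
  (QuotientAddGroup.mk' L).comp
    { toFun := fun m e => (m e : ℤ)
      map_zero' := by ext; simp
      map_add' := by intro a b; ext; simp }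

theorem κL_apply (L : AddSubgroup (σ → ℤ)) (m : σ →₀ ℕ) :
    κL L m = QuotientAddGroup.mk' L (fun e => (m e : ℤ)) := rfl

/-- integer combinations with zero coefficient sum -/
def Lat (s : Finset ι) (c : ι → σ → ℤ) : AddSubgroup (σ → ℤ) where
  carrier := {z | ∃ n : ι → ℤ, ∑ i ∈ s, n i = 0 ∧ z = ∑ i ∈ s, n i • c i}
  add_mem' := by
    rintro _ _ ⟨n, hn, rfl⟩ ⟨m, hm, rfl⟩
    refine ⟨n + m, ?_, ?_⟩
    · simp [sum_add_distrib, hn, hm]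
    · simp [sum_add_distrib, add_smul]
  zero_mem' := ⟨0, by simp, by simp⟩
  neg_mem' := by
    rintro _ ⟨n, hn, rfl⟩
    exact ⟨-n, by simp [hn], by simp⟩

theorem sub_mem_Lat {s : Finset ι} {c : ι → σ → ℤ} {i k : ι} (hi : i ∈ s) (hk : k ∈ s) :
    c i - c k ∈ Lat s c := by
  refine ⟨Pi.single i 1 - Pi.single k 1, ?_, ?_⟩
  · simp [sum_sub_distrib, Finset.sum_pi_single', hi, hk]
  · simp only [Pi.sub_apply, sub_smul, sum_sub_distrib]
    rw [Finset.sum_eq_single i, Finset.sum_eq_single k] <;> simp_all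

theorem Lat_le {s : Finset ι} {c c' : ι → σ → ℤ} (i0 : ι) (hi0 : i0 ∈ s)
    (h : ∀ i ∈ s, ∃ ε : ℤ, c i - c i0 = ε • (c' i - c' i0)) : Lat s c ≤ Lat s c' := by
  rintro _ ⟨n, hn, rfl⟩
  have : ∑ i ∈ s, n i • c i = ∑ i ∈ s, n i • (c i - c i0) := by
    simp only [smul_sub, sum_sub_distrib]
    rw [← Finset.sum_smul, hn]; simp
  rw [this]
  refine AddSubgroup.sum_mem _ fun i hi => AddSubgroup.zsmul_mem _ ?_ _
  obtain ⟨ε, hε⟩ := h i hi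
  rw [hε]
  exact AddSubgroup.zsmul_mem _ (sub_mem_Lat hi hi0) _

theorem Lat_congr {s : Finset ι} {c c' : ι → σ → ℤ} (i0 : ι) (hi0 : i0 ∈ s)
    (h : ∀ i ∈ s, c i - c i0 = c' i - c' i0 ∨ c i - c i0 = - (c' i - c' i0)) :
    Lat s c = Lat s c' := by
  apply le_antisymm
  · refine Lat_le i0 hi0 fun i hi => ?_
    rcases h i hi with h | h
    · exact ⟨1, by rw [h, one_smul]⟩
    · exact ⟨-1, by rw [h, neg_one_smul]⟩
  · refine Lat_le i0 hi0 fun i hi => ?_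
    rcases h i hi with h | h
    · exact ⟨1, by rw [h, one_smul]⟩
    · exact ⟨-1, by rw [h, neg_one_smul, neg_neg]⟩

theorem Lat_mem_coeff {s : Finset ι} {c : ι → σ → ℤ} {i0 : ι} (hi0 : i0 ∈ s) (d : ℤ) (z : σ → ℤ)
    (hz : z - d • c i0 ∈ Lat s c) :
    ∃ n : ι → ℤ, ∑ i ∈ s, n i = d ∧ ∀ e, z e = ∑ i ∈ s, n i * c i e := by
  obtain ⟨n, hn, h⟩ := hz
  refine ⟨n + Pi.single i0 d, ?_, fun e => ?_⟩
  · simp [sum_add_distrib, hn, Finset.sum_pi_single', hi0]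
  · have := congrFun h e
    simp only [Pi.sub_apply, Pi.smul_apply, Finset.sum_apply, smul_eq_mul] at this
    simp only [Pi.add_apply, add_mul, sum_add_distrib]
    have h2 : ∑ x ∈ s, (Pi.single i0 d : ι → ℤ) x * c x e = d * c i0 e := by
      rw [Finset.sum_eq_single i0]
      · simp
      · intro k _ hk; simp [hk]
      · intro h; exact absurd hi0 h
    rw [h2, ← this]; ring

/-- positive part -/
def posP (z : σ → ℤ) : σ →₀ ℕ := Finsupp.equivFunOnFinite.symm (fun e => (z e).toNat)

theorem posP_apply (z : σ → ℤ) (e : σ) : posP z e = (z e).toNat := rfl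

theorem κL_pos_neg (L : AddSubgroup (σ → ℤ)) (z : σ → ℤ) : 
    κL L (posP z) = κL L (posP (-z)) + QuotientAddGroup.mk' L z := by
  rw [κL_apply, κL_apply, ← map_add]
  congr 1
  ext e
  simp only [posP_apply, Pi.add_apply, Pi.neg_apply]
  omega

theorem neg_le_of {s : Finset ι} {c : ι → σ → ℤ} {i : ι} (hi : i ∈ s)
    (hD : ∀ e, c i e < 0 → ∀ k ∈ s, k ≠ i → c k e = 0) (n : ι → ℤ) (hn : 1 ≤ n i)
    (m m' : σ →₀ ℕ) (h : ∀ e, c i e < 0 → (m' e : ℤ) = m e + ∑ k ∈ s, n k * c k e) :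
    posP (- c i) ≤ m := by
  intro e
  rw [posP_apply, Pi.neg_apply]
  by_cases he : c i e < 0
  · have h1 := h e he
    rw [Finset.sum_eq_single i (fun k hk hki => by rw [hD e he k hk hki, mul_zero])
      (fun h => absurd hi h)] at h1
    have : -c i e ≤ m e := by nlinarith
    omega
  · omega

/-- invariant for lattices -/
def InvL (K : Type u) [Field K] (L : AddSubgroup (σ → ℤ)) (n : ℕ) : Prop := Inv K (κL L) n

theorem lat_step (K : Type u) [Field K] (s : Finset ι) (c : ι → σ → ℤ) (j : ι) (hj : j ∉ s)
    (D0 : ∀ i ∈ insert j s, ∃ e, c i e < 0)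
    (D1 : ∀ i ∈ insert j s, ∀ e, c i e < 0 → ∀ k ∈ insert j s, k ≠ i → c k e = 0)
    (D2 : ∀ k ∈ s, ∀ e, c j e ≠ 0 → c k e = 0) (n : ℕ) (hs : s.card = n + 1)
    (hI : InvL K (Lat s c) n) : InvL K (Lat (insert j s) c) (n + 1) := by
  obtain ⟨i0, hi0⟩ : s.Nonempty := by rw [← Finset.card_pos]; omega
  set L := Lat s c with hL
  set L' := Lat (insert j s) c with hL'
  have hLL : L ≤ L' := by
    rintro _ ⟨n, hn, rfl⟩
    have hne : ∀ i ∈ s, i ≠ j := by rintro i hi rfl; exact hj hi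
    refine ⟨fun i => if i = j then 0 else n i, ?_, ?_⟩
    · rw [sum_insert hj, if_pos rfl, zero_add, ← hn]
      exact sum_congr rfl fun i hi => by rw [if_neg (hne i hi)]
    · simp only []
      rw [sum_insert hj, if_pos rfl, zero_smul, zero_add]
      exact sum_congr rfl fun i hi => by rw [if_neg (hne i hi)]
  let π : ((σ → ℤ) ⧸ L) →+ ((σ → ℤ) ⧸ L') := QuotientAddGroup.map L L' (AddMonoidHom.id _) hLL
  have hπκ : π.comp (κL L) = κL L' := rfl
  unfold InvL
  rw [← hπκ]
  set mk := QuotientAddGroup.mk' L with hmk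
  have hmk0 : ∀ z, mk z = 0 ↔ z ∈ L := fun z => QuotientAddGroup.eq_zero_iff z
  have hδ : ∀ i ∈ s, mk (c i) = mk (c i0) := by
    intro i hi
    rw [← sub_eq_zero, ← map_sub, hmk0]
    exact sub_mem_Lat hi hi0
  have hγ : κL L (posP (- c j)) + mk (c i0) - κL L (posP (c j)) = mk (c i0 - c j) := by
    rw [κL_pos_neg L (c j), map_sub]; abel
  -- extraction of coefficients
  have hext : ∀ (m m' : σ →₀ ℕ) (z : σ → ℤ) (d : ℤ), κL L m + d • mk (c i0) + mk z = κL L m' → 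
      ∃ n : ι → ℤ, ∑ i ∈ s, n i = d ∧ ∀ e, (m' e : ℤ) = m e + ∑ i ∈ s, n i * c i e + z e := by
    intro m m' z d h
    have : ((fun e => (m' e : ℤ)) - (fun e => (m e : ℤ)) - z) - d • c i0 ∈ L := by
      rw [← hmk0, map_sub, map_sub, map_sub, map_zsmul, ← κL_apply, ← κL_apply, ← h]; abel
    obtain ⟨n, hn, h⟩ := Lat_mem_coeff hi0 d _ this
    refine ⟨n, hn, fun e => ?_⟩
    rw [← h e]; simp only [Pi.sub_apply]; ring
  refine inv_step (κ := κL L) π (mk (c i0)) (posP (c j)) (posP (- c j)) (fun i => posP (- c i)) s n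
    hs ?_ ?_ ?_ ?_ ?_ ?_ ?_ hI
  · intro g
    obtain ⟨z, rfl⟩ := QuotientAddGroup.mk'_surjective L g
    rw [hγ]
    have h1 : π (QuotientAddGroup.mk' L z) = QuotientAddGroup.mk' L' z := rfl
    rw [h1]
    have h2 : QuotientAddGroup.mk' L' z = 0 ↔ z ∈ L' := QuotientAddGroup.eq_zero_iff z
    rw [h2]
    constructor
    · rintro ⟨n, hn, rfl⟩
      refine ⟨- n j, ?_⟩
      rw [← hmk, ← map_zsmul, ← sub_eq_zero, ← map_sub, hmk0]
      rw [sum_insert hj] at hn ⊢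
      have : n j • c j + ∑ i ∈ s, n i • c i - -n j • (c i0 - c j) = 
        ∑ i ∈ s, n i • (c i - c i0) := by
        simp only [smul_sub, sum_sub_distrib]
        rw [← Finset.sum_smul, show ∑ i ∈ s, n i = - n j by omega]
        simp only [neg_smul]; abel
      rw [this]
      exact AddSubgroup.sum_mem _ fun i hi => AddSubgroup.zsmul_mem _ (sub_mem_Lat hi hi0) _
    · rintro ⟨d, hd⟩
      rw [← hmk, ← map_zsmul, ← sub_eq_zero, ← map_sub, hmk0] at hd
      have := L'.add_mem (hLL hd) (L'.zsmul_mem (sub_mem_Lat (c := c) (mem_insert_of_mem hi0) 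
        (mem_insert_self j s)) d)
      simpa using this
  · intro k hk h0
    rw [hγ, ← map_nsmul, hmk0] at h0
    obtain ⟨n, hn, h0⟩ := h0
    obtain ⟨e, he⟩ := D0 j (mem_insert_self _ _)
    have := congrFun h0 e
    have hz : ∀ i ∈ s, c i e = 0 := fun i hi => D2 i hi e he.ne
    simp only [Pi.sub_apply, Pi.smul_apply, Finset.sum_apply, hz i0 hi0] at this
    rw [Finset.sum_eq_zero (fun i hi => by rw [hz i hi, smul_zero])] at this
    simp at this
    omega
  · rintro _ ⟨m, rfl⟩ d hd ⟨m', hm'⟩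
    rw [hγ] at hm'
    obtain ⟨n, hn, h⟩ := hext m m' (- (d : ℤ) • c j) d (by
      rw [hm', map_zsmul, map_sub, nsmul_sub, neg_smul, natCast_zsmul, natCast_zsmul]; abel)
    obtain ⟨i, hi, hni⟩ : ∃ i ∈ s, 1 ≤ n i := by
      by_contra hcon
      push Not at hcon
      have : ∑ i ∈ s, n i ≤ 0 := Finset.sum_nonpos fun i hi => by have := hcon i hi; omega
      omega
    have hβ : posP (- c i) ≤ m := by
      refine neg_le_of hi (fun e he k hk hki => D1 i (mem_insert_of_mem hi) e he k 
        (mem_insert_of_mem hk) hki) n hni m m' fun e he => ?_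
      have h3 : c j e = 0 := D1 i (mem_insert_of_mem hi) e he j (mem_insert_self _ _) 
        (by rintro rfl; exact hj hi)
      rw [h e]; simp [h3]
    have hαβ : posP (c j) + posP (- c i) ≤ m := by
      intro e
      have h4 := hβ e
      rw [Finsupp.add_apply]
      by_cases he : c j e = 0
      · rw [posP_apply, he]; simpa using h4
      · have h5 : c i e = 0 := D2 i hi e he
        rw [posP_apply (- c i), Pi.neg_apply, h5, posP_apply]
        have h6 := h e
        rw [Finset.sum_eq_zero (fun k hk => by rw [D2 k hk e he, mul_zero])] at h6
        simp only [Pi.smul_apply, smul_eq_mul] at h6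
        have hd' : (1:ℤ) ≤ d := by exact_mod_cast hd
        by_cases hpos : 0 < c j e
        · have : c j e ≤ m e := by nlinarith
          simp; omega
        · simp; omega
    obtain ⟨r, hr⟩ := exists_add_of_le hαβ
    refine ⟨κL L (posP (- c i) + r), ⟨_, rfl⟩, ⟨posP (c i) + r, ?_⟩, ?_⟩
    · rw [map_add, map_add, κL_pos_neg, ← hmk, hδ i hi]; abel
    · rw [hr, ← map_add, add_assoc]
  · intro i hi k hk hik e
    rw [posP_apply, posP_apply, Pi.neg_apply, Pi.neg_apply]
    by_cases he : c i e < 0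
    · right; rw [D1 i (mem_insert_of_mem hi) e he k (mem_insert_of_mem hk) hik.symm]; simp
    · left; omega
  · intro i hi
    refine ⟨posP (c i), ?_⟩
    rw [κL_pos_neg, ← hmk, hδ i hi]
  · intro m m' hm hmm hm'
    obtain ⟨n, hn, h⟩ := hext m m' 0 0 (by simp [hmm])
    have hle : ∀ i ∈ s, n i ≤ 0 := by
      intro i hi
      by_contra hcon
      exact hm i hi (neg_le_of hi (fun e he k hk hki => D1 i (mem_insert_of_mem hi) e he k 
        (mem_insert_of_mem hk) hki) n (by omega) m m' fun e he => by rw [h e]; simp)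
    have hz : ∀ i ∈ s, n i = 0 := (Finset.sum_eq_zero_iff_of_nonpos hle).1 hn
    ext e
    have := h e
    rw [Finset.sum_eq_zero (fun i hi => by rw [hz i hi, zero_mul])] at this
    simp at this
    exact this.symm
  · rintro m hm ⟨m', hm'⟩
    obtain ⟨n, hn, h⟩ := hext m m' 0 1 (by simp [hm'])
    have hle : ∀ i ∈ s, n i ≤ 0 := by
      intro i hi
      by_contra hcon
      exact hm i hi (neg_le_of hi (fun e he k hk hki => D1 i (mem_insert_of_mem hi) e he k 
        (mem_insert_of_mem hk) hki) n (by omega) m m' fun e he => by rw [h e]; simp)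
    have := Finset.sum_nonpos hle
    omega

theorem lat_base (K : Type u) [Field K] (c : ι → σ → ℤ) (i : ι) : InvL K (Lat {i} c) 0 := by
  apply inv_base
  intro m m' h
  rw [κL_apply, κL_apply, ← sub_eq_zero, ← map_sub] at h
  have h : _ ∈ Lat {i} c := (QuotientAddGroup.eq_zero_iff _).1 h
  obtain ⟨n, hn, h⟩ := h
  simp only [sum_singleton] at hn h
  rw [hn, zero_smul] at h
  ext e
  have := congrFun h e
  simp at this
  omega

theorem lat_stage (K : Type u) [Field K] (s t : Finset ι) (c : ι → σ → ℤ) (hst : Disjoint s t)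
    (hs : s.Nonempty)
    (D0 : ∀ i ∈ s ∪ t, ∃ e, c i e < 0)
    (D1 : ∀ i ∈ s ∪ t, ∀ e, c i e < 0 → ∀ k ∈ s ∪ t, k ≠ i → c k e = 0)
    (D2 : ∀ j ∈ t, ∀ k ∈ s ∪ t, k ≠ j → ∀ e, c j e ≠ 0 → c k e = 0)
    (hI : InvL K (Lat s c) (s.card - 1)) : InvL K (Lat (s ∪ t) c) ((s ∪ t).card - 1) := by
  induction t using Finset.induction_on with
  | empty => simpa using hI
  | insert j t hj ih =>
    have hsub : s ∪ t ⊆ s ∪ insert j t := union_subset_union_right (subset_insert _ _)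
    have ih := ih (disjoint_of_subset_right (subset_insert _ _) hst)
      (fun i hi => D0 i (hsub hi)) (fun i hi e he k hk => D1 i (hsub hi) e he k (hsub hk))
      (fun i hi k hk => D2 i (mem_insert_of_mem hi) k (hsub hk))
    have hjs : j ∉ s ∪ t := by
      rw [mem_union, not_or]
      exact ⟨fun h => (disjoint_left.1 hst h) (mem_insert_self _ _), hj⟩
    rw [union_insert] at D0 D1 D2 ⊢
    have hpos : 0 < (s ∪ t).card := card_pos.2 (hs.mono subset_union_left)
    rw [card_insert_of_notMem hjs, show (s ∪ t).card + 1 - 1 = ((s ∪ t).card - 1) + 1 by omega]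
    refine lat_step K (s ∪ t) c j hjs D0 D1 ?_ _ (by omega) ih
    intro k hk e he
    exact D2 j (mem_insert_self _ _) k (mem_insert_of_mem hk) (by rintro rfl; exact hjs hk) e he

end
end PartA4

section PartA5
open CategoryTheory.Abelian

theorem projDim_eq {R : Type u} [CommRing R] (M : ModuleCat.{u} R) (Y : ModuleCat.{u} R) (n : ℕ)
    (h1 : HasProjectiveDimensionLT M (n + 1)) (h2 : ¬ Subsingleton (Ext M Y n)) :
    projDim R M = n := by
  apply le_antisymm
  · apply sInf_le
    exact ⟨n, rfl, exists_resolution_of_hasPD n M h1⟩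
  · apply le_sInf
    rintro _ ⟨m, rfl, P, hP⟩
    have h3 := hasPD_of_resolution P m hP
    by_contra hlt
    rw [not_le, Nat.cast_lt] at hlt
    exact h2 (HasProjectiveDimensionLT.subsingleton M (m + 1) n hlt Y)

section
variable (K : Type u) [Field K] {V : Type v} [Fintype V] (H : SimpleGraph V)

/-- the boundary lattice -/
def bdry : (H.edgeSet → ℤ) →+ (V → ℤ) where
  toFun z v := ∑ e : H.edgeSet, if v ∈ (e : Sym2 V) then z e else 0
  map_zero' := by ext; simp
  map_add' := by intro a b; ext v; simp [← sum_add_distrib, ← ite_add_zero]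

/-- exponent of an edge -/
def eExp (e : Sym2 V) : V →₀ ℕ := Finsupp.equivFunOnFinite.symm (fun v => if v ∈ e then 1 else 0)

theorem edgeMon_eq (e : H.edgeSet) : edgeMon K (e : Sym2 V) = monomial (eExp (e : Sym2 V)) 1 := by
  obtain ⟨e, he⟩ := e
  induction e using Sym2.ind with
  | _ a b =>
    have hab : a ≠ b := H.ne_of_adj he
    change X a * X b = _
    rw [X, X, monomial_mul, one_mul]
    refine congrArg (fun d => monomial d (1 : K)) ?_
    ext v
    simp only [Finsupp.add_apply, Finsupp.single_apply, eExp, Finsupp.equivFunOnFinite_symm_apply_apply, Sym2.mem_iff]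
    by_cases h1 : a = v
    · subst h1; simp [hab.symm]
    · by_cases h2 : b = v
      · subst h2; simp [hab]
      · simp [h1, h2, Ne.symm h1, Ne.symm h2]

/-- exponent map -/
def eMap : (H.edgeSet →₀ ℕ) →+ (V →₀ ℕ) :=
  Finsupp.liftAddHom (fun e => (multiplesHom _ (eExp (e : Sym2 V))))

theorem edgeHom_eq (p : MvPolynomial H.edgeSet K) :
    edgeHom K H p = AddMonoidAlgebra.mapDomainAlgHom K K (eMap H) p := by
  have : edgeHom K H = AddMonoidAlgebra.mapDomainAlgHom K K (eMap H) := by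
    apply MvPolynomial.algHom_ext
    intro e
    rw [edgeHom, aeval_X, edgeMon_eq]
    have : (AddMonoidAlgebra.mapDomainAlgHom K K (eMap H)) (X e : MvPolynomial H.edgeSet K) = 
      AddMonoidAlgebra.single (eMap H (Finsupp.single e 1)) 1 := AddMonoidAlgebra.mapDomain_single
    rw [this]
    simp [eMap]
    rfl
  rw [this]

theorem eMap_apply (m : H.edgeSet →₀ ℕ) (v : V) :
    (eMap H m v : ℤ) = bdry H (fun e => (m e : ℤ)) v := by
  have : eMap H m v = ∑ e : H.edgeSet, if v ∈ (e : Sym2 V) then m e else 0 := by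
    simp only [eMap, Finsupp.liftAddHom_apply]
    rw [Finsupp.sum_fintype _ _ (by simp), Finsupp.finsetSum_apply]
    simp [eExp]
  rw [this]
  simp [bdry]

theorem mapDomain_eq_zero_of {A B D : Type*} (f : A → B) (g : A → D) 
    (h : ∀ a b, f a = f b → g a = g b) (x : A →₀ K) (hx : Finsupp.mapDomain f x = 0) :
    Finsupp.mapDomain g x = 0 := by
  by_cases hA : Nonempty D
  · obtain ⟨ψ, hψ⟩ : ∃ ψ : B → D, ∀ a, ψ (f a) = g a := 
      ⟨fun b => if hb : ∃ a, f a = b then g hb.choose else Classical.arbitrary D, fun a => by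
        have hb : ∃ a', f a' = f a := ⟨a, rfl⟩
        simp only [hb, dif_pos]
        exact h _ _ hb.choose_spec⟩
    have : g = ψ ∘ f := by ext a; exact (hψ a).symm
    rw [this, Finsupp.mapDomain_comp, hx, Finsupp.mapDomain_zero]
  · ext d; exact absurd ⟨d⟩ hA

theorem alg_main (n : ℕ) (h : InvL K (bdry H).ker n) :
    projDim (MvPolynomial H.edgeSet K) (ModuleCat.of _ (edgeRing K H)) = (n : ℕ∞) := by
  set S := MvPolynomial H.edgeSet K
  set κ := κL (bdry H).ker with hκ
  let r : S →ₗ[S] Rm K κ := LinearMap.codRestrict _ (Algebra.linearMap S (Amb K κ)) 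
    (fun p => mem_Rm_iff.2 ⟨p, rfl⟩)
  have hr : Function.Surjective r := by
    rintro ⟨x, hx⟩
    obtain ⟨p, rfl⟩ := mem_Rm_iff.1 hx
    exact ⟨p, rfl⟩
  have hcong : ∀ a b, κ a = κ b ↔ eMap H a = eMap H b := by
    intro a b
    rw [hκ, κL_apply, κL_apply, ← sub_eq_zero, ← map_sub]
    have : (QuotientAddGroup.mk' (bdry H).ker) ((fun e => (a e : ℤ)) - fun e => (b e : ℤ)) = 0 ↔ 
      ((fun e => (a e : ℤ)) - fun e => (b e : ℤ)) ∈ (bdry H).ker := QuotientAddGroup.eq_zero_iff _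
    rw [this, AddMonoidHom.mem_ker, map_sub, sub_eq_zero]
    constructor
    · intro h; ext v
      have := congrFun h v
      rw [← eMap_apply, ← eMap_apply] at this
      exact_mod_cast this
    · intro h; ext v
      rw [← eMap_apply, ← eMap_apply, h]
  have hker : LinearMap.ker r = toricIdeal K H := by
    ext p
    rw [LinearMap.mem_ker, toricIdeal, RingHom.mem_ker]
    change _ ↔ edgeHom K H p = 0
    rw [edgeHom_eq]
    have e1 : r p = 0 ↔ ambMap K κ p = 0 := by
      rw [← Subtype.coe_inj]; rfl
    rw [e1]
    constructor
    · intro h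
      have h := congrArg cf h
      apply AddMonoidAlgebra.coeff_injective
      exact mapDomain_eq_zero_of K κ (eMap H) (fun a b => (hcong a b).1) _ h
    · intro h
      have h := congrArg AddMonoidAlgebra.coeff h
      apply cf_inj
      exact mapDomain_eq_zero_of K (eMap H) κ (fun a b => (hcong a b).2) _ h
  have e := LinearMap.quotKerEquivOfSurjective r hr
  rw [hker] at e
  refine projDim_eq _ (ModuleCat.of S (Yone K H.edgeSet)) n (pd_of_equiv e.symm _ h.1) ?_
  intro hsub
  apply h.2
  have hiso : ModuleCat.of S (Rm K κ) ≅ ModuleCat.of S (edgeRing K H) := e.symm.toModuleIso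
  refine ⟨fun x y => ?_⟩
  have key : ∀ z : Ext (ModuleCat.of S (Rm K κ)) (ModuleCat.of S (Yone K H.edgeSet)) n,
      z = (Ext.mk₀ hiso.hom).comp ((Ext.mk₀ hiso.inv).comp z (zero_add n)) (zero_add n) := by
    intro z
    rw [Ext.mk₀_comp_mk₀_assoc, Iso.hom_inv_id, Ext.mk₀_id_comp]
  rw [key x, key y, Subsingleton.elim ((Ext.mk₀ hiso.inv).comp x (zero_add n))]

end
end PartA5

section PartG1

section GraphOne
variable {V : Type v} {G : SimpleGraph V}

/-- `a` and `b` are joined by a walk avoiding `v`. -/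
def Conn (G : SimpleGraph V) (v a b : V) : Prop := ∃ p : G.Walk a b, v ∉ p.support

lemma Conn.symm {v a b : V} (h : Conn G v a b) : Conn G v b a := by
  obtain ⟨p, hp⟩ := h
  exact ⟨p.reverse, by simpa using hp⟩

lemma Conn.trans {v a b c : V} (h : Conn G v a b) (h' : Conn G v b c) : Conn G v a c := by
  obtain ⟨p, hp⟩ := h
  obtain ⟨q, hq⟩ := h'
  refine ⟨p.append q, ?_⟩
  rw [SimpleGraph.Walk.mem_support_append_iff]
  tauto

lemma Conn.refl {v a : V} (h : v ≠ a) : Conn G v a a :=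
  ⟨SimpleGraph.Walk.nil, by simpa using h⟩

lemma Conn.adj {v a b : V} (h : v ≠ a) (h' : v ≠ b) (hab : G.Adj a b) : Conn G v a b :=
  ⟨SimpleGraph.Walk.cons hab SimpleGraph.Walk.nil, by simp [h, h']⟩

lemma Conn.ne_right {v a b : V} (h : Conn G v a b) : v ≠ b := by
  obtain ⟨p, hp⟩ := h
  rintro rfl
  exact hp p.end_mem_support

lemma conn_of_mem {v a b : V} (q : G.Walk a b) (hq : v ∉ q.support) {x y : V}
    (hx : x ∈ q.support) (hy : y ∈ q.support) : Conn G v x y := by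
  have h1 : ∀ x ∈ q.support, Conn G v a x := fun x hx =>
    ⟨q.takeUntil x hx, fun h => hq (q.support_takeUntil_subset_support hx h)⟩
  exact (h1 x hx).symm.trans (h1 y hy)

lemma cyc_decomp {a : V} (C : G.Walk a a) (hC : C.IsCycle) (v : V) (hv : v ∈ C.support) :
    ∃ x1 x2, ∃ q : G.Walk x1 x2, G.Adj v x1 ∧ G.Adj v x2 ∧ x1 ≠ x2 ∧ q.IsPath ∧ v ∉ q.support ∧
      (∀ u, u ∈ C.support ↔ u = v ∨ u ∈ q.support) ∧
      (∀ e, e ∈ C.edges ↔ e = s(v, x1) ∨ e = s(v, x2) ∨ e ∈ q.edges) := by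
  have hs := fun w => SimpleGraph.Walk.mem_support_rotate_iff (w := w) C v hv
  have he := fun e => (SimpleGraph.Walk.rotate_edges C v hv).mem_iff (a := e)
  have hcy := hC.rotate hv
  generalize C.rotate v hv = D at *
  cases D with
  | nil => exact absurd rfl hcy.ne_nil
  | @cons _ x1 _ h p =>
    rw [SimpleGraph.Walk.cons_isCycle_iff] at hcy
    obtain ⟨hp, hne⟩ := hcy
    obtain ⟨r, rfl⟩ : ∃ r : G.Walk v x1, p = r.reverse := ⟨p.reverse, by simp⟩
    cases r with
    | nil => exact absurd h (G.irrefl)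
    | @cons _ x2 _ h2 r =>
      rw [SimpleGraph.Walk.isPath_reverse_iff, SimpleGraph.Walk.cons_isPath_iff] at hp
      refine ⟨x1, x2, r.reverse, h, h2, ?_, by simpa using hp.1, by simpa using hp.2, ?_, ?_⟩
      · rintro rfl
        apply hne
        simp
      · intro u
        rw [← hs]
        have : u = x2 → u ∈ r.support := fun h => by rw [h]; exact r.start_mem_support
        simp
        tauto
      · intro e
        rw [← he, Sym2.eq_swap (a := v) (b := x2)]
        simp
        tauto

lemma cyc_build {v x1 x2 : V} (q : G.Walk x1 x2) (h1 : G.Adj v x1) (h2 : G.Adj v x2)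
    (hne : x1 ≠ x2) (hq : q.IsPath) (hv : v ∉ q.support) :
    ∃ C : G.Walk v v, C.IsCycle ∧ C.length = q.length + 2 ∧
      (∀ u, u ∈ C.support ↔ u = v ∨ u ∈ q.support) ∧
      (∀ e, e ∈ C.edges ↔ e = s(v, x1) ∨ e = s(v, x2) ∨ e ∈ q.edges) := by
  refine ⟨SimpleGraph.Walk.cons h1 (q.concat h2.symm), ?_, by simp, ?_, ?_⟩
  · rw [SimpleGraph.Walk.cons_isCycle_iff]
    refine ⟨hq.concat hv _, ?_⟩
    intro h
    rw [SimpleGraph.Walk.edges_concat] at h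
    simp at h
    rcases h with h | h
    · exact hv (q.fst_mem_support_of_mem_edges h)
    · rcases h with h | h
      · exact h2.ne h.1
      · exact hne h
  · intro u
    simp [SimpleGraph.Walk.support_concat]
    tauto
  · intro e
    simp [SimpleGraph.Walk.edges_concat, Sym2.eq_swap]
    tauto

lemma path_odd (hE : HasNoEvenCycle G) {v x1 x2 : V} (q : G.Walk x1 x2) (h1 : G.Adj v x1)
    (h2 : G.Adj v x2) (hne : x1 ≠ x2) (hq : q.IsPath) (hv : v ∉ q.support) : Odd q.length := by
  obtain ⟨C, hC, hl, -⟩ := cyc_build q h1 h2 hne hq hv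
  have := hE v C hC
  rw [hl, Nat.not_even_iff_odd] at this
  rw [Nat.odd_iff] at *
  omega

lemma first_hit (S : Set V) {z y : V} (R : G.Walk z y) (hR : R.IsPath) (hy : y ∈ S) :
    ∃ w ∈ S, ∃ Q : G.Walk z w, Q.IsPath ∧ (∀ u ∈ Q.support, u ∈ S → u = w) ∧
      (∀ u ∈ Q.support, u ∈ R.support) := by
  induction R with
  | nil => exact ⟨_, hy, SimpleGraph.Walk.nil, by simp, by simp, by simp⟩
  | @cons z _ _ h p ih =>
    by_cases hz : z ∈ S
    · exact ⟨z, hz, SimpleGraph.Walk.nil, by simp, by simp, by simp⟩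
    · rw [SimpleGraph.Walk.cons_isPath_iff] at hR
      obtain ⟨w, hw, Q, hQ, h1, h2⟩ := ih hR.1 hy
      refine ⟨w, hw, SimpleGraph.Walk.cons h Q, ?_, ?_, ?_⟩
      · rw [SimpleGraph.Walk.cons_isPath_iff]
        exact ⟨hQ, fun hh => hR.2 (h2 _ hh)⟩
      · intro u hu huS
        simp at hu
        rcases hu with rfl | hu
        · exact absurd huS hz
        · exact h1 u hu huS
      · intro u hu
        simp at hu ⊢
        rcases hu with rfl | hu
        · simp
        · right; exact h2 u hu

lemma append_isPath {a b c : V} (p : G.Walk a b) (q : G.Walk b c) (hp : p.IsPath) (hq : q.IsPath)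
    (h : ∀ u ∈ p.support, u ∈ q.support → u = b) : (p.append q).IsPath := by
  induction p with
  | nil => simpa using hq
  | @cons a _ _ h' p ih =>
    rw [SimpleGraph.Walk.cons_isPath_iff] at hp
    rw [SimpleGraph.Walk.cons_append, SimpleGraph.Walk.cons_isPath_iff]
    refine ⟨ih q hp.1 hq fun u hu hu' => h u (by simp [hu]) hu', ?_⟩
    rw [SimpleGraph.Walk.mem_support_append_iff]
    rintro (hh | hh)
    · exact hp.2 hh
    · have := h a (by simp) hh
      subst this
      exact hp.2 p.end_mem_support

/-- No three distinct neighbours of `v` in one component of `G - v`. -/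
lemma no_three (hE : HasNoEvenCycle G) {v x y z : V} (hx : G.Adj v x) (hy : G.Adj v y)
    (hz : G.Adj v z) (hxy : x ≠ y) (hxz : x ≠ z) (hyz : y ≠ z) (h1 : Conn G v x y)
    (h2 : Conn G v z y) : False := by
  obtain ⟨P0, hP0⟩ := h1
  obtain ⟨R0, hR0⟩ := h2
  obtain ⟨P, hP, hvP⟩ : ∃ P : G.Walk x y, P.IsPath ∧ v ∉ P.support :=
    ⟨P0.bypass, P0.bypass_isPath, fun h => hP0 (P0.support_bypass_subset_support h)⟩
  obtain ⟨R, hR, hvR⟩ : ∃ R : G.Walk z y, R.IsPath ∧ v ∉ R.support :=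
    ⟨R0.bypass, R0.bypass_isPath, fun h => hR0 (R0.support_bypass_subset_support h)⟩
  obtain ⟨w, hw, Q, hQ, hQ1, hQ2⟩ := first_hit {u | u ∈ P.support} R hR P.end_mem_support
  have o1 := path_odd hE P hx hy hxy hP hvP
  have hw' : w ∈ P.support := hw
  have hlen : (P.takeUntil w hw').length + (P.dropUntil w hw').length = P.length := by
    conv_rhs => rw [← P.take_spec hw']
    rw [SimpleGraph.Walk.length_append]
  have o2 := path_odd hE (Q.append (P.takeUntil w hw').reverse) hz hx hxz.symm
    (append_isPath _ _ hQ (by simpa using hP.takeUntil hw')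
      (fun u hu hu' => hQ1 u hu (P.support_takeUntil_subset_support hw' (by simpa using hu'))))
    (by
      rw [SimpleGraph.Walk.mem_support_append_iff]
      rintro (h | h)
      · exact hvR (hQ2 _ h)
      · exact hvP (P.support_takeUntil_subset_support hw' (by simpa using h)))
  have o3 := path_odd hE (Q.append (P.dropUntil w hw')) hz hy hyz.symm
    (append_isPath _ _ hQ (hP.dropUntil hw')
      (fun u hu hu' => hQ1 u hu (P.support_dropUntil_subset_support hw' hu')))
    (by
      rw [SimpleGraph.Walk.mem_support_append_iff]
      rintro (h | h)
      · exact hvR (hQ2 _ h)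
      · exact hvP (P.support_dropUntil_subset_support hw' h))
  simp only [SimpleGraph.Walk.length_append, SimpleGraph.Walk.length_reverse, Nat.odd_iff] at *
  omega

end GraphOne
end PartG1

section PartG2

section GraphTwo
variable {V : Type v} {G : SimpleGraph V}

/-- `S` is the vertex set of a cycle of `G`. -/
def IsCyc (G : SimpleGraph V) (S : Set V) : Prop :=
  ∃ a, ∃ C : G.Walk a a, C.IsCycle ∧ S = {x | x ∈ C.support}

/-- `v` has at least three neighbours. -/
def Big (G : SimpleGraph V) (v : V) : Prop :=
  ∃ x y z, G.Adj v x ∧ G.Adj v y ∧ G.Adj v z ∧ x ≠ y ∧ x ≠ z ∧ y ≠ z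

lemma cycle_induced (hE : HasNoEvenCycle G) {a : V} (C : G.Walk a a) (hC : C.IsCycle) {x y : V}
    (hx : x ∈ C.support) (hy : y ∈ C.support) (hxy : G.Adj x y) : s(x, y) ∈ C.edges := by
  obtain ⟨x1, x2, q, h1, h2, hne, hq, hv, hs, he⟩ := cyc_decomp C hC x hx
  rw [he]
  by_contra hcon
  push Not at hcon
  have e1 : x1 ≠ y := by rintro rfl; exact hcon.1 rfl
  have e2 : x2 ≠ y := by rintro rfl; exact hcon.2.1 rfl
  have hyq : y ∈ q.support := by
    rcases (hs y).1 hy with h | h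
    · exact absurd h hxy.ne'
    · exact h
  exact no_three hE h1 hxy h2 e1 hne e2.symm (conn_of_mem q hv q.start_mem_support hyq)
    (conn_of_mem q hv q.end_mem_support hyq)

lemma IsCyc.decomp (hE : HasNoEvenCycle G) {S : Set V} (hS : IsCyc G S) {v : V} (hv : v ∈ S) :
    ∃ x1 x2, ∃ q : G.Walk x1 x2, G.Adj v x1 ∧ G.Adj v x2 ∧ x1 ≠ x2 ∧ q.IsPath ∧ v ∉ q.support ∧
      (∀ u, u ∈ S ↔ u = v ∨ u ∈ q.support) ∧
      (∀ x y, x ∈ S → y ∈ S → G.Adj x y → s(x, y) = s(v, x1) ∨ s(x, y) = s(v, x2) ∨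
        s(x, y) ∈ q.edges) := by
  obtain ⟨a, C, hC, rfl⟩ := hS
  obtain ⟨x1, x2, q, h1, h2, hne, hq, hv, hs, he⟩ := cyc_decomp C hC v hv
  refine ⟨x1, x2, q, h1, h2, hne, hq, hv, hs, ?_⟩
  intro x y hx hy hxy
  rw [← he]
  exact cycle_induced hE C hC hx hy hxy

lemma IsCyc.decomp_ne (hE : HasNoEvenCycle G) {S : Set V} (hS : IsCyc G S) {v : V} (hv : v ∈ S)
    (b : V) :
    ∃ x1 x2, ∃ q : G.Walk x1 x2, G.Adj v x1 ∧ G.Adj v x2 ∧ x1 ≠ x2 ∧ x1 ≠ b ∧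
      q.IsPath ∧ v ∉ q.support ∧
      (∀ u, u ∈ S ↔ u = v ∨ u ∈ q.support) ∧
      (∀ x y, x ∈ S → y ∈ S → G.Adj x y → s(x, y) = s(v, x1) ∨ s(x, y) = s(v, x2) ∨
        s(x, y) ∈ q.edges) := by
  obtain ⟨x1, x2, q, h1, h2, hne, hq, hv, hs, he⟩ := hS.decomp hE hv
  by_cases hb : x1 = b
  · refine ⟨x2, x1, q.reverse, h2, h1, hne.symm, fun h => hne (hb.trans h.symm), by simpa using hq,
      by simpa using hv, by simpa using hs, ?_⟩
    intro x y hx hy hxy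
    have := he x y hx hy hxy
    simp only [SimpleGraph.Walk.edges_reverse, List.mem_reverse]
    tauto
  · exact ⟨x1, x2, q, h1, h2, hne, hb, hq, hv, hs, he⟩

lemma IsCyc.conn {S : Set V} (hS : IsCyc G S) {v x y : V}
    (hx : x ∈ S) (hy : y ∈ S) (hxv : x ≠ v) (hyv : y ≠ v) : Conn G v x y := by
  obtain ⟨a, C, hC, rfl⟩ := hS
  by_cases hv : v ∈ C.support
  · obtain ⟨x1, x2, q, h1, h2, hne, hq, hv, hs, he⟩ := cyc_decomp C hC v hv
    have hx' : x ∈ q.support := by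
      rcases (hs x).1 hx with h | h
      · exact absurd h hxv
      · exact h
    have hy' : y ∈ q.support := by
      rcases (hs y).1 hy with h | h
      · exact absurd h hyv
      · exact h
    exact conn_of_mem q hv hx' hy'
  · exact conn_of_mem C hv hx hy

lemma IsCyc.two (hE : HasNoEvenCycle G) {S : Set V} (hS : IsCyc G S) {v : V} (hv : v ∈ S) :
    ∃ x1 x2, x1 ∈ S ∧ x2 ∈ S ∧ x1 ≠ x2 ∧ G.Adj v x1 ∧ G.Adj v x2 := by
  obtain ⟨x1, x2, q, h1, h2, hne, hq, hv, hs, he⟩ := hS.decomp hE hv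
  exact ⟨x1, x2, (hs _).2 (Or.inr q.start_mem_support), (hs _).2 (Or.inr q.end_mem_support),
    hne, h1, h2⟩

lemma IsCyc.local_step (hE : HasNoEvenCycle G) {S : Set V} (hS : IsCyc G S) {v x y : V}
    (hv : v ∈ S) (hx : x ∈ S) (hvx : G.Adj v x) (hvy : G.Adj v y)
    (hc : Conn G v x y) : y ∈ S := by
  obtain ⟨x1, x2, m1, m2, hne, h1, h2⟩ := hS.two hE hv
  by_contra hy
  exact no_three hE h1 hvy h2 (fun h => hy (h ▸ m1)) hne (fun h => hy (h ▸ m2))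
    ((hS.conn m1 hx h1.ne' hvx.ne').trans hc) ((hS.conn m2 hx h2.ne' hvx.ne').trans hc)

lemma IsCyc.propagate (hE : HasNoEvenCycle G) {S S' : Set V} (hS : IsCyc G S) (hS' : IsCyc G S')
    {x y : V} (q : G.Walk x y) (hq : q.IsPath) (hqS : ∀ w ∈ q.support, w ∈ S') :
    ∀ u, u ∉ q.support → u ∈ S → u ∈ S' → G.Adj u x → x ∈ S → ∀ w ∈ q.support, w ∈ S := by
  induction q with
  | nil =>
    intro u _ _ _ _ hx w hw
    simp at hw
    rw [hw]; exact hx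
  | @cons x x' _ h q ih =>
    intro u hu huS huS' hux hx w hw
    rw [SimpleGraph.Walk.cons_isPath_iff] at hq
    simp only [SimpleGraph.Walk.support_cons, List.mem_cons] at hw hu hqS
    rcases hw with rfl | hw
    · exact hx
    · have hx' : x' ∈ S := hS.local_step hE hx huS hux.symm h
        (hS'.conn huS' (hqS _ (Or.inr q.start_mem_support)) hux.ne h.ne')
      exact ih hq.1 (fun w hw => hqS w (Or.inr hw)) x hq.2 hx (hqS _ (Or.inl rfl)) h hx' w hw

lemma IsCyc.subset (hE : HasNoEvenCycle G) {S S' : Set V} (hS : IsCyc G S) (hS' : IsCyc G S')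
    {v x : V} (hvx : G.Adj v x) (h1 : v ∈ S) (h2 : x ∈ S) (h1' : v ∈ S') (h2' : x ∈ S') :
    S' ⊆ S := by
  obtain ⟨x1, x2, q, a1, a2, hne, hq, hv, hs, he⟩ := hS'.decomp hE h1'
  have m1 : x1 ∈ S' := (hs _).2 (Or.inr q.start_mem_support)
  have hx1 : x1 ∈ S := by
    exact hS.local_step hE h1 h2 hvx a1 (hS'.conn h2' m1 hvx.ne' a1.ne')
  intro w hw
  rcases (hs w).1 hw with rfl | hw
  · exact h1
  · exact hS.propagate hE hS' q hq (fun w hw => (hs w).2 (Or.inr hw)) v hv h1 h1' a1 hx1 w hw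

/-- Two cycles sharing an edge coincide. -/
lemma IsCyc.eq (hE : HasNoEvenCycle G) {S S' : Set V} (hS : IsCyc G S) (hS' : IsCyc G S')
    {v x : V} (hvx : G.Adj v x) (h1 : v ∈ S) (h2 : x ∈ S) (h1' : v ∈ S') (h2' : x ∈ S') :
    S = S' :=
  Set.Subset.antisymm (hS'.subset hE hS hvx h1' h2' h1 h2) (hS.subset hE hS' hvx h1 h2 h1' h2')

lemma big_of (hE : HasNoEvenCycle G) {S : Set V} (hS : IsCyc G S) {v y : V} (hv : v ∈ S)
    (hvy : G.Adj v y) (hy : y ∉ S) : Big G v := by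
  obtain ⟨x1, x2, m1, m2, hne, h1, h2⟩ := hS.two hE hv
  exact ⟨x1, x2, y, h1, h2, hvy, hne, fun h => hy (h ▸ m1), fun h => hy (h ▸ m2)⟩

lemma exists_cyc_aux [Fintype V] (hD : ∀ v u : V, ∃ y, G.Adj v y ∧ y ≠ u) {u x : V}
    (hux : G.Adj u x) (n : ℕ) : ∀ (w : V) (p : G.Walk w x), p.IsPath → u ∉ p.support →
      Fintype.card V ≤ p.length + n → ∃ S, IsCyc G S ∧ ∀ w ∈ S, w = u ∨ Conn G u x w := by
  induction n with
  | zero =>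
    intro w p hp _ h
    have := hp.length_lt
    omega
  | succ n ih =>
    intro w p hp hu hn
    have key : ∀ y, G.Adj w y → y ≠ u → y ∉ p.support →
        ∃ S, IsCyc G S ∧ ∀ w ∈ S, w = u ∨ Conn G u x w := by
      intro y hwy hyu hy
      refine ih y (SimpleGraph.Walk.cons hwy.symm p) ?_ ?_ ?_
      · rw [SimpleGraph.Walk.cons_isPath_iff]
        exact ⟨hp, hy⟩
      · simp [hu, hyu.symm]
      · simp only [SimpleGraph.Walk.length_cons]
        omega
    cases p with
    | nil =>
      obtain ⟨y, hy, hyu⟩ := hD x u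
      exact key y hy hyu (by simpa using hy.ne')
    | @cons _ w' _ h p' =>
      obtain ⟨y, hy, hyw⟩ := hD w w'
      by_cases hyu : y = u
      · subst hyu
        have hwx : w ≠ x := by
          rintro rfl
          rw [SimpleGraph.Walk.cons_isPath_iff] at hp
          exact hp.2 p'.end_mem_support
        obtain ⟨C, hC, -, hs, -⟩ := cyc_build _ hy.symm hux hwx hp hu
        refine ⟨_, ⟨_, C, hC, rfl⟩, ?_⟩
        intro w hw
        rcases (hs w).1 hw with h | h
        · exact Or.inl h
        · exact Or.inr (conn_of_mem _ hu (SimpleGraph.Walk.end_mem_support _) h)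
      · by_cases hyp : y ∈ (SimpleGraph.Walk.cons h p').support
        · have hyp' : y ∈ p'.support := by
            simp at hyp
            rcases hyp with h | h
            · exact absurd h hy.ne'
            · exact h
          have hp0 := hp
          rw [SimpleGraph.Walk.cons_isPath_iff] at hp
          obtain ⟨C, hC, -, hs, -⟩ := cyc_build (p'.takeUntil y hyp') h hy hyw.symm
            (hp.1.takeUntil hyp') (fun hh => hp.2 (p'.support_takeUntil_subset_support hyp' hh))
          refine ⟨_, ⟨_, C, hC, rfl⟩, ?_⟩
          intro z hz
          right
          refine conn_of_mem _ hu (SimpleGraph.Walk.end_mem_support _) ?_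
          rcases (hs z).1 hz with h | h
          · simp [h]
          · have := p'.support_takeUntil_subset_support hyp' h
            simp [this]
        · exact key y hy hyu hyp

lemma exists_cyc [Fintype V] (hD : ∀ v u : V, ∃ y, G.Adj v y ∧ y ≠ u) {u x : V}
    (hux : G.Adj u x) : ∃ S, IsCyc G S ∧ ∀ w ∈ S, w = u ∨ Conn G u x w :=
  exists_cyc_aux hD hux (Fintype.card V) x SimpleGraph.Walk.nil (by simp)
    (by simpa using hux.ne) (by simp)

/-- Joining edges between disjoint cycles. -/
lemma join_edge (hE : HasNoEvenCycle G) (hO : OddCycleCondition G) {S S' : Set V}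
    (hS : IsCyc G S) (hS' : IsCyc G S') (hd : ∀ x, x ∈ S → x ∈ S' → False) :
    ∃ x ∈ S, ∃ y ∈ S', G.Adj x y := by
  obtain ⟨a, C, hC, rfl⟩ := hS
  obtain ⟨a', C', hC', rfl⟩ := hS'
  exact hO a a' C C' hC hC' (Nat.not_even_iff_odd.1 (hE _ _ hC))
    (Nat.not_even_iff_odd.1 (hE _ _ hC')) (fun x h h' => hd x h h')

lemma exists_far (hE : HasNoEvenCycle G) {u : V} (v : V) (hu : Big G u) :
    ∃ x, G.Adj u x ∧ ¬ Conn G u x v := by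
  obtain ⟨x, y, z, hx, hy, hz, hxy, hxz, hyz⟩ := hu
  by_contra hcon
  push Not at hcon
  exact no_three hE hx hy hz hxy hxz hyz ((hcon x hx).trans (hcon y hy).symm)
    ((hcon z hz).trans (hcon y hy).symm)

lemma far_disjoint {u v x y w : V} (huv : u ≠ v) (hux : G.Adj u x) (hx : ¬ Conn G u x v)
    (hy : ¬ Conn G v y u) (h1 : Conn G u x w) (h2 : Conn G v y w) : False := by
  obtain ⟨p, hp⟩ := h1
  have hvp : v ∉ p.support := by
    intro h
    exact hx (conn_of_mem p hp p.start_mem_support h)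
  have hxv : v ≠ x := by rintro rfl; exact hvp p.start_mem_support
  have hc : Conn G v x w := ⟨p, hvp⟩
  exact hy (h2.trans (hc.symm.trans (Conn.adj hxv huv.symm hux.symm)))

lemma big_adj [Fintype V] (hD : ∀ v u : V, ∃ y, G.Adj v y ∧ y ≠ u) (hE : HasNoEvenCycle G)
    (hO : OddCycleCondition G) {u v : V} (huv : u ≠ v) (hu : Big G u) (hv : Big G v) :
    G.Adj u v := by
  obtain ⟨x, hux, hx⟩ := exists_far hE v hu
  obtain ⟨y, hvy, hy⟩ := exists_far hE u hv
  obtain ⟨S, hS, hS1⟩ := exists_cyc hD hux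
  obtain ⟨S', hS', hS1'⟩ := exists_cyc hD hvy
  have n1 : v ∉ S := fun h => (hS1 v h).elim (fun h => huv h.symm) hx
  have n2 : u ∉ S' := fun h => (hS1' u h).elim (fun h => huv h) hy
  obtain ⟨a, ha, b, hb, hab⟩ := join_edge hE hO hS hS' (fun w hw hw' => by
    rcases hS1 w hw with rfl | h
    · exact n2 hw'
    · rcases hS1' w hw' with rfl | h'
      · exact n1 hw
      · exact far_disjoint huv hux hx hy h h')
  rcases hS1 a ha with rfl | h
  · rcases hS1' b hb with rfl | h'
    · exact hab
    · exact absurd (h'.trans (Conn.adj h'.ne_right huv.symm hab.symm)) hy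
  · rcases hS1' b hb with rfl | h'
    · exact absurd (h.trans (Conn.adj h.ne_right huv hab)) hx
    · exfalso
      have : u ≠ b := by rintro rfl; exact n2 hb
      exact far_disjoint huv hux hx hy (h.trans (Conn.adj h.ne_right this hab)) h'

lemma cyc_of_walk {a b : V} (hab : G.Adj a b) (p : G.Walk a b) (hp : s(a, b) ∉ p.edges) :
    ∃ S, IsCyc G S ∧ a ∈ S ∧ b ∈ S := by
  refine ⟨_, ⟨b, SimpleGraph.Walk.cons hab.symm p.bypass, ?_, rfl⟩, by simp, by simp⟩
  rw [SimpleGraph.Walk.cons_isCycle_iff]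
  refine ⟨p.bypass_isPath, fun h => hp ?_⟩
  rw [Sym2.eq_swap]
  exact p.edges_bypass_subset_edges h

lemma bridge_avoid {a b : V} (hD : ∀ S, IsCyc G S → a ∈ S → b ∉ S) (hE : HasNoEvenCycle G)
    (hab : G.Adj a b) {S : Set V} (hS : IsCyc G S)
    (hS1 : ∀ w ∈ S, w = a ∨ Conn G a b w) : a ∉ S := by
  intro ha
  have hb := hD S hS ha
  obtain ⟨x1, x2, m1, m2, hne, h1, h2⟩ := hS.two hE ha
  have c1 : Conn G a b x1 := (hS1 x1 m1).resolve_left h1.ne'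
  have c2 : Conn G a b x2 := (hS1 x2 m2).resolve_left h2.ne'
  exact no_three hE h1 hab h2 (fun h => hb (h ▸ m1)) hne (fun h => hb (h ▸ m2)) c1.symm c2.symm

/-- An edge in no cycle joins two vertices of degree at least three. -/
lemma bridge_big [Fintype V] (hD : ∀ v u : V, ∃ y, G.Adj v y ∧ y ≠ u) (hE : HasNoEvenCycle G)
    (hO : OddCycleCondition G) {a b : V} (hab : G.Adj a b)
    (hn : ∀ S, IsCyc G S → a ∈ S → b ∉ S) : Big G a ∧ Big G b := by
  obtain ⟨S, hS, hS1⟩ := exists_cyc hD hab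
  obtain ⟨S', hS', hS1'⟩ := exists_cyc hD hab.symm
  have n1 := bridge_avoid hn hE hab hS hS1
  have n2 := bridge_avoid (fun S hS hb ha => hn S hS ha hb) hE hab.symm hS' hS1'
  have k1 : ∀ w ∈ S, Conn G a b w := fun w hw =>
    (hS1 w hw).resolve_left (fun h => n1 (h ▸ hw))
  have k2 : ∀ w ∈ S', Conn G b a w := fun w hw =>
    (hS1' w hw).resolve_left (fun h => n2 (h ▸ hw))
  obtain ⟨c, hc, d, hd, hcd⟩ := join_edge hE hO hS hS' (fun w hw hw' => by
    obtain ⟨p, hp⟩ := k1 w hw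
    obtain ⟨q, hq⟩ := k2 w hw'
    obtain ⟨T, hT, h1, h2⟩ := cyc_of_walk hab (q.append p.reverse) (by
      intro h
      rw [SimpleGraph.Walk.edges_append, List.mem_append] at h
      rcases h with h | h
      · exact hq (q.snd_mem_support_of_mem_edges h)
      · simp at h
        exact hp (p.fst_mem_support_of_mem_edges h))
    exact hn T hT h1 h2)
  obtain ⟨p, hp⟩ := k1 c hc
  obtain ⟨q, hq⟩ := k2 d hd
  by_cases he : s(a, b) = s(d, c)
  · rw [Sym2.eq_iff] at he
    rcases he with ⟨rfl, rfl⟩ | ⟨rfl, rfl⟩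
    · exact ⟨big_of hE hS' hd hab n2, big_of hE hS hc hab.symm n1⟩
    · exact absurd hc n1
  · exfalso
    obtain ⟨T, hT, h1, h2⟩ := cyc_of_walk hab
      (q.append (SimpleGraph.Walk.cons hcd.symm p.reverse)) (by
      intro h
      rw [SimpleGraph.Walk.edges_append, List.mem_append, SimpleGraph.Walk.edges_cons,
        List.mem_cons] at h
      rcases h with h | h | h
      · exact hq (q.snd_mem_support_of_mem_edges h)
      · exact he h
      · simp at h
        exact hp (p.fst_mem_support_of_mem_edges h))
    exact hn T hT h1 h2

lemma no_four (hE : HasNoEvenCycle G) {a b c d : V} (hab : G.Adj a b) (hbc : G.Adj b c)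
    (hcd : G.Adj c d) (hda : G.Adj d a) (hac : a ≠ c) (hbd : b ≠ d) : False := by
  have := path_odd hE (SimpleGraph.Walk.cons hbc (SimpleGraph.Walk.cons hcd SimpleGraph.Walk.nil))
    hab hda.symm hbd (by simp [hbc.ne, hcd.ne, hbd]) (by simp [hab.ne, hac, hda.ne'])
  simp at this
  exact absurd this (by decide)

lemma cyc_univ (hE : HasNoEvenCycle G) (hC : G.Connected) {S : Set V} (hS : IsCyc G S)
    (hn : ∀ v ∈ S, ¬ Big G v) (v : V) : v ∈ S := by
  obtain ⟨a, ha⟩ : ∃ a, a ∈ S := by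
    obtain ⟨a, C, hC, rfl⟩ := hS
    exact ⟨a, C.start_mem_support⟩
  have : ∀ {a b : V} (_ : G.Walk a b), a ∈ S → b ∈ S := by
    intro a b p
    induction p with
    | nil => exact id
    | cons h p ih =>
      intro ha
      apply ih
      by_contra hb
      exact hn _ ha (big_of hE hS ha h hb)
  obtain ⟨p⟩ := hC.preconnected a v
  exact this p ha

/-- The two possible shapes of a compact graph. -/
lemma shapes [Fintype V] (hD : ∀ v u : V, ∃ y, G.Adj v y ∧ y ≠ u) (hE : HasNoEvenCycle G)
    (hO : OddCycleCondition G) (hC : G.Connected) :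
    (∃ v1 v2, G.Adj v1 v2 ∧ ∀ v, Big G v → v = v1 ∨ v = v2) ∨
    (∃ v1 v2 v3, G.Adj v1 v2 ∧ G.Adj v1 v3 ∧ G.Adj v2 v3 ∧
      ∀ v, Big G v → v = v1 ∨ v = v2 ∨ v = v3) := by
  by_cases h1 : ∃ v1, Big G v1
  · obtain ⟨v1, b1⟩ := h1
    by_cases h2 : ∃ v2, Big G v2 ∧ v2 ≠ v1
    · obtain ⟨v2, b2, n2⟩ := h2
      have a12 := big_adj hD hE hO n2.symm b1 b2
      by_cases h3 : ∃ v3, Big G v3 ∧ v3 ≠ v1 ∧ v3 ≠ v2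
      · obtain ⟨v3, b3, n31, n32⟩ := h3
        right
        refine ⟨v1, v2, v3, a12, big_adj hD hE hO n31.symm b1 b3,
          big_adj hD hE hO n32.symm b2 b3, ?_⟩
        intro v hv
        by_contra hcon
        push Not at hcon
        exact no_four hE a12 (big_adj hD hE hO n32.symm b2 b3)
          (big_adj hD hE hO hcon.2.2.symm b3 hv) (big_adj hD hE hO hcon.1 hv b1) n31.symm
          hcon.2.1.symm
      · left
        push Not at h3
        exact ⟨v1, v2, a12, fun v hv => by
          by_cases h : v = v1
          · exact Or.inl h
          · exact Or.inr (h3 v hv h)⟩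
    · push Not at h2
      obtain ⟨y, hy, -⟩ := hD v1 v1
      exact Or.inl ⟨v1, y, hy, fun v hv => Or.inl (h2 v hv)⟩
  · push Not at h1
    obtain ⟨v1⟩ := hC.nonempty
    obtain ⟨y, hy, -⟩ := hD v1 v1
    exact Or.inl ⟨v1, y, hy, fun v hv => absurd hv (h1 v)⟩

lemma tri_cyc {v1 v2 v3 : V} (h12 : G.Adj v1 v2) (h13 : G.Adj v1 v3) (h23 : G.Adj v2 v3) :
    IsCyc G {v1, v2, v3} := by
  obtain ⟨C, hC, -, hs, -⟩ := cyc_build (SimpleGraph.Walk.cons h23 SimpleGraph.Walk.nil)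
    h12 h13 h23.ne (by simp [h23.ne]) (by simp [h12.ne, h13.ne])
  refine ⟨v1, C, hC, ?_⟩
  ext u
  simp [hs]

lemma min_deg [Fintype V] (h : ∀ v, 2 ≤ (G.neighborSet v).ncard) (v u : V) :
    ∃ y, G.Adj v y ∧ y ≠ u := by
  obtain ⟨y, hy, hyu⟩ := Set.exists_ne_of_one_lt_ncard (h v) u
  exact ⟨y, hy, hyu⟩

lemma cycleCount_eq (hE : HasNoEvenCycle G) : cycleCount G = Set.ncard {S | IsCyc G S} := by
  unfold cycleCount
  congr 1
  ext S
  constructor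
  · rintro ⟨a, c, hc, -, rfl⟩
    exact ⟨a, c, hc, rfl⟩
  · rintro ⟨a, c, hc, rfl⟩
    exact ⟨a, c, hc, fun x y hx hy hxy => cycle_induced hE c hc hx hy hxy, rfl⟩

end GraphTwo
end PartG2

section PartG3


section GraphThree
variable {V : Type v} [Fintype V] {H : SimpleGraph V}

lemma bdry_apply (z : H.edgeSet → ℤ) (v : V) :
    bdry H z v = ∑ e : H.edgeSet, if v ∈ (e : Sym2 V) then z e else 0 := rfl

/-- The indicator vector of an edge. -/
def ed {a b : V} (h : H.Adj a b) : H.edgeSet → ℤ := Pi.single ⟨s(a, b), h⟩ 1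

lemma bdry_ed {a b : V} (h : H.Adj a b) (u : V) :
    bdry H (ed h) u = (if u = a then 1 else 0) + (if u = b then 1 else 0) := by
  rw [bdry_apply, Finset.sum_eq_single ⟨s(a, b), h⟩]
  · have := h.ne
    simp only [ed, Pi.single_eq_same, Sym2.mem_iff]
    by_cases h1 : u = a <;> by_cases h2 : u = b <;> simp_all
  · intro e _ he
    simp [ed, Pi.single_eq_of_ne he]
  · simp

/-- Alternating sum of the edges of a walk. -/
def sgn : {a b : V} → H.Walk a b → (H.edgeSet → ℤ)
  | _, _, SimpleGraph.Walk.nil => 0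
  | _, _, SimpleGraph.Walk.cons h p => ed h - sgn p

lemma bdry_sgn {a b : V} (p : H.Walk a b) (u : V) :
    bdry H (sgn p) u = (if u = a then 1 else 0) - (-1) ^ p.length * (if u = b then 1 else 0) := by
  induction p with
  | nil => simp [sgn]
  | cons h p ih =>
    rw [sgn, map_sub, Pi.sub_apply, ih, bdry_ed, SimpleGraph.Walk.length_cons, pow_succ]
    ring

lemma sgn_zero {a b : V} (p : H.Walk a b) (e : H.edgeSet) (he : (e : Sym2 V) ∉ p.edges) :
    sgn p e = 0 := by
  induction p with
  | nil => simp [sgn]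
  | cons h p ih =>
    simp only [SimpleGraph.Walk.edges_cons, List.mem_cons, not_or] at he
    rw [sgn, Pi.sub_apply, ih he.2, ed, Pi.single_eq_of_ne]
    · simp
    · intro h
      exact he.1 (by rw [h])

lemma sgn_abs {a b : V} (p : H.Walk a b) (hp : p.IsTrail) (e : H.edgeSet) :
    sgn p e ≤ 1 ∧ -1 ≤ sgn p e := by
  induction p with
  | nil => simp [sgn]
  | @cons a a' _ h p ih =>
    rw [SimpleGraph.Walk.isTrail_cons] at hp
    rw [sgn, Pi.sub_apply]
    by_cases he : e = ⟨s(a, a'), h⟩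
    · subst he
      rw [sgn_zero p _ hp.2]
      simp [ed]
    · rw [ed, Pi.single_eq_of_ne he]
      have := ih hp.1
      omega

lemma deg_two {u x' x : V} (hx : ¬ Big H x) (h1 : H.Adj x u) (h2 : H.Adj x x') (hne : u ≠ x')
    (z : H.edgeSet → ℤ) :
    bdry H z x = z ⟨s(x, u), h1⟩ + z ⟨s(x, x'), h2⟩ := by
  have hne' : (⟨s(x, u), h1⟩ : H.edgeSet) ≠ ⟨s(x, x'), h2⟩ := by
    intro h
    have := congrArg Subtype.val h
    simp at this
    rcases this with h | h
    · exact hne h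
    · exact h2.ne h.1
  rw [bdry_apply, ← Finset.sum_subset (Finset.subset_univ {⟨s(x, u), h1⟩, ⟨s(x, x'), h2⟩}),
    Finset.sum_pair hne']
  · simp
  · rintro ⟨e, he⟩ _ hn
    rw [if_neg]
    intro hxe
    obtain ⟨y, rfl⟩ := Sym2.mem_iff_exists.1 hxe
    apply hn
    have hy : H.Adj x y := he
    have : y = u ∨ y = x' := by
      by_contra hcon
      push Not at hcon
      exact hx ⟨y, u, x', hy, h1, h2, hcon.1, hcon.2, hne⟩
    rcases this with rfl | rfl <;> simp

lemma prop_zero (z : H.edgeSet → ℤ) {x y : V} (q : H.Walk x y) (hq : q.IsPath)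
    (hb : ∀ t ∈ q.support, t ≠ y → ¬ Big H t ∧ bdry H z t = 0) :
    ∀ u (hu : H.Adj u x), u ∉ q.support → z ⟨s(u, x), hu⟩ = 0 →
      ∀ e : H.edgeSet, (e : Sym2 V) ∈ q.edges → z e = 0 := by
  induction q with
  | nil => simp
  | @cons x x' y h q ih =>
    intro u hu huq hz e he
    rw [SimpleGraph.Walk.cons_isPath_iff] at hq
    simp only [SimpleGraph.Walk.support_cons, List.mem_cons, not_or] at huq hb
    have hxy : x ≠ y := by rintro rfl; exact hq.2 q.end_mem_support
    have hb' := hb x (Or.inl rfl) hxy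
    have hne : u ≠ x' := by rintro rfl; exact huq.2 q.start_mem_support
    have hd := deg_two hb'.1 hu.symm h hne z
    have e1 : (⟨s(x, u), hu.symm⟩ : H.edgeSet) = ⟨s(u, x), hu⟩ := Subtype.ext Sym2.eq_swap
    rw [hb'.2, e1, hz, zero_add] at hd
    simp only [SimpleGraph.Walk.edges_cons, List.mem_cons] at he
    rcases he with he | he
    · have : e = ⟨s(x, x'), h⟩ := Subtype.ext he
      rw [this, ← hd]
    · exact ih hq.1 (fun t ht hty => hb t (Or.inr ht) hty) x h hq.2 hd.symm e he

/-- A vector attached to a cycle `S` with root `v`. -/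
structure CV (H : SimpleGraph V) (v : V) (S : Set V) (c : H.edgeSet → ℤ) : Prop where
  supp : ∀ e : H.edgeSet, c e ≠ 0 → ∀ u ∈ (e : Sym2 V), u ∈ S
  bd : ∀ u, bdry H c u = if u = v then 2 else 0
  le : ∀ e, c e ≤ 1

lemma CV.neg {v : V} {S : Set V} {c : H.edgeSet → ℤ} (h : CV H v S c) : ∃ e, c e < 0 := by
  by_contra hcon
  push Not at hcon
  have h1 := h.bd v
  rw [if_pos rfl, bdry_apply] at h1
  obtain ⟨e, -, he⟩ : ∃ e ∈ (Finset.univ : Finset H.edgeSet),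
      0 < (if v ∈ (e : Sym2 V) then c e else 0) := by
    apply Finset.exists_lt_of_sum_lt
    simp only [Finset.sum_const_zero]
    omega
  split_ifs at he with hv
  · obtain ⟨e, he'⟩ := e
    obtain ⟨y, rfl⟩ := Sym2.mem_iff_exists.1 hv
    have hy : H.Adj v y := he'
    have h2 := h.bd y
    rw [if_neg hy.ne', bdry_apply, Finset.sum_eq_zero_iff_of_nonneg] at h2
    · have := h2 ⟨s(v, y), he'⟩ (Finset.mem_univ _)
      simp at this
      omega
    · intro e _
      split_ifs
      · exact hcon e
      · exact le_rfl
  · exact absurd he (lt_irrefl 0)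

lemma CV.pos {v : V} {S : Set V} {c : H.edgeSet → ℤ} (h : CV H v S c) (g : H.edgeSet) :
    ∃ e, e ≠ g ∧ 0 < c e := by
  by_contra hcon
  push Not at hcon
  have h1 := h.bd v
  rw [if_pos rfl, bdry_apply, ← Finset.add_sum_erase _ _ (Finset.mem_univ g)] at h1
  have h2 : ∑ x ∈ Finset.univ.erase g, (if v ∈ (x : Sym2 V) then c x else 0) ≤ 0 := by
    apply Finset.sum_nonpos
    intro e he
    split_ifs
    · exact hcon e (Finset.ne_of_mem_erase he)
    · exact le_rfl
  have h3 := h.le g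
  split_ifs at h1 <;> omega

lemma exists_CV (hE : HasNoEvenCycle H) {S : Set V} (hS : IsCyc H S) {v : V} (hv : v ∈ S) (b : V)
    (hb : b ∈ S → b ≠ v → H.Adj v b) :
    ∃ c, CV H v S c ∧ ∀ z : H.edgeSet → ℤ,
      (∀ u ∈ S, u ≠ v → u ≠ b → ¬ Big H u ∧ bdry H z u = 0) →
      ∃ n : ℤ, ∀ e : H.edgeSet, (∀ u ∈ (e : Sym2 V), u ∈ S) → (e : Sym2 V) ≠ s(v, b) →
        z e = n * c e := by
  obtain ⟨x1, x2, q, h1, h2, hne, hx1b, hq, hvq, hs, he⟩ := hS.decomp_ne hE hv b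
  set p := q.concat h2.symm with hp
  have hpp : p.IsPath := hq.concat hvq _
  have h1p : s(v, x1) ∉ p.edges := by
    intro h
    rw [hp, SimpleGraph.Walk.edges_concat] at h
    simp at h
    rcases h with h | h
    · exact hvq (q.fst_mem_support_of_mem_edges h)
    · rcases h with h | h
      · exact h2.ne h.1
      · exact hne h
  have htr : (SimpleGraph.Walk.cons h1 p).IsTrail := by
    rw [SimpleGraph.Walk.isTrail_cons]
    exact ⟨hpp.isTrail, h1p⟩
  have hodd := path_odd hE q h1 h2 hne hq hvq
  set c := sgn (SimpleGraph.Walk.cons h1 p) with hc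
  have hbd : ∀ u, bdry H c u = if u = v then 2 else 0 := by
    intro u
    rw [hc, bdry_sgn, SimpleGraph.Walk.length_cons, hp, SimpleGraph.Walk.length_concat,
      Odd.neg_one_pow]
    · split_ifs <;> norm_num
    · rw [Nat.odd_iff] at *
      omega
  have hc1 : c ⟨s(v, x1), h1⟩ = 1 := by
    rw [hc, sgn, Pi.sub_apply, sgn_zero p _ h1p]
    simp [ed]
  refine ⟨c, ⟨?_, hbd, fun e => (sgn_abs _ htr e).1⟩, ?_⟩
  · intro e hee u hu
    have : (e : Sym2 V) ∈ (SimpleGraph.Walk.cons h1 p).edges := by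
      by_contra hcon
      exact hee (sgn_zero _ e hcon)
    rw [hs]
    obtain ⟨e, he'⟩ := e
    obtain ⟨y, rfl⟩ := Sym2.mem_iff_exists.1 hu
    have := SimpleGraph.Walk.fst_mem_support_of_mem_edges _ this
    rw [SimpleGraph.Walk.support_cons, hp, SimpleGraph.Walk.support_concat] at this
    simp at this
    tauto
  · intro z hz
    refine ⟨z ⟨s(v, x1), h1⟩, ?_⟩
    set n := z ⟨s(v, x1), h1⟩ with hn
    have key : ∀ u ∈ S, u ≠ v → u ≠ b → ¬ Big H u ∧ bdry H (z - n • c) u = 0 := by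
      intro u hu huv hub
      obtain ⟨k1, k2⟩ := hz u hu huv hub
      refine ⟨k1, ?_⟩
      rw [map_sub, map_zsmul, Pi.sub_apply, Pi.smul_apply, hbd, k2, if_neg huv]
      simp
    have hz1 : (z - n • c) ⟨s(v, x1), h1⟩ = 0 := by
      simp [hc1, hn]
    suffices hh : ∀ e : H.edgeSet, (∀ u ∈ (e : Sym2 V), u ∈ S) → (e : Sym2 V) ≠ s(v, b) →
        (z - n • c) e = 0 by
      intro e h1 h2
      have := hh e h1 h2
      simp only [Pi.sub_apply, Pi.smul_apply, smul_eq_mul] at this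
      linarith
    rintro ⟨e, hee⟩ heS heb
    induction e using Sym2.ind with
    | _ x y =>
      have hq1 : x2 ≠ b → ∀ t ∈ q.support, t ≠ b := by
        rintro hxb t ht rfl
        have htS : t ∈ S := (hs t).2 (Or.inr ht)
        have htv : t ≠ v := by rintro rfl; exact hvq ht
        have hvt := hb htS htv
        rcases he v t hv htS hvt with h | h | h
        · simp at h
          rcases h with h | h
          · exact hx1b h.symm
          · exact h1.ne h.1
        · simp at h
          rcases h with h | h
          · exact hxb h.symm
          · exact h2.ne h.1
        · exact hvq (q.fst_mem_support_of_mem_edges h)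
      have hqS : ∀ t ∈ q.support, t ∈ S ∧ t ≠ v := fun t ht =>
        ⟨(hs t).2 (Or.inr ht), by rintro rfl; exact hvq ht⟩
      rcases he x y (heS x (by simp)) (heS y (by simp)) hee with h | h | h
      · have : (⟨s(x, y), hee⟩ : H.edgeSet) = ⟨s(v, x1), h1⟩ := Subtype.ext h
        rw [this, hz1]
      · have hxb : x2 ≠ b := by rintro rfl; exact heb h
        obtain ⟨x3, q', h3, rfl⟩ | hnil : (∃ (x3 : V) (q' : H.Walk x1 x3) (h3 : H.Adj x3 x2),
            q = q'.concat h3) ∨ x1 = x2 := by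
          rcases q with _ | ⟨h, q⟩
          · exact Or.inr rfl
          · obtain ⟨x3, q', h3, h4⟩ := SimpleGraph.Walk.exists_cons_eq_concat h q
            exact Or.inl ⟨x3, q', h3, h4⟩
        swap
        · exact absurd hnil hne
        have hx2 := hqS x2 (SimpleGraph.Walk.end_mem_support _)
        obtain ⟨k1, k2⟩ := key x2 hx2.1 hx2.2 hxb
        have hx3v : x3 ≠ v := by
          rintro rfl
          apply hvq
          rw [SimpleGraph.Walk.support_concat]
          simp
        have hlast := prop_zero (z - n • c) (q'.concat h3) hq (fun t ht _ =>
          key t (hqS t ht).1 (hqS t ht).2 (hq1 hxb t ht)) v h1 hvq hz1 ⟨s(x3, x2), h3⟩ (by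
            rw [SimpleGraph.Walk.edges_concat]
            simp)
        have hd := deg_two k1 h3.symm h2.symm hx3v (z - n • c)
        have e1 : (⟨s(x2, x3), h3.symm⟩ : H.edgeSet) = ⟨s(x3, x2), h3⟩ := Subtype.ext Sym2.eq_swap
        have e2 : (⟨s(x2, v), h2.symm⟩ : H.edgeSet) = ⟨s(x, y), hee⟩ :=
          Subtype.ext (Sym2.eq_swap.trans h.symm)
        rw [k2, e1, hlast, zero_add, e2] at hd
        exact hd.symm
      · refine prop_zero (z - n • c) q hq ?_ v h1 hvq hz1 ⟨s(x, y), hee⟩ h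
        intro t ht htx
        refine key t (hqS t ht).1 (hqS t ht).2 ?_
        by_cases hxb : x2 = b
        · rw [← hxb]; exact htx
        · exact hq1 hxb t ht

end GraphThree
end PartG3

section PartG4


section GraphFour
variable {V : Type v} [Fintype V] {H : SimpleGraph V}

/-- Both ends of the edge `e` lie in `S`. -/
def InS (e : H.edgeSet) (S : Set V) : Prop := ∀ u ∈ (e : Sym2 V), u ∈ S

lemma cyc_shared (hE : HasNoEvenCycle H) {S S' : Set V} (hS : IsCyc H S) (hS' : IsCyc H S')
    {e : H.edgeSet} (h : InS e S) (h' : InS e S') : S = S' := by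
  obtain ⟨e, he⟩ := e
  induction e using Sym2.ind with
  | _ x y => exact hS.eq hE hS' he (h x (by simp)) (h y (by simp)) (h' x (by simp)) (h' y (by simp))

lemma stage_gen (K : Type u) [Field K] (hE : HasNoEvenCycle H) (s t : Finset (Set V))
    (hcyc : ∀ i ∈ s ∪ t, IsCyc H i) (hst : Disjoint s t) (hs : s.Nonempty) (P : Set H.edgeSet)
    (c : Set V → H.edgeSet → ℤ) (n0 : ∀ i ∈ s ∪ t, ∃ e, c i e < 0)
    (n1 : ∀ i ∈ s ∪ t, ∀ e, c i e ≠ 0 → InS e i ∨ e ∈ P)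
    (n2 : ∀ i ∈ s ∪ t, ∀ e, c i e < 0 → InS e i ∧ e ∉ P)
    (n3 : ∀ j ∈ t, ∀ e, c j e ≠ 0 → InS e j ∧ e ∉ P)
    (hI : InvL K (Lat s c) (s.card - 1)) : InvL K (Lat (s ∪ t) c) ((s ∪ t).card - 1) := by
  have key : ∀ i ∈ s ∪ t, ∀ k ∈ s ∪ t, k ≠ i → ∀ e, InS e i → e ∉ P → c k e = 0 := by
    intro i hi k hk hki e he heP
    by_contra hcon
    rcases n1 k hk e hcon with h | h
    · exact hki (cyc_shared hE (hcyc k hk) (hcyc i hi) h he)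
    · exact heP h
  refine lat_stage K s t c hst hs n0 ?_ ?_ hI
  · intro i hi e he k hk hki
    exact key i hi k hk hki e (n2 i hi e he).1 (n2 i hi e he).2
  · intro j hj k hk hkj e he
    exact key j (Finset.mem_union_right _ hj) k hk hkj e (n3 j hj e he).1 (n3 j hj e he).2

lemma two_ed_sub_neg {a b : V} (h : H.Adj a b) {v : V} {S : Set V} {c : H.edgeSet → ℤ}
    (hc : CV H v S c) : ∃ e, (2 • ed h - c) e < 0 := by
  obtain ⟨e, he, hpos⟩ := hc.pos ⟨s(a, b), h⟩
  refine ⟨e, ?_⟩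
  simp [ed, Pi.single_eq_of_ne he, hpos]

lemma two_ed_sub_supp {a b : V} (h : H.Adj a b) {v : V} {S : Set V} {c : H.edgeSet → ℤ}
    (hc : CV H v S c) (e : H.edgeSet) (he : (2 • ed h - c) e ≠ 0) :
    InS e S ∨ e = ⟨s(a, b), h⟩ := by
  by_cases hg : e = ⟨s(a, b), h⟩
  · exact Or.inr hg
  · left
    refine hc.supp e ?_
    simpa [ed, Pi.single_eq_of_ne hg] using he

lemma two_ed_sub_lt {a b : V} (h : H.Adj a b) {v : V} {S : Set V} {c : H.edgeSet → ℤ}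
    (hc : CV H v S c) (e : H.edgeSet) (he : (2 • ed h - c) e < 0) :
    InS e S ∧ e ≠ ⟨s(a, b), h⟩ ∧ 0 < c e := by
  by_cases hg : e = ⟨s(a, b), h⟩
  · exfalso
    have := hc.le e
    subst hg
    simp [ed] at he
    omega
  · have : 0 < c e := by simpa [ed, Pi.single_eq_of_ne hg] using he
    exact ⟨hc.supp e this.ne', hg, this⟩

lemma two_stage (K : Type u) [Field K] (hE : HasNoEvenCycle H) (T : Finset (Set V))
    (hT : ∀ i ∈ T, IsCyc H i) {v1 v2 : V} (h12 : H.Adj v1 v2) (i0 : Set V) (hi0 : i0 ∈ T)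
    (hv : v1 ∈ i0) (c0 : Set V → H.edgeSet → ℤ)
    (hc : ∀ i ∈ T, CV H (if v1 ∈ i then v1 else v2) i (c0 i)) :
    InvL K (Lat T (fun i => if v1 ∈ i then 2 • ed h12 - c0 i else c0 i)) (T.card - 1) := by
  set s := T.filter (v1 ∈ ·) with hs
  set t := T.filter (v1 ∉ ·) with ht
  have hU : s ∪ t = T := Finset.filter_union_filter_not_eq _ _
  have hi0s : i0 ∈ s := by simp [hs, hi0, hv]
  have hsT : ∀ i ∈ s, i ∈ T := fun i hi => (Finset.mem_filter.1 hi).1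
  have st1 : InvL K (Lat s c0) (s.card - 1) := by
    have hU' : {i0} ∪ s.erase i0 = s := by
      rw [← Finset.insert_eq, Finset.insert_erase hi0s]
    have := stage_gen K hE {i0} (s.erase i0) (by
        rw [hU']; exact fun i hi => hT i (hsT i hi)) (by simp) (by simp) ∅ c0
        (by rw [hU']; exact fun i hi => (hc i (hsT i hi)).neg)
        (by rw [hU']; exact fun i hi e he => Or.inl ((hc i (hsT i hi)).supp e he))
        (by rw [hU']; exact fun i hi e he => ⟨(hc i (hsT i hi)).supp e he.ne, by simp⟩)
        (fun i hi e he => ⟨(hc i (hsT i (Finset.mem_of_mem_erase hi))).supp e he, by simp⟩)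
        (by simpa using lat_base K c0 i0)
    rwa [hU'] at this
  have hvs : ∀ i ∈ s, v1 ∈ i := fun i hi => (Finset.mem_filter.1 hi).2
  set c : Set V → H.edgeSet → ℤ := fun i => if v1 ∈ i then 2 • ed h12 - c0 i else c0 i with hcd
  have hL : Lat s c0 = Lat s c := by
    refine Lat_congr i0 hi0s fun i hi => Or.inr ?_
    simp only [hcd, if_pos (hvs i hi), if_pos hv]
    abel
  rw [hL] at st1
  have := stage_gen K hE s t (by rw [hU]; exact hT) (Finset.disjoint_filter_filter_not _ _ _)
    ⟨i0, hi0s⟩ {⟨s(v1, v2), h12⟩} c ?_ ?_ ?_ ?_ st1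
  · rwa [hU] at this
  · rw [hU]
    intro i hi
    by_cases h : v1 ∈ i
    · simp only [hcd, if_pos h]
      exact two_ed_sub_neg h12 (hc i hi)
    · simp only [hcd, if_neg h]
      exact (hc i hi).neg
  · rw [hU]
    intro i hi e
    by_cases h : v1 ∈ i
    · simp only [hcd, if_pos h]
      exact two_ed_sub_supp h12 (hc i hi) e
    · simp only [hcd, if_neg h]
      exact fun he => Or.inl ((hc i hi).supp e he)
  · rw [hU]
    intro i hi e
    by_cases h : v1 ∈ i
    · simp only [hcd, if_pos h]
      exact fun he => ⟨(two_ed_sub_lt h12 (hc i hi) e he).1, (two_ed_sub_lt h12 (hc i hi) e he).2.1⟩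
    · simp only [hcd, if_neg h]
      refine fun he => ⟨(hc i hi).supp e he.ne, ?_⟩
      rintro rfl
      exact h ((hc i hi).supp _ he.ne v1 (by simp))
  · intro i hi e
    have h : v1 ∉ i := (Finset.mem_filter.1 hi).2
    have hi := (Finset.mem_filter.1 hi).1
    simp only [hcd, if_neg h]
    refine fun he => ⟨(hc i hi).supp e he, ?_⟩
    rintro rfl
    exact h ((hc i hi).supp _ he v1 (by simp))

lemma decomp_sum (hE : HasNoEvenCycle H) (T : Finset (Set V)) (hT : ∀ i ∈ T, IsCyc H i)
    (P : Set H.edgeSet) (c0 : Set V → H.edgeSet → ℤ)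
    (hsupp : ∀ i ∈ T, ∀ e, c0 i e ≠ 0 → InS e i)
    (hcov : ∀ e, e ∉ P → ∃ i ∈ T, InS e i) (z : H.edgeSet → ℤ) (n : Set V → ℤ)
    (hn : ∀ i ∈ T, ∀ e, InS e i → e ∉ P → z e = n i * c0 i e) (e : H.edgeSet) (he : e ∉ P) :
    (z - ∑ i ∈ T, n i • c0 i) e = 0 := by
  obtain ⟨i, hi, hei⟩ := hcov e he
  rw [Pi.sub_apply, Finset.sum_apply, Finset.sum_eq_single i]
  · rw [hn i hi e hei he]
    simp
  · intro j hj hji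
    have : c0 j e = 0 := by
      by_contra hcon
      exact hji (cyc_shared hE (hT j hj) (hT i hi) (hsupp j hj e hcon) hei)
    simp [this]
  · exact fun h => absurd hi h

lemma bdry_comb (T : Finset (Set V)) (c0 : Set V → H.edgeSet → ℤ) (r : Set V → V)
    (hc : ∀ i ∈ T, CV H (r i) i (c0 i)) (n : Set V → ℤ) (u : V) :
    bdry H (∑ i ∈ T, n i • c0 i) u = 2 * ∑ i ∈ T, if u = r i then n i else 0 := by
  rw [map_sum, Finset.sum_apply, Finset.mul_sum]
  refine Finset.sum_congr rfl fun i hi => ?_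
  rw [map_zsmul, Pi.smul_apply, (hc i hi).bd]
  split_ifs <;> simp [mul_comm]

lemma lat_le_ker (T : Finset (Set V)) (c : Set V → H.edgeSet → ℤ) (v : V)
    (hc : ∀ i ∈ T, ∀ u, bdry H (c i) u = if u = v then 2 else 0) : Lat T c ≤ (bdry H).ker := by
  rintro _ ⟨n, hn, rfl⟩
  rw [AddMonoidHom.mem_ker]
  ext u
  rw [map_sum, Finset.sum_apply]
  have : ∀ i ∈ T, (bdry H (n i • c i)) u = n i * if u = v then 2 else 0 := by
    intro i hi
    rw [map_zsmul, Pi.smul_apply, hc i hi, smul_eq_mul]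
  rw [Finset.sum_congr rfl this, ← Finset.sum_mul, hn]
  simp

lemma bdry_two_sub {a b : V} (h : H.Adj a b) {S : Set V} {c : H.edgeSet → ℤ}
    (hc : CV H a S c) (u : V) : bdry H (2 • ed h - c) u = if u = b then 2 else 0 := by
  rw [map_sub, map_nsmul, Pi.sub_apply, Pi.smul_apply, bdry_ed, hc.bd]
  split_ifs <;> simp

lemma ker_two (hE : HasNoEvenCycle H) (T : Finset (Set V))
    (hT : ∀ i ∈ T, IsCyc H i) {v1 v2 : V} (h12 : H.Adj v1 v2)
    (hcov : ∀ e : H.edgeSet, (e : Sym2 V) ≠ s(v1, v2) → ∃ i ∈ T, InS e i)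
    (c0 : Set V → H.edgeSet → ℤ)
    (hc : ∀ i ∈ T, CV H (if v1 ∈ i then v1 else v2) i (c0 i))
    (hz : ∀ i ∈ T, ∀ z ∈ (bdry H).ker, ∃ n : ℤ, ∀ e : H.edgeSet, InS e i →
      (e : Sym2 V) ≠ s(v1, v2) → z e = n * c0 i e) :
    (bdry H).ker = Lat T (fun i => if v1 ∈ i then 2 • ed h12 - c0 i else c0 i) := by
  apply le_antisymm
  · intro z hzk
    have hz' : ∀ i : Set V, ∃ n : ℤ, i ∈ T → ∀ e : H.edgeSet, InS e i →
        (e : Sym2 V) ≠ s(v1, v2) → z e = n * c0 i e := by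
      intro i
      by_cases hi : i ∈ T
      · obtain ⟨n, hn⟩ := hz i hi z hzk
        exact ⟨n, fun _ => hn⟩
      · exact ⟨0, fun h => absurd h hi⟩
    choose n hn using hz'
    set g : H.edgeSet := ⟨s(v1, v2), h12⟩ with hg
    have hP : ∀ e : H.edgeSet, e ∉ ({g} : Set H.edgeSet) → (e : Sym2 V) ≠ s(v1, v2) := by
      intro e he h
      exact he (Subtype.ext h)
    set z' := z - ∑ i ∈ T, n i • c0 i with hz'
    have hd : ∀ e, e ∉ ({g} : Set H.edgeSet) → z' e = 0 :=
      decomp_sum hE T hT {g} c0 (fun i hi e he => (hc i hi).supp e he)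
        (fun e he => hcov e (hP e he)) z n (fun i hi e h1 h2 => hn i hi e h1 (hP e h2))
    obtain ⟨y, hy⟩ : ∃ y : ℤ, z' = y • ed h12 := by
      refine ⟨z' g, ?_⟩
      ext e
      by_cases he : e = g
      · subst he
        simp [ed, hg]
      · have h0 : ed h12 e = 0 := Pi.single_eq_of_ne he _
        rw [hd e he]
        simp [h0]
    have hb : ∀ u, bdry H z' u = - (2 * ∑ i ∈ T, if u = (if v1 ∈ i then v1 else v2) then n i else 0) := by
      intro u
      rw [hz', map_sub, Pi.sub_apply, AddMonoidHom.mem_ker.1 hzk, bdry_comb T c0 _ hc]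
      simp
    have hb' : ∀ u, bdry H z' u = y * ((if u = v1 then 1 else 0) + (if u = v2 then 1 else 0)) := by
      intro u
      rw [hy, map_zsmul, Pi.smul_apply, bdry_ed, smul_eq_mul]
    have e1 := (hb' v1).symm.trans (hb v1)
    have e2 := (hb' v2).symm.trans (hb v2)
    have f1 : (∑ i ∈ T, if v1 = (if v1 ∈ i then v1 else v2) then n i else 0) =
        ∑ i ∈ T, if v1 ∈ i then n i else 0 := by
      refine Finset.sum_congr rfl fun i _ => ?_
      by_cases h : v1 ∈ i <;> simp [h, h12.ne]
    have f2 : (∑ i ∈ T, if v2 = (if v1 ∈ i then v1 else v2) then n i else 0) =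
        ∑ i ∈ T, if v1 ∈ i then 0 else n i := by
      refine Finset.sum_congr rfl fun i _ => ?_
      by_cases h : v1 ∈ i <;> simp [h, h12.ne']
    rw [f1] at e1
    rw [f2] at e2
    simp [h12.ne, h12.ne'] at e1 e2
    refine ⟨fun i => if v1 ∈ i then - n i else n i, ?_, ?_⟩
    · have : ∀ i ∈ T, (if v1 ∈ i then - n i else n i) =
          (if v1 ∈ i then 0 else n i) - (if v1 ∈ i then n i else 0) := by
        intro i _
        split_ifs <;> simp
      rw [Finset.sum_congr rfl this, Finset.sum_sub_distrib]
      linarith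
    · have : ∀ i ∈ T, ((if v1 ∈ i then - n i else n i) • (if v1 ∈ i then 2 • ed h12 - c0 i else c0 i)) =
          n i • c0 i - (if v1 ∈ i then n i else 0) • ((2 : ℤ) • ed h12) := by
        intro i _
        split_ifs
        · ext e
          simp
          ring
        · simp
      rw [Finset.sum_congr rfl this, Finset.sum_sub_distrib, ← Finset.sum_smul]
      have h3 : z = ∑ i ∈ T, n i • c0 i + y • ed h12 := by
        rw [← hy, hz']; abel
      rw [h3, sub_eq_add_neg, smul_smul, ← neg_smul]
      congr 2
      linarith
  · refine lat_le_ker T _ v2 fun i hi u => ?_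
    have := hc i hi
    by_cases h : v1 ∈ i
    · rw [if_pos h] at this ⊢
      exact bdry_two_sub h12 this u
    · rw [if_neg h] at this ⊢
      exact this.bd u

end GraphFour
end PartG4

section PartG5


section GraphFive
variable {V : Type v} [Fintype V] {H : SimpleGraph V}

lemma three_stage (K : Type u) [Field K] (hE : HasNoEvenCycle H) (T : Finset (Set V))
    (hT : ∀ i ∈ T, IsCyc H i) {v1 v2 v3 : V} (h12 : H.Adj v1 v2) (h13 : H.Adj v1 v3)
    (h23 : H.Adj v2 v3) (hDT : ({v1, v2, v3} : Set V) ∈ T) (c0 : Set V → H.edgeSet → ℤ)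
    (hc : ∀ i ∈ T, CV H (if v1 ∈ i then v1 else if v2 ∈ i then v2 else v3) i (c0 i))
    (hD : c0 {v1, v2, v3} = ed h12 + ed h13 - ed h23)
    (h1 : ∀ i ∈ T, i ≠ {v1, v2, v3} → v1 ∈ i → v2 ∉ i) :
    InvL K (Lat T (fun i => if v1 ∈ i then 2 • ed h13 - c0 i else
      if v2 ∈ i then 2 • ed h23 - c0 i else c0 i)) (T.card - 1) := by
  set D : Set V := {v1, v2, v3} with hDdef
  have hv1D : v1 ∈ D := by simp [hDdef]
  set s := T.filter (fun i => v1 ∈ i ∨ v2 ∈ i) with hs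
  set t := T.filter (fun i => ¬ (v1 ∈ i ∨ v2 ∈ i)) with ht
  have hU : s ∪ t = T := Finset.filter_union_filter_not_eq _ _
  have hDs : D ∈ s := by simp [hs, hDT, hv1D]
  have hsT : ∀ i ∈ s, i ∈ T := fun i hi => (Finset.mem_filter.1 hi).1
  have hs2 : ∀ i ∈ s, v1 ∈ i ∨ v2 ∈ i := fun i hi => (Finset.mem_filter.1 hi).2
  have st := two_stage K hE s (fun i hi => hT i (hsT i hi)) h12 D hDs hv1D c0 (by
    intro i hi
    have := hc i (hsT i hi)
    by_cases h : v1 ∈ i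
    · simpa [h] using this
    · have h' := (hs2 i hi).resolve_left h
      simpa [h, h'] using this)
  set c : Set V → H.edgeSet → ℤ := fun i => if v1 ∈ i then 2 • ed h13 - c0 i else
      if v2 ∈ i then 2 • ed h23 - c0 i else c0 i with hcd
  have hL : Lat s (fun i => if v1 ∈ i then 2 • ed h12 - c0 i else c0 i) = Lat s c := by
    refine Lat_congr D hDs fun i hi => ?_
    by_cases h : v1 ∈ i
    · left
      simp only [hcd, if_pos h, if_pos hv1D]
      abel
    · have h' := (hs2 i hi).resolve_left h
      right
      simp only [hcd, if_neg h, if_pos h', if_pos hv1D, hD]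
      abel
  rw [hL] at st
  have n12 := h12.ne
  have n13 := h13.ne
  have n23 := h23.ne
  set g13 : H.edgeSet := ⟨s(v1, v3), h13⟩ with hg13
  set g23 : H.edgeSet := ⟨s(v2, v3), h23⟩ with hg23
  have hcg : ∀ i ∈ T, v1 ∈ i → ¬ 0 < c0 i g23 := by
    intro i hi hv1 hpos
    by_cases hiD : i = D
    · rw [hiD, hD] at hpos
      have a1 : ed h12 g23 = 0 := Pi.single_eq_of_ne (by
        intro h
        have := congrArg Subtype.val h
        simp [hg23] at this
        grind) _
      have a2 : ed h13 g23 = 0 := Pi.single_eq_of_ne (by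
        intro h
        have := congrArg Subtype.val h
        simp [hg23] at this
        grind) _
      have a3 : ed h23 g23 = 1 := Pi.single_eq_same _ _
      simp [a1, a2, a3] at hpos
    · exact h1 i hi hiD hv1 ((hc i hi).supp g23 hpos.ne' v2 (by simp [hg23]))
  have := stage_gen K hE s t (by rw [hU]; exact hT) (Finset.disjoint_filter_filter_not _ _ _)
    ⟨D, hDs⟩ {g13, g23} c ?_ ?_ ?_ ?_ st
  · rwa [hU] at this
  · rw [hU]
    intro i hi
    have hci := hc i hi
    simp only [hcd]
    split_ifs with h h'
    · exact two_ed_sub_neg h13 hci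
    · exact two_ed_sub_neg h23 hci
    · exact hci.neg
  · rw [hU]
    intro i hi e
    have hci := hc i hi
    simp only [hcd]
    split_ifs with h h'
    · intro he
      rcases two_ed_sub_supp h13 hci e he with h | h
      · exact Or.inl h
      · exact Or.inr (by simp [h, hg13])
    · intro he
      rcases two_ed_sub_supp h23 hci e he with h | h
      · exact Or.inl h
      · exact Or.inr (by simp [h, hg23])
    · exact fun he => Or.inl (hci.supp e he)
  · rw [hU]
    intro i hi e
    have hci := hc i hi
    simp only [hcd]
    split_ifs with h h'
    · intro he
      obtain ⟨k1, k2, k3⟩ := two_ed_sub_lt h13 hci e he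
      refine ⟨k1, ?_⟩
      rintro (h' | h')
      · exact k2 h'
      · rw [h'] at k3
        exact hcg i hi h k3
    · intro he
      obtain ⟨k1, k2, k3⟩ := two_ed_sub_lt h23 hci e he
      refine ⟨k1, ?_⟩
      rintro (h'' | h'')
      · exact h (k1 v1 (by simp [h'', hg13]))
      · exact k2 h''
    · intro he
      have k1 : InS e i := hci.supp e he.ne
      refine ⟨k1, ?_⟩
      rintro (h'' | h'')
      · exact h (k1 v1 (by simp [h'', hg13]))
      · exact h' (k1 v2 (by
          rw [Set.mem_singleton_iff] at h''
          simp [h'', hg23]))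
  · intro i hi e
    have h := (Finset.mem_filter.1 hi).2
    have hi := (Finset.mem_filter.1 hi).1
    have hci := hc i hi
    push Not at h
    simp only [hcd, if_neg h.1, if_neg h.2]
    intro he
    have k1 : InS e i := hci.supp e he
    refine ⟨k1, ?_⟩
    rintro (h'' | h'')
    · exact h.1 (k1 v1 (by simp [h'', hg13]))
    · exact h.2 (k1 v2 (by
          rw [Set.mem_singleton_iff] at h''
          simp [h'', hg23]))

lemma ker_three (hE : HasNoEvenCycle H) (T : Finset (Set V))
    (hT : ∀ i ∈ T, IsCyc H i) {v1 v2 v3 : V} (h12 : H.Adj v1 v2) (h13 : H.Adj v1 v3)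
    (h23 : H.Adj v2 v3) (hDT : ({v1, v2, v3} : Set V) ∈ T) (c0 : Set V → H.edgeSet → ℤ)
    (hc : ∀ i ∈ T, CV H (if v1 ∈ i then v1 else if v2 ∈ i then v2 else v3) i (c0 i))
    (hD : c0 {v1, v2, v3} = ed h12 + ed h13 - ed h23)
    (hcov : ∀ e : H.edgeSet, ∃ i ∈ T, InS e i)
    (hz : ∀ i ∈ T, i ≠ {v1, v2, v3} → ∀ z ∈ (bdry H).ker, ∃ n : ℤ, ∀ e : H.edgeSet, InS e i →
      z e = n * c0 i e) :
    (bdry H).ker = Lat T (fun i => if v1 ∈ i then 2 • ed h13 - c0 i else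
      if v2 ∈ i then 2 • ed h23 - c0 i else c0 i) := by
  set D : Set V := {v1, v2, v3} with hDdef
  have hv1D : v1 ∈ D := by simp [hDdef]
  have n12 := h12.ne
  have n13 := h13.ne
  have n23 := h23.ne
  apply le_antisymm
  · intro z hzk
    have hz' : ∀ i : Set V, ∃ n : ℤ, i ∈ T.erase D → ∀ e : H.edgeSet, InS e i →
        z e = n * c0 i e := by
      intro i
      by_cases hi : i ∈ T.erase D
      · obtain ⟨n, hn⟩ := hz i (Finset.mem_of_mem_erase hi) (Finset.ne_of_mem_erase hi) z hzk
        exact ⟨n, fun _ => hn⟩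
      · exact ⟨0, fun h => absurd h hi⟩
    choose n hn using hz'
    set g12 : H.edgeSet := ⟨s(v1, v2), h12⟩ with hg12
    set g13 : H.edgeSet := ⟨s(v1, v3), h13⟩ with hg13
    set g23 : H.edgeSet := ⟨s(v2, v3), h23⟩ with hg23
    have d1 : g12 ≠ g13 := by
      intro h
      have := congrArg Subtype.val h
      simp [hg12, hg13] at this
      grind
    have d2 : g12 ≠ g23 := by
      intro h
      have := congrArg Subtype.val h
      simp [hg12, hg23] at this
      grind
    have d3 : g13 ≠ g23 := by
      intro h
      have := congrArg Subtype.val h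
      simp [hg13, hg23] at this
      grind
    have hTe : ∀ i ∈ T.erase D, i ∈ T := fun i hi => Finset.mem_of_mem_erase hi
    set z' := z - ∑ i ∈ T.erase D, n i • c0 i with hz'
    have hd : ∀ e, e ∉ ({g12, g13, g23} : Set H.edgeSet) → z' e = 0 := by
      refine decomp_sum hE (T.erase D) (fun i hi => hT i (hTe i hi)) _ c0
        (fun i hi e he => (hc i (hTe i hi)).supp e he) ?_ z n (fun i hi e h1 _ => hn i hi e h1)
      intro e he
      obtain ⟨i, hi, hei⟩ := hcov e
      refine ⟨i, ?_, hei⟩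
      rw [Finset.mem_erase]
      refine ⟨?_, hi⟩
      rintro rfl
      apply he
      obtain ⟨e, hee⟩ := e
      induction e using Sym2.ind with
      | _ x y =>
        have hx := hei x (by simp)
        have hy := hei y (by simp)
        have hxy : x ≠ y := H.ne_of_adj hee
        simp only [hDdef, Set.mem_insert_iff, Set.mem_singleton_iff] at hx hy
        simp only [hg12, hg13, hg23, Set.mem_insert_iff, Set.mem_singleton_iff, Subtype.mk.injEq,
          Sym2.eq_iff]
        grind
    obtain ⟨y1, y2, y3, hy⟩ : ∃ y1 y2 y3 : ℤ, z' = y1 • ed h12 + y2 • ed h13 + y3 • ed h23 := by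
      refine ⟨z' g12, z' g13, z' g23, ?_⟩
      ext e
      have f1 : ed h12 e = if e = g12 then 1 else 0 := by rw [ed, Pi.single_apply]
      have f2 : ed h13 e = if e = g13 then 1 else 0 := by rw [ed, Pi.single_apply]
      have f3 : ed h23 e = if e = g23 then 1 else 0 := by rw [ed, Pi.single_apply]
      simp only [Pi.add_apply, Pi.smul_apply, smul_eq_mul, f1, f2, f3]
      by_cases e1 : e = g12
      · subst e1; simp [d1, d2]
      by_cases e2 : e = g13
      · subst e2; simp [d1.symm, d3]
      by_cases e3 : e = g23
      · subst e3; simp [d2.symm, d3.symm]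
      rw [hd e (by simp [e1, e2, e3])]
      simp [e1, e2, e3]
    have hb : ∀ u, bdry H z' u = - (2 * ∑ i ∈ T.erase D,
        if u = (if v1 ∈ i then v1 else if v2 ∈ i then v2 else v3) then n i else 0) := by
      intro u
      rw [hz', map_sub, Pi.sub_apply, AddMonoidHom.mem_ker.1 hzk,
        bdry_comb (T.erase D) c0 _ (fun i hi => hc i (hTe i hi))]
      simp
    have hb' : ∀ u, bdry H z' u = y1 * ((if u = v1 then 1 else 0) + (if u = v2 then 1 else 0)) +
        y2 * ((if u = v1 then 1 else 0) + (if u = v3 then 1 else 0)) +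
        y3 * ((if u = v2 then 1 else 0) + (if u = v3 then 1 else 0)) := by
      intro u
      rw [hy]
      simp only [map_add, map_zsmul, Pi.add_apply, Pi.smul_apply, bdry_ed, smul_eq_mul]
    have e1 := (hb' v1).symm.trans (hb v1)
    have e2 := (hb' v2).symm.trans (hb v2)
    have e3 := (hb' v3).symm.trans (hb v3)
    have f1 : (∑ i ∈ T.erase D,
        if v1 = (if v1 ∈ i then v1 else if v2 ∈ i then v2 else v3) then n i else 0) =
        ∑ i ∈ T.erase D, if v1 ∈ i then n i else 0 := by
      refine Finset.sum_congr rfl fun i _ => ?_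
      by_cases h : v1 ∈ i <;> by_cases h' : v2 ∈ i <;> simp [h, h', n12, n13]
    have f2 : (∑ i ∈ T.erase D,
        if v2 = (if v1 ∈ i then v1 else if v2 ∈ i then v2 else v3) then n i else 0) =
        ∑ i ∈ T.erase D, if v1 ∈ i then 0 else if v2 ∈ i then n i else 0 := by
      refine Finset.sum_congr rfl fun i _ => ?_
      by_cases h : v1 ∈ i <;> by_cases h' : v2 ∈ i <;> simp [h, h', n12.symm, n23]
    have f3 : (∑ i ∈ T.erase D,
        if v3 = (if v1 ∈ i then v1 else if v2 ∈ i then v2 else v3) then n i else 0) =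
        ∑ i ∈ T.erase D, if v1 ∈ i then 0 else if v2 ∈ i then 0 else n i := by
      refine Finset.sum_congr rfl fun i _ => ?_
      by_cases h : v1 ∈ i <;> by_cases h' : v2 ∈ i <;> simp [h, h', n13.symm, n23.symm]
    rw [f1] at e1
    rw [f2] at e2
    rw [f3] at e3
    simp only [if_true, n12, n13, n23, n12.symm, n13.symm, n23.symm, if_false] at e1 e2 e3
    refine ⟨fun i => if i = D then - y1 else if v1 ∈ i then - n i else
      if v2 ∈ i then - n i else n i, ?_, ?_⟩
    · rw [← Finset.add_sum_erase _ _ hDT]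
      have : ∀ i ∈ T.erase D, (if i = D then - y1 else if v1 ∈ i then - n i else
          if v2 ∈ i then - n i else n i) =
          (if v1 ∈ i then 0 else if v2 ∈ i then 0 else n i) - (if v1 ∈ i then n i else 0) -
          (if v1 ∈ i then 0 else if v2 ∈ i then n i else 0) := by
        intro i hi
        rw [if_neg (Finset.ne_of_mem_erase hi)]
        split_ifs <;> simp
      rw [Finset.sum_congr rfl this, Finset.sum_sub_distrib, Finset.sum_sub_distrib, if_pos rfl]
      linarith
    · rw [← Finset.add_sum_erase _ _ hDT]
      have : ∀ i ∈ T.erase D, ((if i = D then - y1 else if v1 ∈ i then - n i else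
          if v2 ∈ i then - n i else n i) • (if v1 ∈ i then 2 • ed h13 - c0 i else
            if v2 ∈ i then 2 • ed h23 - c0 i else c0 i)) =
          n i • c0 i - (if v1 ∈ i then n i else 0) • ((2 : ℤ) • ed h13) -
            (if v1 ∈ i then 0 else if v2 ∈ i then n i else 0) • ((2 : ℤ) • ed h23) := by
        intro i hi
        rw [if_neg (Finset.ne_of_mem_erase hi)]
        split_ifs
        · ext e
          simp
          ring
        · ext e
          simp
          ring
        · simp
      rw [Finset.sum_congr rfl this, Finset.sum_sub_distrib, Finset.sum_sub_distrib,
        ← Finset.sum_smul, ← Finset.sum_smul]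
      simp only [if_true, if_pos hv1D, hD]
      have h3 : z = ∑ i ∈ T.erase D, n i • c0 i + (y1 • ed h12 + y2 • ed h13 + y3 • ed h23) := by
        rw [← hy, hz']; abel
      rw [h3]
      ext e
      simp only [Pi.add_apply, Pi.sub_apply, Pi.smul_apply, smul_eq_mul, two_nsmul]
      generalize (∑ i ∈ T.erase D, n i • c0 i) e = X
      generalize (∑ i ∈ T.erase D, if v1 ∈ i then n i else 0) = A at *
      generalize (∑ i ∈ T.erase D, if v1 ∈ i then 0 else if v2 ∈ i then n i else 0) = B at *
      have hA : y2 = -(2 * A) - y1 := by linarith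
      have hB : y3 = -(2 * B) - y1 := by linarith
      rw [hA, hB]
      ring
  · refine lat_le_ker T _ v3 fun i hi u => ?_
    have := hc i hi
    by_cases h : v1 ∈ i
    · simp only [if_pos h] at this ⊢
      exact bdry_two_sub h13 this u
    · by_cases h' : v2 ∈ i
      · simp only [if_neg h, if_pos h'] at this ⊢
        exact bdry_two_sub h23 this u
      · simp only [if_neg h, if_neg h'] at this ⊢
        exact this.bd u

lemma cyc_cover (hdeg : ∀ v u : V, ∃ y, H.Adj v y ∧ y ≠ u) (hE : HasNoEvenCycle H)
    (hO : OddCycleCondition H) (e : H.edgeSet) :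
    (∃ i, IsCyc H i ∧ InS e i) ∨ ∀ u ∈ (e : Sym2 V), Big H u := by
  obtain ⟨e, he⟩ := e
  induction e using Sym2.ind with
  | _ a b =>
    by_cases hn : ∀ S, IsCyc H S → a ∈ S → b ∉ S
    · right
      obtain ⟨h1, h2⟩ := bridge_big hdeg hE hO he hn
      intro u hu
      simp only [Sym2.mem_iff] at hu
      rcases hu with rfl | rfl
      · exact h1
      · exact h2
    · push Not at hn
      obtain ⟨S, hS, ha, hb⟩ := hn
      left
      refine ⟨S, hS, ?_⟩
      intro u hu
      simp only [Sym2.mem_iff] at hu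
      rcases hu with rfl | rfl
      · exact ha
      · exact hb

lemma case_two (K : Type u) [Field K] (hC : H.Connected)
    (hdeg : ∀ v u : V, ∃ y, H.Adj v y ∧ y ≠ u) (hE : HasNoEvenCycle H)
    (hO : OddCycleCondition H) {v1 v2 : V} (h12 : H.Adj v1 v2)
    (hB : ∀ v, Big H v → v = v1 ∨ v = v2) (T : Finset (Set V)) (hT : ∀ i, i ∈ T ↔ IsCyc H i) :
    InvL K (bdry H).ker (T.card - 1) := by
  have hcov : ∀ e : H.edgeSet, (e : Sym2 V) ≠ s(v1, v2) → ∃ i ∈ T, InS e i := by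
    intro e he
    rcases cyc_cover hdeg hE hO e with ⟨i, hi, h⟩ | h
    · exact ⟨i, (hT i).2 hi, h⟩
    · exfalso
      obtain ⟨e, hee⟩ := e
      induction e using Sym2.ind with
      | _ a b =>
        have hab : a ≠ b := H.ne_of_adj hee
        have h1 := hB a (h a (by simp))
        have h2 := hB b (h b (by simp))
        apply he
        rw [Sym2.eq_iff]
        grind
  obtain ⟨y, hy, hy2⟩ := hdeg v1 v2
  obtain ⟨i0, hi0, hin⟩ := hcov ⟨s(v1, y), hy⟩ (by
    intro h
    simp at h
    rcases h with h | h
    · exact hy2 h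
    · exact h12.ne h.1)
  have hv1 : v1 ∈ i0 := hin v1 (by simp)
  have hch : ∀ i : Set V, ∃ c : H.edgeSet → ℤ, i ∈ T → CV H (if v1 ∈ i then v1 else v2) i c ∧
      ∀ z ∈ (bdry H).ker, ∃ n : ℤ, ∀ e : H.edgeSet, InS e i →
      (e : Sym2 V) ≠ s(v1, v2) → z e = n * c e := by
    intro i
    by_cases hi : i ∈ T
    swap
    · exact ⟨0, fun h => absurd h hi⟩
    have hic := (hT i).1 hi
    by_cases h : v1 ∈ i
    · obtain ⟨c, hc1, hc2⟩ := exists_CV hE hic h v2 (fun _ _ => h12)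
      refine ⟨c, fun _ => ⟨by rwa [if_pos h], fun z hz => hc2 z ?_⟩⟩
      intro u _ hu1 hu2
      refine ⟨fun hbig => ?_, by rw [AddMonoidHom.mem_ker.1 hz]; rfl⟩
      exact (hB u hbig).elim hu1 hu2
    · have h2 : v2 ∈ i := by
        by_contra h2
        refine h (cyc_univ hE hC hic (fun u hu hbig => ?_) v1)
        rcases hB u hbig with rfl | rfl
        · exact h hu
        · exact h2 hu
      obtain ⟨c, hc1, hc2⟩ := exists_CV hE hic h2 v1 (fun hh => absurd hh h)
      refine ⟨c, fun _ => ⟨by rwa [if_neg h], fun z hz => ?_⟩⟩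
      rw [Sym2.eq_swap]
      refine hc2 z ?_
      intro u _ hu1 hu2
      refine ⟨fun hbig => ?_, by rw [AddMonoidHom.mem_ker.1 hz]; rfl⟩
      exact (hB u hbig).elim hu2 hu1
  choose c0 hc0 using hch
  rw [ker_two hE T (fun i hi => (hT i).1 hi) h12 hcov c0 (fun i hi => (hc0 i hi).1)
    (fun i hi => (hc0 i hi).2)]
  exact two_stage K hE T (fun i hi => (hT i).1 hi) h12 i0 hi0 hv1 c0 (fun i hi => (hc0 i hi).1)

lemma tri_CV {v1 v2 v3 : V} (h12 : H.Adj v1 v2) (h13 : H.Adj v1 v3)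
    (h23 : H.Adj v2 v3) : CV H v1 {v1, v2, v3} (ed h12 + ed h13 - ed h23) := by
  have n12 := h12.ne
  have n13 := h13.ne
  have n23 := h23.ne
  have d1 : (⟨s(v1, v2), h12⟩ : H.edgeSet) ≠ ⟨s(v1, v3), h13⟩ := by
    intro h
    have := congrArg Subtype.val h
    simp at this
    grind
  refine ⟨?_, ?_, ?_⟩
  · intro e he u hu
    have f1 : ed h12 e = if e = ⟨s(v1, v2), h12⟩ then 1 else 0 := by rw [ed, Pi.single_apply]
    have f2 : ed h13 e = if e = ⟨s(v1, v3), h13⟩ then 1 else 0 := by rw [ed, Pi.single_apply]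
    have f3 : ed h23 e = if e = ⟨s(v2, v3), h23⟩ then 1 else 0 := by rw [ed, Pi.single_apply]
    simp only [Pi.sub_apply, Pi.add_apply, f1, f2, f3] at he
    simp only [Set.mem_insert_iff, Set.mem_singleton_iff]
    by_cases e1 : e = ⟨s(v1, v2), h12⟩
    · rw [e1] at hu
      simp only [Sym2.mem_iff] at hu
      tauto
    by_cases e2 : e = ⟨s(v1, v3), h13⟩
    · rw [e2] at hu
      simp only [Sym2.mem_iff] at hu
      tauto
    by_cases e3 : e = ⟨s(v2, v3), h23⟩
    · rw [e3] at hu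
      simp only [Sym2.mem_iff] at hu
      tauto
    simp [e1, e2, e3] at he
  · intro u
    simp only [map_sub, map_add, Pi.sub_apply, Pi.add_apply, bdry_ed]
    by_cases a : u = v1 <;> by_cases b : u = v2 <;> by_cases c : u = v3 <;> simp [a, b, c] <;> grind
  · intro e
    have f1 : ed h12 e = if e = ⟨s(v1, v2), h12⟩ then 1 else 0 := by rw [ed, Pi.single_apply]
    have f2 : ed h13 e = if e = ⟨s(v1, v3), h13⟩ then 1 else 0 := by rw [ed, Pi.single_apply]
    have f3 : ed h23 e = if e = ⟨s(v2, v3), h23⟩ then 1 else 0 := by rw [ed, Pi.single_apply]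
    simp only [Pi.sub_apply, Pi.add_apply, f1, f2, f3]
    by_cases e1 : e = ⟨s(v1, v2), h12⟩
    · have e2 : e ≠ ⟨s(v1, v3), h13⟩ := fun h => d1 (e1.symm.trans h)
      rw [if_pos e1, if_neg e2]
      split_ifs <;> norm_num
    · rw [if_neg e1]
      split_ifs <;> norm_num

lemma case_three (K : Type u) [Field K] (hC : H.Connected)
    (hdeg : ∀ v u : V, ∃ y, H.Adj v y ∧ y ≠ u) (hE : HasNoEvenCycle H)
    (hO : OddCycleCondition H) {v1 v2 v3 : V} (h12 : H.Adj v1 v2) (h13 : H.Adj v1 v3)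
    (h23 : H.Adj v2 v3)
    (hB : ∀ v, Big H v → v = v1 ∨ v = v2 ∨ v = v3) (T : Finset (Set V))
    (hT : ∀ i, i ∈ T ↔ IsCyc H i) :
    InvL K (bdry H).ker (T.card - 1) := by
  have hDc := tri_cyc h12 h13 h23
  have hDT : ({v1, v2, v3} : Set V) ∈ T := (hT _).2 hDc
  set D : Set V := {v1, v2, v3} with hDdef
  have m1 : v1 ∈ D := by simp [hDdef]
  have m2 : v2 ∈ D := by simp [hDdef]
  have m3 : v3 ∈ D := by simp [hDdef]
  have hcov : ∀ e : H.edgeSet, ∃ i ∈ T, InS e i := by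
    intro e
    rcases cyc_cover hdeg hE hO e with ⟨i, hi, h⟩ | h
    · exact ⟨i, (hT i).2 hi, h⟩
    · refine ⟨D, hDT, fun u hu => ?_⟩
      rcases hB u (h u hu) with rfl | rfl | rfl
      · exact m1
      · exact m2
      · exact m3
  have hDadj : ∀ a ∈ D, ∀ b ∈ D, a ≠ b → H.Adj a b := by
    intro a ha b hb hab
    simp only [hDdef, Set.mem_insert_iff, Set.mem_singleton_iff] at ha hb
    rcases ha with rfl | rfl | rfl <;> rcases hb with rfl | rfl | rfl <;>
      first | exact absurd rfl hab | assumption | (apply SimpleGraph.Adj.symm; assumption)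
  have huniq : ∀ i ∈ T, i ≠ D → ∀ a ∈ D, ∀ b ∈ D, a ∈ i → b ∈ i → a = b := by
    intro i hi hiD a ha b hb hai hbi
    by_contra hab
    exact hiD (((hT i).1 hi).eq hE hDc (hDadj a ha b hb hab) hai hbi ha hb)
  have hch : ∀ i : Set V, ∃ c : H.edgeSet → ℤ, i ∈ T →
      CV H (if v1 ∈ i then v1 else if v2 ∈ i then v2 else v3) i c ∧
      (i = D → c = ed h12 + ed h13 - ed h23) ∧
      (i ≠ D → ∀ z ∈ (bdry H).ker, ∃ n : ℤ, ∀ e : H.edgeSet, InS e i → z e = n * c e) := by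
    intro i
    by_cases hi : i ∈ T
    swap
    · exact ⟨0, fun h => absurd h hi⟩
    by_cases hiD : i = D
    · subst hiD
      refine ⟨_, fun _ => ⟨?_, fun _ => rfl, fun h => absurd rfl h⟩⟩
      rw [if_pos m1]
      exact tri_CV h12 h13 h23
    have hic := (hT i).1 hi
    set r := if v1 ∈ i then v1 else if v2 ∈ i then v2 else v3 with hr
    have hri : r ∈ i := by
      rw [hr]
      split_ifs with h1 h2
      · exact h1
      · exact h2
      · by_contra h3
        refine h1 (cyc_univ hE hC hic (fun u hu hbig => ?_) v1)
        rcases hB u hbig with rfl | rfl | rfl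
        · exact h1 hu
        · exact h2 hu
        · exact h3 hu
    have hrD : r ∈ D := by
      rw [hr]
      split_ifs
      · exact m1
      · exact m2
      · exact m3
    obtain ⟨c, hc1, hc2⟩ := exists_CV hE hic hri r (fun _ h => absurd rfl h)
    refine ⟨c, fun _ => ⟨hc1, fun h => absurd h hiD, fun _ z hz => ?_⟩⟩
    obtain ⟨n, hn⟩ := hc2 z (by
      intro u hu hur _
      refine ⟨fun hbig => ?_, by rw [AddMonoidHom.mem_ker.1 hz]; rfl⟩
      have huD : u ∈ D := by
        rcases hB u hbig with rfl | rfl | rfl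
        · exact m1
        · exact m2
        · exact m3
      exact hur (huniq i hi hiD u huD r hrD hu hri))
    refine ⟨n, fun e he => hn e he ?_⟩
    intro h
    have := e.2
    rw [h] at this
    exact H.irrefl this
  choose c0 hc0 using hch
  rw [ker_three hE T (fun i hi => (hT i).1 hi) h12 h13 h23 hDT c0 (fun i hi => (hc0 i hi).1)
    ((hc0 D hDT).2.1 rfl) hcov (fun i hi => (hc0 i hi).2.2)]
  exact three_stage K hE T (fun i hi => (hT i).1 hi) h12 h13 h23 hDT c0 (fun i hi => (hc0 i hi).1)
    ((hc0 D hDT).2.1 rfl)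
    (fun i hi hiD h1 h2 => h12.ne (huniq i hi hiD v1 m1 v2 m2 h1 h2))

lemma compact_inv (K : Type u) [Field K] (hH : IsCompactGraph H) :
    InvL K (bdry H).ker (cycleCount H - 1) := by
  obtain ⟨hC, hd, hE, hO⟩ := hH
  have hdeg := min_deg hd
  set T := (Set.toFinite {S | IsCyc H S}).toFinset with hTd
  have hT : ∀ i, i ∈ T ↔ IsCyc H i := by intro i; simp [hTd]
  rw [cycleCount_eq hE, Set.ncard_eq_toFinset_card _ (Set.toFinite _)]
  rcases shapes hdeg hE hO hC with ⟨v1, v2, h12, hB⟩ | ⟨v1, v2, v3, h12, h13, h23, hB⟩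
  · exact case_two K hC hdeg hE hO h12 hB T hT
  · exact case_three K hC hdeg hE hO h12 h13 h23 hB T hT

theorem final (K : Type u) [Field K] (hH : IsCompactGraph H) :
    projDim (MvPolynomial H.edgeSet K) (ModuleCat.of _ (edgeRing K H)) =
      ((cycleCount H - 1 : ℕ) : ℕ∞) :=
  alg_main K H _ (compact_inv K hH)

end GraphFive
end PartG5

/-- The projective dimension of the edge ring of a compact graph is
`t(H) - 1`, the number of minimal cycles minus one. -/
theorem statement4 (K : Type*) [Field K] (V : Type*) [Fintype V] (H : SimpleGraph V)
    (hH : IsCompactGraph H) :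
    projDim (MvPolynomial H.edgeSet K) (ModuleCat.of _ (edgeRing K H)) =
      ((cycleCount H - 1 : ℕ) : ℕ∞) := by
  exact final K hH

end Paper
end
end

section
/- Let m ≥ 2 and ℓ = (ℓ_1,…,ℓ_m) ∈ ℤ_{>0}^m, and let G = G_{2ℓ+1} be the odd multi-path graph. Then the minimal vectors of relint(ℝ₊(G)) ∩ ℤ^{V(G)} are exactly the m − 1 vectors α_k = Σ_{i=1}^{m} Σ_{j=1}^{2ℓ_i} ε_{u_{i,j}} + k·(ε_{v1} + ε_{v2}) for k = 1, …, m − 1. -/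
open CategoryTheory MvPolynomial Finset
open scoped Classical

noncomputable section

namespace Paper

/-! ### General facts on relative interiors of finitely generated cones. -/

theorem relint_pos {E V : Type*} [Fintype E] [Fintype V] (L : (E → ℝ) →ₗ[ℝ] (V → ℝ))
    (C : Set (V → ℝ)) (hC : ∀ x, x ∈ C ↔ ∃ f : E → ℝ, (∀ p, 0 ≤ f p) ∧ x = L f)
    (f : E → ℝ) (hf : ∀ p, 0 < f p) : L f ∈ intrinsicInterior ℝ C := by
  have hopen : IsOpenMap L.rangeRestrict := by
    have h := LinearMap.isOpenMap_of_finiteDimensional L.rangeRestrict L.surjective_rangeRestrict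
    exact h
  have hpos : IsOpen {g : E → ℝ | ∀ p, 0 < g p} := by
    simp only [Set.ofPred_forall]
    exact isOpen_iInter_of_finite fun p => isOpen_lt continuous_const (continuous_apply p)
  obtain ⟨U, hU, hUeq⟩ := isOpen_induced_iff.1 (hopen _ hpos)
  have hspan : affineSpan ℝ C ≤ (LinearMap.range L).toAffineSubspace := by
    rw [affineSpan_le]
    intro y hy
    obtain ⟨g, -, rfl⟩ := (hC y).1 hy
    exact ⟨g, rfl⟩
  have hmemC : L f ∈ C := (hC _).2 ⟨f, fun p => (hf p).le, rfl⟩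
  rw [mem_intrinsicInterior]
  refine ⟨⟨L f, subset_affineSpan ℝ C hmemC⟩, ?_, rfl⟩
  rw [mem_interior]
  refine ⟨Subtype.val ⁻¹' U, ?_, hU.preimage continuous_subtype_val, ?_⟩
  · rintro ⟨y, hy⟩ hyU
    have hyr : y ∈ LinearMap.range L := hspan hy
    have : (⟨y, hyr⟩ : LinearMap.range L) ∈ Subtype.val ⁻¹' U := hyU
    rw [hUeq] at this
    obtain ⟨g, hg, hgy⟩ := this
    refine (hC y).2 ⟨g, fun p => (hg p).le, ?_⟩
    exact (congrArg Subtype.val hgy).symm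
  · have : L.rangeRestrict f ∈ L.rangeRestrict '' {g : E → ℝ | ∀ p, 0 < g p} := ⟨f, hf, rfl⟩
    rw [← hUeq] at this
    exact this

theorem exists_pos_of_relint {E V : Type*} [Fintype E] [Fintype V] (L : (E → ℝ) →ₗ[ℝ] (V → ℝ))
    (C : Set (V → ℝ)) (hC : ∀ x, x ∈ C ↔ ∃ f : E → ℝ, (∀ p, 0 ≤ f p) ∧ x = L f)
    (x : V → ℝ) (hx : x ∈ intrinsicInterior ℝ C) :
    ∃ f : E → ℝ, (∀ p, 0 < f p) ∧ x = L f := by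
  obtain ⟨⟨y, hy⟩, hyint, rfl⟩ := mem_intrinsicInterior.1 hx
  have hyC : y ∈ C := by
    have h := interior_subset hyint
    exact h
  obtain ⟨g, hg, hgy⟩ := (hC y).1 hyC
  have hsC : y + L 1 ∈ C := (hC _).2 ⟨g + 1, fun p => by
    have := hg p
    simp only [Pi.add_apply, Pi.one_apply]; linarith, by rw [map_add, hgy]⟩
  have hline : ∀ t : ℝ, y - t • L 1 ∈ affineSpan ℝ C := fun t => by
    have := AffineMap.lineMap_mem (-t) hy (subset_affineSpan ℝ C hsC)
    rw [AffineMap.lineMap_apply_module] at this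
    convert this using 1
    module
  let γ : ℝ → affineSpan ℝ C := fun t => ⟨y - t • L 1, hline t⟩
  have hγ : Continuous γ := by
    apply Continuous.subtype_mk
    fun_prop
  have h0 : γ 0 = ⟨y, hy⟩ := by simp [γ]
  have hev : ∀ᶠ t in nhds (0 : ℝ), γ t ∈ interior ((↑) ⁻¹' C : Set (affineSpan ℝ C)) := by
    apply hγ.continuousAt.eventually_mem
    rw [h0]
    exact isOpen_interior.mem_nhds hyint
  obtain ⟨ε, hε, hball⟩ := Metric.eventually_nhds_iff.1 hev
  have hm := interior_subset (hball (y := ε / 2) (by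
    rw [Real.dist_eq, sub_zero, abs_of_pos (by linarith)]; linarith))
  have hm' : y - (ε / 2) • L 1 ∈ C := hm
  obtain ⟨f, hf, hfe⟩ := (hC _).1 hm'
  refine ⟨f + (ε / 2) • 1, fun p => ?_, ?_⟩
  · have := hf p
    simp only [Pi.add_apply, Pi.smul_apply, Pi.one_apply, smul_eq_mul]; linarith
  · rw [map_add, map_smul, ← hfe]
    simp

/-! ### Edge coordinates on multi-path graphs. -/

/-- Index set for the edges of the multi-path graph. -/
abbrev MPE {m : ℕ} (c : Fin m → ℕ) : Type := Σ i : Fin m, Fin (c i + 1)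

def lo {m : ℕ} (c : Fin m → ℕ) (p : MPE c) : MPV c :=
  Fin.cases (motive := fun _ => MPV c) (Sum.inl 0) (fun j => Sum.inr ⟨p.1, j⟩) p.2

def hi {m : ℕ} (c : Fin m → ℕ) (p : MPE c) : MPV c :=
  Fin.lastCases (motive := fun _ => MPV c) (Sum.inl 1) (fun j => Sum.inr ⟨p.1, j⟩) p.2

/-- The linear map from edge weights to vertex weights. -/
def mpL {m : ℕ} (c : Fin m → ℕ) : (MPE c → ℝ) →ₗ[ℝ] (MPV c → ℝ) where
  toFun f := Sum.elim
    (fun a => if a = 0 then ∑ i, f ⟨i, 0⟩ else ∑ i, f ⟨i, Fin.last (c i)⟩)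
    (fun q => f ⟨q.1, q.2.castSucc⟩ + f ⟨q.1, q.2.succ⟩)
  map_add' f g := by
    ext v
    rcases v with a | q
    · by_cases h : a = 0 <;> simp [h, Finset.sum_add_distrib]
    · simp; ring
  map_smul' r f := by
    ext v
    rcases v with a | q
    · by_cases h : a = 0 <;> simp [h, Finset.mul_sum]
    · simp; ring

theorem mpL_inl0 {m : ℕ} (c : Fin m → ℕ) (f : MPE c → ℝ) :
    mpL c f (Sum.inl 0) = ∑ i, f ⟨i, 0⟩ := by simp [mpL]

theorem mpL_inl1 {m : ℕ} (c : Fin m → ℕ) (f : MPE c → ℝ) :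
    mpL c f (Sum.inl 1) = ∑ i, f ⟨i, Fin.last (c i)⟩ := by simp [mpL]

theorem mpL_inr {m : ℕ} (c : Fin m → ℕ) (f : MPE c → ℝ) (i : Fin m) (j : Fin (c i)) :
    mpL c f (Sum.inr ⟨i, j⟩) = f ⟨i, j.castSucc⟩ + f ⟨i, j.succ⟩ := by simp [mpL]

theorem lo_zero {m : ℕ} (c : Fin m → ℕ) (i : Fin m) : lo c ⟨i, 0⟩ = Sum.inl 0 := rfl

theorem lo_succ {m : ℕ} (c : Fin m → ℕ) (i : Fin m) (j : Fin (c i)) :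
    lo c ⟨i, j.succ⟩ = Sum.inr ⟨i, j⟩ := rfl

theorem hi_last {m : ℕ} (c : Fin m → ℕ) (i : Fin m) :
    hi c ⟨i, Fin.last _⟩ = Sum.inl 1 := by simp [hi]

theorem hi_castSucc {m : ℕ} (c : Fin m → ℕ) (i : Fin m) (j : Fin (c i)) :
    hi c ⟨i, j.castSucc⟩ = Sum.inr ⟨i, j⟩ := by simp [hi]

theorem adj_lo_hi {m : ℕ} (c : Fin m → ℕ) (hc : ∀ i, 0 < c i) (p : MPE c) :
    (multiPath c).Adj (lo c p) (hi c p) := by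
  obtain ⟨i, k⟩ := p
  rw [multiPath, SimpleGraph.fromRel_adj]
  induction k using Fin.cases with
  | zero =>
    have h0 : (0 : Fin (c i + 1)) = (⟨0, hc i⟩ : Fin (c i)).castSucc := rfl
    rw [lo_zero, h0, hi_castSucc]
    exact ⟨by simp, Or.inl (Or.inl ⟨rfl, rfl⟩)⟩
  | succ j =>
    rw [lo_succ]
    by_cases hj : (j : ℕ) + 1 = c i
    · have : j.succ = Fin.last (c i) := Fin.ext hj
      rw [this, hi_last]
      exact ⟨by simp, Or.inr (Or.inr ⟨rfl, hj⟩)⟩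
    · have hlt : (j : ℕ) + 1 < c i := by omega
      have : j.succ = (⟨j + 1, hlt⟩ : Fin (c i)).castSucc := rfl
      rw [this, hi_castSucc]
      refine ⟨?_, Or.inl ⟨rfl, rfl⟩⟩
      intro h
      simp only [Sum.inr.injEq, Sigma.mk.injEq, heq_eq_eq, true_and] at h
      have := congrArg Fin.val h
      simp at this

theorem exists_of_rel {m : ℕ} (c : Fin m → ℕ) (u v : MPV c) (h : mpRel c u v) :
    ∃ p : MPE c, s(lo c p, hi c p) = s(u, v) := by
  rcases u with a | ⟨i, j⟩ <;> rcases v with b | ⟨i', j'⟩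
  · exact h.elim
  · rcases h with ⟨rfl, hj⟩ | ⟨rfl, hj⟩
    · refine ⟨⟨i', j'.castSucc⟩, ?_⟩
      have : j'.castSucc = 0 := Fin.ext hj
      rw [hi_castSucc, this, lo_zero]
    · refine ⟨⟨i', j'.succ⟩, ?_⟩
      have : j'.succ = Fin.last _ := Fin.ext hj
      rw [lo_succ, this, hi_last, Sym2.eq_swap]
  · exact h.elim
  · obtain ⟨hi', hj⟩ := h
    have := Fin.ext hi'
    subst this
    refine ⟨⟨i, j.succ⟩, ?_⟩
    have : j.succ = j'.castSucc := Fin.ext hj.symm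
    rw [lo_succ, this, hi_castSucc]

theorem exists_of_edge {m : ℕ} (c : Fin m → ℕ) (e : Sym2 (MPV c))
    (h : e ∈ (multiPath c).edgeSet) : ∃ p : MPE c, s(lo c p, hi c p) = e := by
  induction e using Sym2.ind with
  | _ u v =>
    rw [SimpleGraph.mem_edgeSet, multiPath, SimpleGraph.fromRel_adj] at h
    rcases h.2 with h | h
    · exact exists_of_rel c u v h
    · rw [Sym2.eq_swap]
      exact exists_of_rel c v u h

theorem lo_eq_inr {m : ℕ} (c : Fin m → ℕ) (p : MPE c) (i : Fin m) (j : Fin (c i)) :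
    lo c p = Sum.inr ⟨i, j⟩ ↔ p = ⟨i, j.succ⟩ := by
  constructor
  · obtain ⟨i', k⟩ := p
    induction k using Fin.cases with
    | zero => rw [lo_zero]; simp
    | succ j' =>
      rw [lo_succ]
      intro h
      cases h
      rfl
  · rintro rfl; exact lo_succ c i j

theorem hi_eq_inr {m : ℕ} (c : Fin m → ℕ) (p : MPE c) (i : Fin m) (j : Fin (c i)) :
    hi c p = Sum.inr ⟨i, j⟩ ↔ p = ⟨i, j.castSucc⟩ := by
  constructor
  · obtain ⟨i', k⟩ := p
    induction k using Fin.lastCases with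
    | last => rw [hi_last]; simp
    | cast j' =>
      rw [hi_castSucc]
      intro h
      cases h
      rfl
  · rintro rfl; exact hi_castSucc c i j

theorem lo_eq_inl0 {m : ℕ} (c : Fin m → ℕ) (p : MPE c) :
    lo c p = Sum.inl 0 ↔ p.2 = 0 := by
  obtain ⟨i', k⟩ := p
  induction k using Fin.cases with
  | zero => simp [lo_zero]
  | succ j' => simp [lo_succ]

theorem lo_ne_inl1 {m : ℕ} (c : Fin m → ℕ) (p : MPE c) :
    lo c p ≠ Sum.inl 1 := by
  obtain ⟨i', k⟩ := p
  induction k using Fin.cases with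
  | zero => simp [lo_zero]
  | succ j' => simp [lo_succ]

theorem hi_eq_inl1 {m : ℕ} (c : Fin m → ℕ) (p : MPE c) :
    hi c p = Sum.inl 1 ↔ p.2 = Fin.last _ := by
  obtain ⟨i', k⟩ := p
  induction k using Fin.lastCases with
  | last => simp [hi_last]
  | cast j' => simp [hi_castSucc]

theorem hi_ne_inl0 {m : ℕ} (c : Fin m → ℕ) (p : MPE c) :
    hi c p ≠ Sum.inl 0 := by
  obtain ⟨i', k⟩ := p
  induction k using Fin.lastCases with
  | last => simp [hi_last]
  | cast j' => simp [hi_castSucc]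

theorem sum_single_aux {m : ℕ} (c : Fin m → ℕ) (p : MPE c) (k : (i : Fin m) → Fin (c i + 1)) :
    ∑ i, (Pi.single p (1 : ℝ) : MPE c → ℝ) ⟨i, k i⟩ = if p.2 = k p.1 then 1 else 0 := by
  rw [Finset.sum_eq_single p.1]
  · by_cases h : p.2 = k p.1
    · rw [if_pos h, ← h]; simp
    · rw [if_neg h]
      apply Pi.single_eq_of_ne
      intro h'
      obtain ⟨i, q⟩ := p
      apply h
      simp only [Sigma.mk.injEq, heq_eq_eq, true_and] at h'
      exact h'.symm
  · intro i _ hi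
    apply Pi.single_eq_of_ne
    rintro rfl
    exact hi rfl
  · simp

theorem edgeVec_eq {m : ℕ} (c : Fin m → ℕ) (hc : ∀ i, 0 < c i) (p : MPE c) :
    edgeVec s(lo c p, hi c p) = mpL c (Pi.single p 1) := by
  have hne := (adj_lo_hi c hc p).ne
  ext v
  have hsplit : edgeVec s(lo c p, hi c p) v =
      (if lo c p = v then 1 else 0) + (if hi c p = v then 1 else 0) := by
    unfold edgeVec
    simp only [Sym2.mem_iff]
    by_cases h1 : lo c p = v
    · have h2 : ¬ hi c p = v := fun h => hne (h1.trans h.symm)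
      simp [h1, h2]
    · by_cases h2 : hi c p = v
      · simp [h1, h2]
      · rw [if_neg, if_neg h1, if_neg h2, add_zero]
        rintro (h | h)
        · exact h1 h.symm
        · exact h2 h.symm
  rw [hsplit]
  rcases v with a | ⟨i, j⟩
  · fin_cases a
    · simp only [Fin.zero_eta, mpL_inl0, lo_eq_inl0, hi_ne_inl0, if_false, add_zero]
      rw [sum_single_aux c p (fun _ => 0)]
    · simp only [Fin.mk_one, mpL_inl1, hi_eq_inl1, lo_ne_inl1, if_false, zero_add]
      rw [sum_single_aux c p (fun i => Fin.last (c i))]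
  · rw [mpL_inr]
    simp only [lo_eq_inr, hi_eq_inr, Pi.single_apply, eq_comm (a := p)]
    rw [add_comm]

theorem mem_edgeCone_iff {m : ℕ} (c : Fin m → ℕ) (hc : ∀ i, 0 < c i) (x : MPV c → ℝ) :
    x ∈ edgeCone (multiPath c) ↔ ∃ f : MPE c → ℝ, (∀ p, 0 ≤ f p) ∧ x = mpL c f := by
  constructor
  · rintro ⟨a, ha0, haE, rfl⟩
    have key : ∀ e, ∃ f : MPE c → ℝ, (∀ p, 0 ≤ f p) ∧ a e • edgeVec e = mpL c f := by
      intro e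
      by_cases he : e ∈ (multiPath c).edgeSet
      · obtain ⟨p, rfl⟩ := exists_of_edge c e he
        refine ⟨a s(lo c p, hi c p) • Pi.single p 1, fun q => ?_, ?_⟩
        · have : (0 : ℝ) ≤ (Pi.single p (1 : ℝ) : MPE c → ℝ) q := by
            rw [Pi.single_apply]; split_ifs <;> norm_num
          exact mul_nonneg (ha0 _) this
        · rw [map_smul, edgeVec_eq c hc]
      · exact ⟨0, fun _ => le_rfl, by rw [haE e he, zero_smul, map_zero]⟩
    choose F hF0 hF using key
    refine ⟨∑ e, F e, fun p => ?_, ?_⟩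
    · rw [Finset.sum_apply]
      exact Finset.sum_nonneg fun e _ => hF0 e p
    · rw [map_sum]
      exact Finset.sum_congr rfl fun e _ => hF e
  · rintro ⟨f, hf, rfl⟩
    refine ⟨fun e => ∑ p : MPE c, if s(lo c p, hi c p) = e then f p else 0, ?_, ?_, ?_⟩
    · intro e
      apply Finset.sum_nonneg
      intro p _
      split_ifs
      · exact hf p
      · exact le_rfl
    · intro e he
      apply Finset.sum_eq_zero
      intro p _
      rw [if_neg]
      rintro rfl
      exact he (adj_lo_hi c hc p)
    · simp only [Finset.sum_smul]
      rw [Finset.sum_comm]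
      have hfs : f = ∑ p, f p • (Pi.single p 1 : MPE c → ℝ) := by
        ext q
        simp [Finset.sum_apply, Pi.single_apply]
      conv_lhs => rw [hfs, map_sum]
      apply Finset.sum_congr rfl
      intro p _
      rw [map_smul, ← edgeVec_eq c hc]
      simp [ite_smul]

/-! ### The vectors `α_k`. -/

/-- The alternating edge weights with parameters `s i`. -/
def altW {m : ℕ} (c : Fin m → ℕ) (s : Fin m → ℝ) : MPE c → ℝ :=
  fun p => if Even (p.2 : ℕ) then s p.1 else 1 - s p.1

theorem mpL_altW {m : ℕ} (c : Fin m → ℕ) (hc : ∀ i, Even (c i)) (s : Fin m → ℝ) (k : ℝ)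
    (hk : ∑ i, s i = k) : mpL c (altW c s) = Sum.elim (fun _ => k) (fun _ => 1) := by
  ext v
  rcases v with a | ⟨i, j⟩
  · fin_cases a
    · simp [mpL_inl0, altW, hk]
    · simp [mpL_inl1, altW, hk, hc]
  · rw [mpL_inr]
    by_cases h : Even (j : ℕ)
    · simp [altW, h, Nat.even_add_one]
    · simp [altW, h, Nat.even_add_one]

theorem alpha_mem {m : ℕ} (c : Fin m → ℕ) (hc0 : ∀ i, 0 < c i) (hc : ∀ i, Even (c i)) (k : ℕ)
    (hk1 : 1 ≤ k) (hk : k < m) :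
    (Sum.elim (fun _ => (k : ℝ)) (fun _ => 1) : MPV c → ℝ) ∈
      intrinsicInterior ℝ (edgeCone (multiPath c)) := by
  have hkpos : (0 : ℝ) < k := by exact_mod_cast hk1
  have hkm : (k : ℝ) < m := by exact_mod_cast hk
  have hmpos : (0 : ℝ) < m := hkpos.trans hkm
  rw [← mpL_altW c hc (fun _ => (k : ℝ) / m) k (by simp; field_simp)]
  apply relint_pos _ _ (mem_edgeCone_iff c hc0)
  intro p
  unfold altW
  have h1 : (k : ℝ) / m < 1 := by rwa [div_lt_one hmpos]
  have h2 : 0 < (k : ℝ) / m := by positivity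
  split_ifs
  · exact h2
  · linarith

theorem alpha_integral {m : ℕ} (c : Fin m → ℕ) (k : ℕ) :
    IsIntegralVec (Sum.elim (fun _ => (k : ℝ)) (fun _ => 1) : MPV c → ℝ) := by
  rintro (a | q)
  · exact ⟨k, by simp⟩
  · exact ⟨1, by simp⟩

/-- Adjusted fractional parts with integral sum strictly between `0` and `m`. -/
theorem exists_frac {m : ℕ} (hm : 2 ≤ m) (t : Fin m → ℝ) (n : ℤ) (ht : ∑ i, t i = n) :
    ∃ (s : Fin m → ℝ) (k : ℕ), (∀ i, 0 ≤ s i ∧ s i ≤ 1) ∧ (∀ i, ∃ z : ℤ, t i = s i + z) ∧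
      ∑ i, s i = k ∧ 1 ≤ k ∧ k < m := by
  have hm2 : (2 : ℝ) ≤ m := by exact_mod_cast hm
  by_cases h : ∀ i, Int.fract (t i) = 0
  · let i0 : Fin m := ⟨0, by omega⟩
    refine ⟨Pi.single i0 1, 1, fun i => ?_, fun i => ?_, by simp, le_rfl, by omega⟩
    · rw [Pi.single_apply]; split_ifs <;> norm_num
    · have h1 : t i = ⌊t i⌋ := by
        have := Int.floor_add_fract (t i)
        rw [h i] at this
        linarith
      rw [Pi.single_apply]
      split_ifs
      · exact ⟨⌊t i⌋ - 1, by push_cast; linarith⟩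
      · exact ⟨⌊t i⌋, by linarith⟩
  · push Not at h
    obtain ⟨i0, hi0⟩ := h
    have hsum : ∑ i, Int.fract (t i) = ((n - ∑ i, ⌊t i⌋ : ℤ) : ℝ) := by
      push_cast
      rw [← ht, ← Finset.sum_sub_distrib]
      rfl
    have hpos : 0 < ∑ i, Int.fract (t i) :=
      Finset.sum_pos' (fun i _ => Int.fract_nonneg _)
        ⟨i0, Finset.mem_univ _, lt_of_le_of_ne (Int.fract_nonneg _) hi0.symm⟩
    have hlt : ∑ i, Int.fract (t i) < m := by
      have : ∑ i, Int.fract (t i) < ∑ i : Fin m, (1 : ℝ) :=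
        Finset.sum_lt_sum_of_nonempty ⟨i0, Finset.mem_univ _⟩ fun i _ => Int.fract_lt_one _
      simpa using this
    set N : ℤ := n - ∑ i, ⌊t i⌋ with hN
    rw [hsum] at hpos hlt
    have hNpos : 0 < N := by exact_mod_cast hpos
    have hNlt : N < m := by exact_mod_cast hlt
    refine ⟨fun i => Int.fract (t i), N.toNat,
      fun i => ⟨Int.fract_nonneg _, (Int.fract_lt_one _).le⟩,
      fun i => ⟨⌊t i⌋, (Int.fract_add_floor _).symm⟩, ?_, by omega, by omega⟩
    rw [hsum]
    have : ((N.toNat : ℤ) : ℝ) = (N : ℝ) := by rw [Int.toNat_of_nonneg hNpos.le]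
    rw [← this, Int.cast_natCast]

/-- The key decomposition. -/
theorem exists_alpha {m : ℕ} (hm : 2 ≤ m) (c : Fin m → ℕ) (hc0 : ∀ i, 0 < c i)
    (hc : ∀ i, Even (c i)) (x : MPV c → ℝ)
    (hx : x ∈ intrinsicInterior ℝ (edgeCone (multiPath c))) (hxi : IsIntegralVec x) :
    ∃ k : ℕ, 1 ≤ k ∧ k < m ∧
      x - (Sum.elim (fun _ => (k : ℝ)) (fun _ => 1) : MPV c → ℝ) ∈ edgeCone (multiPath c) := by
  obtain ⟨a, ha, rfl⟩ := exists_pos_of_relint _ _ (mem_edgeCone_iff c hc0) x hx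
  obtain ⟨n, hn⟩ := hxi (Sum.inl 0)
  rw [mpL_inl0] at hn
  obtain ⟨s, k, hs, hst, hsk, hk1, hkm⟩ := exists_frac hm _ n hn
  refine ⟨k, hk1, hkm, ?_⟩
  rw [← mpL_altW c hc s k hsk, ← map_sub, mem_edgeCone_iff c hc0]
  refine ⟨_, ?_, rfl⟩
  rintro ⟨i, q⟩
  obtain ⟨hs0, hs1⟩ := hs i
  have key : ∀ q : Fin (c i + 1), ∃ z : ℤ, a ⟨i, q⟩ - altW c s ⟨i, q⟩ = z := by
    intro q
    induction q using Fin.induction with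
    | zero =>
      obtain ⟨z, hz⟩ := hst i
      exact ⟨z, by simp [altW, hz]⟩
    | succ j ih =>
      obtain ⟨z, hz⟩ := ih
      obtain ⟨w, hw⟩ := hxi (Sum.inr ⟨i, j⟩)
      have h1 := congrFun (mpL_altW c hc s k hsk) (Sum.inr ⟨i, j⟩)
      rw [mpL_inr] at hw h1
      simp only [Sum.elim_inr] at h1
      exact ⟨w - 1 - z, by push_cast; linarith⟩
  obtain ⟨z, hz⟩ := key q
  have hpos := ha ⟨i, q⟩
  have hw : altW c s ⟨i, q⟩ ≤ 1 ∧ 0 ≤ altW c s ⟨i, q⟩ := by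
    unfold altW
    split_ifs
    · exact ⟨hs1, hs0⟩
    · constructor <;> simp only <;> linarith
  rw [Pi.sub_apply, hz]
  have : (-1 : ℝ) < z := by linarith [hw.1]
  have h2 : -1 < z := by exact_mod_cast this
  have h3 : 0 ≤ z := by omega
  exact_mod_cast h3

theorem integral_sub {V : Type*} {x y : V → ℝ} (hx : IsIntegralVec x) (hy : IsIntegralVec y) :
    IsIntegralVec (x - y) := fun v => by
  obtain ⟨a, ha⟩ := hx v
  obtain ⟨b, hb⟩ := hy v
  exact ⟨a - b, by rw [Pi.sub_apply, ha, hb]; push_cast; rfl⟩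

theorem alpha_minimal {m : ℕ} (c : Fin m → ℕ) (hc0 : ∀ i, 0 < c i) (k : ℕ) (y z : MPV c → ℝ)
    (hy : y ∈ intrinsicInterior ℝ (edgeCone (multiPath c))) (hyi : IsIntegralVec y)
    (hz : z ∈ edgeCone (multiPath c))
    (h : (Sum.elim (fun _ => (k : ℝ)) (fun _ => 1) : MPV c → ℝ) = y + z) : z = 0 := by
  obtain ⟨a, ha, rfl⟩ := exists_pos_of_relint _ _ (mem_edgeCone_iff c hc0) y hy
  obtain ⟨b, hb, rfl⟩ := (mem_edgeCone_iff c hc0 z).1 hz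
  have key : ∀ i (j : Fin (c i)), b ⟨i, j.castSucc⟩ = 0 ∧ b ⟨i, j.succ⟩ = 0 := by
    intro i j
    have h1 := congrFun h (Sum.inr ⟨i, j⟩)
    obtain ⟨w, hw⟩ := hyi (Sum.inr ⟨i, j⟩)
    rw [Pi.add_apply, hw, mpL_inr, Sum.elim_inr] at h1
    rw [mpL_inr] at hw
    have hwpos : (0 : ℝ) < w := by
      rw [← hw]; exact add_pos (ha _) (ha _)
    have hw1 : 1 ≤ w := by
      have : 0 < w := by exact_mod_cast hwpos
      omega
    have hw1' : (1 : ℝ) ≤ w := by exact_mod_cast hw1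
    have hb1 := hb ⟨i, j.castSucc⟩
    have hb2 := hb ⟨i, j.succ⟩
    constructor <;> linarith
  have hb0 : b = 0 := by
    ext ⟨i, q⟩
    induction q using Fin.cases with
    | zero => exact (key i ⟨0, hc0 i⟩).1
    | succ j => exact (key i j).2
  rw [hb0, map_zero]

/-- Minimal vectors of the relative interior of the edge cone of the odd
multi-path graph `G_{2ℓ+1}`. -/
theorem statement5 (m : ℕ) (hm : 2 ≤ m) (ℓ : Fin m → ℕ) (hℓ : ∀ i, 1 ≤ ℓ i) :
    {x : MPV (fun i => 2 * ℓ i) → ℝ | IsMinimalVec (multiPath (fun i => 2 * ℓ i)) x} =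
      {x : MPV (fun i => 2 * ℓ i) → ℝ | ∃ k : ℕ, 1 ≤ k ∧ k ≤ m - 1 ∧
        x = Sum.elim (fun _ => (k : ℝ)) (fun _ => 1)} := by
  have hc0 : ∀ i, 0 < (fun i => 2 * ℓ i) i := fun i => by
    have := hℓ i
    simp only; omega
  have hc : ∀ i, Even ((fun i => 2 * ℓ i) i) := fun i => even_two_mul _
  ext x
  simp only [Set.mem_setOf_eq]
  constructor
  · rintro ⟨hx, hxi, hmin⟩
    obtain ⟨k, hk1, hkm, hk⟩ := exists_alpha hm _ hc0 hc x hx hxi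
    refine ⟨k, hk1, by omega, ?_⟩
    by_contra hne
    exact hmin ⟨_, _, ⟨alpha_mem _ hc0 hc k hk1 hkm, alpha_integral _ k⟩,
      ⟨hk, integral_sub hxi (alpha_integral _ k), sub_ne_zero.2 hne⟩, (add_sub_cancel _ _).symm⟩
  · rintro ⟨k, hk1, hkm, rfl⟩
    refine ⟨alpha_mem _ hc0 hc k hk1 (by omega), alpha_integral _ k, ?_⟩
    rintro ⟨y, z, ⟨hy, hyi⟩, ⟨hz, -, hz0⟩, h⟩
    exact hz0 (alpha_minimal _ hc0 k y z hy hyi hz h)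

end Paper
end
end
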